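/- Let 𝕂 be a number field with r = r₁ + r₂ − 1 ≥ 1 and set η = 4^{r₂}π^{n}/|d_𝕂|. Assume that every non-trivial zero of ζ_𝕂 is simple and that for every x > 0 the series ∑_ρ x^{ρ} Γ^{r₁}((1−ρ)/2) Γ^{r₂}(1−ρ)/ζ_𝕂′(ρ), taken over the non-trivial zeros ρ of ζ_𝕂, converges (is summable). Then for all α, β > 0 with αβ = η: √α ∑_{m≥1} (b_m/m) Z_{r₁,r₂}(α/m) − √β ∑_{m≥1} (b_m/m) Z_{r₁,r₂}(β/m) = −(1/(√β (r−1)!)) · [d^{r−1}/ds^{r−1} ( (s−1)^{r} β^{s} Γ^{r₁}((1−s)/2) Γ^{r₂}(1−s)/ζ_𝕂(s) )]_{s=1} − (1/(√β (r−1)!)) · [d^{r−1}/ds^{r−1} ( s^{r} β^{s} Γ^{r₁}((1−s)/2) Γ^{r₂}(1−s)/ζ_𝕂(s) )]_{s=0} − (1/√β) ∑_ρ β^{ρ} Γ^{r₁}((1−ρ)/2) Γ^{r₂}(1−ρ)/ζ_𝕂′(ρ). -/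

import Mathlib

open Complex NumberField Filter MeasureTheory Topology

/-- `Z_{r₁,r₂}(x)`, defined as the inverse Mellin transform
`(1/(2πi)) ∫_{Re s = c} Γ^{r₁}(s/2) Γ^{r₂}(s) x^{−s} ds` on the line `Re s = -1/4`
(the value is independent of the choice of `c ∈ (-1/2, 0)`). -/
noncomputable def Z (r₁ r₂ : ℕ) (x : ℝ) : ℂ :=
  mellinInv (-(1/4)) (fun s => (Complex.Gamma (s / 2)) ^ r₁ * (Complex.Gamma s) ^ r₂) x

theorem summable_pi_prod_of_nonneg {ι κ : Type*} [Fintype ι] {f : κ → ℝ}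
    (hf0 : ∀ k, 0 ≤ f k) (hf : Summable f) : Summable fun m : ι → κ => ∏ i, f (m i) := by
  classical
  refine summable_of_sum_le (c := ∏ _i : ι, ∑' k, f k) (fun m => Finset.prod_nonneg fun i _ => hf0 _)
    fun s => ?_
  calc ∑ m ∈ s, ∏ i, f (m i)
      ≤ ∑ m ∈ Fintype.piFinset (fun i => s.image fun m => m i), ∏ i, f (m i) := by
        refine Finset.sum_le_sum_of_subset_of_nonneg (fun m hm => ?_)
          fun m _ _ => Finset.prod_nonneg fun i _ => hf0 _
        exact Fintype.mem_piFinset.2 fun i => Finset.mem_image_of_mem _ hm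
    _ = ∏ i, ∑ k ∈ s.image (fun m => m i), f k := (Finset.prod_univ_sum _ _).symm
    _ ≤ _ := Finset.prod_le_prod (fun i _ => Finset.sum_nonneg fun k _ => hf0 k)
        fun i _ => hf.sum_le_tsum _ fun k _ => hf0 k

theorem summable_exp_neg_mul_sq_int {c : ℝ} (hc : 0 < c) :
    Summable fun m : ℤ => Real.exp (-c * (m : ℝ) ^ 2) := by
  have h : Summable fun m : ℕ => Real.exp (-c * (m : ℝ) ^ 2) := by
    refine Summable.of_nonneg_of_le (fun m => (Real.exp_pos _).le) (fun m => ?_)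
      (Real.summable_pow_mul_exp_neg_nat_mul 0 hc)
    rw [pow_zero, one_mul]
    refine Real.exp_le_exp.2 ?_
    have h1 : (m : ℝ) ≤ (m : ℝ) ^ 2 := by exact_mod_cast Nat.le_self_pow two_ne_zero m
    nlinarith
  refine Summable.of_nat_of_neg (by simpa using h) (by simpa using h)

theorem summable_exp_neg_mul_sum_sq {ι : Type*} [Fintype ι] {c : ℝ} (hc : 0 < c) :
    Summable fun m : ι → ℤ => Real.exp (-c * ∑ i, (m i : ℝ) ^ 2) := by
  refine (summable_pi_prod_of_nonneg (ι := ι) (fun k : ℤ => (Real.exp_pos (-c * (k : ℝ) ^ 2)).le)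
    (summable_exp_neg_mul_sq_int hc)).congr fun m => ?_
  rw [Finset.mul_sum, Real.exp_sum]

theorem exists_pos_mul_sum_sq_le {ι : Type*} [Fintype ι] [DecidableEq ι] {B : Matrix ι ι ℝ}
    (hB : B.det ≠ 0) :
    ∃ κ : ℝ, 0 < κ ∧ ∀ y : ι → ℝ, κ * ∑ i, y i ^ 2 ≤ ∑ i, (B.mulVec y) i ^ 2 := by
  set C : ℝ := ∑ i, ∑ j, (B⁻¹ i j) ^ 2 with hC
  have hC0 : 0 ≤ C := by positivity
  refine ⟨(C + 1)⁻¹, by positivity, fun y => ?_⟩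
  have hy : y = B⁻¹.mulVec (B.mulVec y) := by
    rw [Matrix.mulVec_mulVec, Matrix.nonsing_inv_mul _ (isUnit_iff_ne_zero.2 hB), Matrix.one_mulVec]
  have h1 : ∑ i, y i ^ 2 ≤ C * ∑ i, (B.mulVec y) i ^ 2 := by
    conv_lhs => rw [hy]
    rw [hC, Finset.sum_mul]
    exact Finset.sum_le_sum fun i _ => Finset.sum_mul_sq_le_sq_mul_sq _ _ _
  have h2 : 0 ≤ ∑ i, (B.mulVec y) i ^ 2 := by positivity
  rw [inv_mul_le_iff₀ (by positivity)]
  nlinarith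

section Poisson

variable {ι : Type*} [Fintype ι] [DecidableEq ι]

/-- The Gaussian `y ↦ exp (-π ‖B y‖²)`. -/
noncomputable def gaussianMat (B : Matrix ι ι ℝ) (y : ι → ℝ) : ℝ :=
  Real.exp (-Real.pi * ∑ i, (B.mulVec y) i ^ 2)

omit [DecidableEq ι] in
theorem continuous_gaussianMat (B : Matrix ι ι ℝ) : Continuous (gaussianMat B) := by
  unfold gaussianMat Matrix.mulVec dotProduct
  fun_prop

omit [DecidableEq ι] in
theorem gaussianMat_pos (B : Matrix ι ι ℝ) (y : ι → ℝ) : 0 < gaussianMat B y := Real.exp_pos _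

theorem exists_gaussianMat_le {B : Matrix ι ι ℝ} (hB : B.det ≠ 0) :
    ∃ κ : ℝ, 0 < κ ∧ ∀ y : ι → ℝ, gaussianMat B y ≤ Real.exp (-κ * ∑ i, y i ^ 2) := by
  obtain ⟨κ, hκ, h⟩ := exists_pos_mul_sum_sq_le hB
  refine ⟨Real.pi * κ, by positivity, fun y => Real.exp_le_exp.2 ?_⟩
  have := mul_le_mul_of_nonneg_left (h y) Real.pi_pos.le
  linarith

theorem summable_gaussianMat {B : Matrix ι ι ℝ} (hB : B.det ≠ 0) :
    Summable fun m : ι → ℤ => gaussianMat B (fun i => (m i : ℝ)) := by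
  obtain ⟨κ, hκ, h⟩ := exists_gaussianMat_le hB
  exact Summable.of_nonneg_of_le (fun m => (gaussianMat_pos _ _).le) (fun m => h _)
    (summable_exp_neg_mul_sum_sq hκ)

theorem integrable_gaussianMat {B : Matrix ι ι ℝ} (hB : B.det ≠ 0) :
    Integrable (gaussianMat B) := by
  obtain ⟨κ, hκ, h⟩ := exists_gaussianMat_le hB
  have : Integrable fun y : ι → ℝ => Real.exp (-κ * ∑ i, y i ^ 2) := by
    have := MeasureTheory.Integrable.fintype_prod (ι := ι) (μ := fun _ => volume)
      (f := fun _ (x : ℝ) => Real.exp (-κ * x ^ 2)) (fun _ => integrable_exp_neg_mul_sq hκ)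
    refine this.congr (ae_of_all _ fun y => ?_)
    simp only [Finset.mul_sum, Real.exp_sum]
  refine this.mono' (continuous_gaussianMat B).aestronglyMeasurable (ae_of_all _ fun y => ?_)
  rw [Real.norm_of_nonneg (gaussianMat_pos _ _).le]
  exact h y

theorem fourier_gaussianMat {B : Matrix ι ι ℝ} (hB : B.det ≠ 0) (k : ι → ℤ) :
    ∫ y : ι → ℝ, Complex.exp (-(2 * Real.pi * I * ∑ i, (k i : ℂ) * y i)) * (gaussianMat B y : ℂ) =
      ((|B.det|⁻¹ * gaussianMat (B⁻¹).transpose (fun i => (k i : ℝ)) : ℝ) : ℂ) := by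
  set w : ι → ℝ := ((B⁻¹).transpose).mulVec (fun i => (k i : ℝ)) with hw
  set F : (ι → ℝ) → ℂ := fun z => Complex.exp (-(Real.pi : ℂ) * ∑ i, (z i : ℂ) ^ 2 +
    ∑ i, (-(2 * Real.pi * I * w i)) * (z i : ℂ)) with hF
  have hunit : IsUnit B.det := isUnit_iff_ne_zero.2 hB
  have h1 : ∀ y : ι → ℝ, Complex.exp (-(2 * Real.pi * I * ∑ i, (k i : ℂ) * y i)) *
      (gaussianMat B y : ℂ) = F (Matrix.toLin' B y) := by
    intro y
    have hdot : ∑ i, (k i : ℝ) * y i = ∑ i, w i * (B.mulVec y) i := by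
      have : (fun i => (k i : ℝ)) ⬝ᵥ y = w ⬝ᵥ (B.mulVec y) := by
        rw [hw, Matrix.mulVec_transpose, ← Matrix.dotProduct_mulVec, Matrix.mulVec_mulVec,
          Matrix.nonsing_inv_mul _ hunit, Matrix.one_mulVec]
      exact this
    have hdot' : ∑ i, (k i : ℂ) * y i = ∑ i, (w i : ℂ) * ((B.mulVec y) i : ℝ) := by
      exact_mod_cast hdot
    rw [hF, gaussianMat, hdot', Complex.ofReal_exp, ← Complex.exp_add]
    congr 1
    simp only [Matrix.toLin'_apply]
    push_cast
    rw [Finset.mul_sum, ← Finset.sum_neg_distrib, add_comm]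
    congr 1
    exact Finset.sum_congr rfl fun i _ => by ring
  simp_rw [h1]
  have hmap := Real.map_matrix_volume_pi_eq_smul_volume_pi hB
  have hcont : Continuous F := by rw [hF]; fun_prop
  have h2 : ∫ y, F (Matrix.toLin' B y) = ∫ z, F z ∂(Measure.map (Matrix.toLin' B) volume) := by
    rw [integral_map (LinearMap.continuous_of_finiteDimensional _).aemeasurable
      hcont.aestronglyMeasurable]
  rw [h2, hmap, integral_smul_measure, ENNReal.toReal_ofReal (abs_nonneg _), hF,
    GaussianFourier.integral_cexp_neg_mul_sum_add (by simpa using Real.pi_pos)]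
  have hpi : (Real.pi : ℂ) ≠ 0 := by exact_mod_cast Real.pi_ne_zero
  rw [div_self hpi, Complex.one_cpow, one_mul, gaussianMat, abs_inv, Complex.real_smul]
  push_cast
  congr 2
  rw [Finset.sum_div, Finset.mul_sum]
  refine Finset.sum_congr rfl fun i _ => ?_
  rw [← hw]
  field_simp
  rw [I_sq]
  ring

omit [DecidableEq ι] in
theorem half_sum_sq_sub_le {R : ℝ} {y : ι → ℝ} (hy : ∀ i, |y i| ≤ R) (m : ι → ℤ) :
    (1 / 2) * ∑ i, (m i : ℝ) ^ 2 - Fintype.card ι * R ^ 2 ≤ ∑ i, (y i + m i) ^ 2 := by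
  have : ∑ i, ((1 / 2) * (m i : ℝ) ^ 2 - R ^ 2) ≤ ∑ i, (y i + m i) ^ 2 := by
    refine Finset.sum_le_sum fun i _ => ?_
    have h1 : y i ^ 2 ≤ R ^ 2 := sq_le_sq.2 ((hy i).trans (le_abs_self R))
    have h2 : 0 ≤ ((m i : ℝ) + 2 * y i) ^ 2 := sq_nonneg _
    linarith [show ((m i : ℝ) + 2 * y i) ^ 2 =
      2 * ((y i + m i) ^ 2 - (1 / 2 * (m i : ℝ) ^ 2 - y i ^ 2)) by ring]
  rwa [Finset.sum_sub_distrib, ← Finset.mul_sum, Finset.sum_const, nsmul_eq_mul,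
    Finset.card_univ] at this

theorem exists_summable_bound_gaussianMat_add {B : Matrix ι ι ℝ} (hB : B.det ≠ 0) (R : ℝ) :
    ∃ u : (ι → ℤ) → ℝ, Summable u ∧ ∀ y : ι → ℝ, (∀ i, |y i| ≤ R) → ∀ m : ι → ℤ,
      gaussianMat B (fun i => y i + m i) ≤ u m := by
  obtain ⟨κ, hκ, h⟩ := exists_gaussianMat_le hB
  have hsum : Summable fun m : ι → ℤ => Real.exp (κ * (Fintype.card ι * R ^ 2)) *
      Real.exp (-(κ / 2) * ∑ i, (m i : ℝ) ^ 2) :=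
    (summable_exp_neg_mul_sum_sq (half_pos hκ)).mul_left _
  refine ⟨_, hsum, fun y hy m => (h fun i => y i + m i).trans ?_⟩
  rw [← Real.exp_add]
  have := mul_le_mul_of_nonneg_left (half_sum_sq_sub_le hy m) hκ.le
  exact Real.exp_le_exp.2 (by linarith)

theorem continuous_tsum_gaussianMat_add {B : Matrix ι ι ℝ} (hB : B.det ≠ 0) :
    Continuous fun y : ι → ℝ => ∑' m : ι → ℤ, (gaussianMat B (fun i => y i + m i) : ℂ) := by
  refine continuous_iff_continuousAt.2 fun y₀ => ?_
  obtain ⟨u, hu, hle⟩ := exists_summable_bound_gaussianMat_add hB (‖y₀‖ + 1)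
  have hc : ContinuousOn (fun y : ι → ℝ => ∑' m : ι → ℤ, (gaussianMat B (fun i => y i + m i) : ℂ))
      (Metric.ball y₀ 1) := by
    refine continuousOn_tsum (fun m => ?_) hu fun m y hy => ?_
    · exact (Complex.continuous_ofReal.comp ((continuous_gaussianMat B).comp
        (by fun_prop))).continuousOn
    · rw [Complex.norm_real, Real.norm_of_nonneg (gaussianMat_pos _ _).le]
      refine hle y (fun i => (norm_le_pi_norm y i).trans ?_) m
      have := norm_sub_norm_le y y₀
      have h2 := mem_ball_iff_norm.1 hy
      linarith
  exact hc.continuousAt (Metric.ball_mem_nhds _ one_pos)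

omit [DecidableEq ι] in
theorem setIntegral_box_translate {E : Type*} [NormedAddCommGroup E] [NormedSpace ℝ E]
    (G : (ι → ℝ) → E) (m : ι → ℤ) :
    ∫ y in {x : ι → ℝ | ∀ i, x i ∈ Set.Ioc (m i : ℝ) (m i + 1)}, G y =
      ∫ y in {x : ι → ℝ | ∀ i, x i ∈ Set.Ioc (((0 : ι → ℤ) i : ℤ) : ℝ) (((0 : ι → ℤ) i : ℤ) + 1)},
        G (fun i => y i + m i) := by
  have hmp : MeasurePreserving (fun y : ι → ℝ => y + fun i => (m i : ℝ)) volume volume :=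
    measurePreserving_add_right _ _
  rw [← hmp.setIntegral_preimage_emb (measurableEmbedding_addRight _) G]
  congr 2
  ext y
  simp only [Set.mem_preimage, Set.mem_ofPred_eq, Pi.add_apply, Pi.zero_apply, Int.cast_zero,
    Set.mem_Ioc]
  refine forall_congr' fun i => ?_
  constructor <;> rintro ⟨h1, h2⟩ <;> constructor <;> linarith

/-- Poisson summation for the lattice `ℤ^ι` and a Gaussian. -/
theorem tsum_gaussianMat {B : Matrix ι ι ℝ} (hB : B.det ≠ 0) :
    ∑' m : ι → ℤ, gaussianMat B (fun i => (m i : ℝ)) =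
      |B.det|⁻¹ * ∑' m : ι → ℤ, gaussianMat (B⁻¹).transpose (fun i => (m i : ℝ)) := by
  set F : (ι → ℝ) → ℂ := fun y => ∑' m : ι → ℤ, (gaussianMat B (fun i => y i + m i) : ℂ) with hF
  have hFc : Continuous F := continuous_tsum_gaussianMat_add hB
  have hFper : ∀ (y : ι → ℝ) (k : ι → ℤ), F (fun i => y i + k i) = F y := by
    intro y k
    rw [hF]
    simp only
    rw [← (Equiv.addLeft k).tsum_eq fun m : ι → ℤ => (gaussianMat B (fun i => y i + m i) : ℂ)]
    refine tsum_congr fun m => ?_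
    congr 2
    funext i
    simp only [Equiv.coe_addLeft, Pi.add_apply]
    push_cast
    ring
  set pr : (ι → ℝ) → UnitAddTorus ι := Pi.map (fun _ => ((↑) : ℝ → UnitAddCircle)) with hpr
  have hprq : IsOpenQuotientMap pr := IsOpenQuotientMap.piMap fun _ =>
    QuotientAddGroup.isOpenQuotientMap_mk
  set s : UnitAddTorus ι → (ι → ℝ) := Function.surjInv hprq.surjective with hs
  have hFs : ∀ y, F (s (pr y)) = F y := by
    intro y
    have h1 : pr (s (pr y)) = pr y := Function.surjInv_eq hprq.surjective _
    have h2 : ∀ i, ∃ k : ℤ, s (pr y) i = y i + k := by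
      intro i
      have h3 : ((s (pr y) i : ℝ) : UnitAddCircle) = (y i : ℝ) := congrFun h1 i
      rw [← sub_eq_zero, ← AddCircle.coe_sub] at h3
      obtain ⟨k, hk⟩ := AddCircle.coe_eq_zero_iff (1 : ℝ) |>.1 h3
      exact ⟨k, by rw [zsmul_eq_mul, mul_one] at hk; linarith⟩
    choose k hk using h2
    rw [show s (pr y) = fun i => y i + k i from funext hk, hFper]
  set P : C(UnitAddTorus ι, ℂ) := ⟨fun z => F (s z), by
    refine hprq.isQuotientMap.continuous_iff.2 ?_
    exact hFc.congr fun y => (hFs y).symm⟩ with hP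
  have hPpr : ∀ y, P (pr y) = F y := hFs
  have hcoef : ∀ k : ι → ℤ, UnitAddTorus.mFourierCoeff P k =
      ((|B.det|⁻¹ * gaussianMat (B⁻¹).transpose (fun i => (k i : ℝ)) : ℝ) : ℂ) := by
    intro k
    rw [UnitAddTorus.mFourierCoeff_eq_integral P k 0, ← fourier_gaussianMat hB k]
    set G : (ι → ℝ) → ℂ := fun y =>
      Complex.exp (-(2 * Real.pi * I * ∑ i, (k i : ℂ) * y i)) * (gaussianMat B y : ℂ) with hG
    have hexp : ∀ y : ι → ℝ, UnitAddTorus.mFourier (-k) (pr y) =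
        Complex.exp (-(2 * Real.pi * I * ∑ i, (k i : ℂ) * y i)) := by
      intro y
      simp only [UnitAddTorus.mFourier, ContinuousMap.coe_mk, hpr, Pi.map_apply, fourier_coe_apply,
        Pi.neg_apply]
      rw [← Complex.exp_sum, Finset.mul_sum, ← Finset.sum_neg_distrib]
      congr 1
      refine Finset.sum_congr rfl fun i _ => ?_
      push_cast
      ring
    have hexpn : ∀ y : ι → ℝ,
        ‖Complex.exp (-(2 * Real.pi * I * ∑ i, (k i : ℂ) * y i))‖ = 1 := by
      intro y
      rw [show -(2 * Real.pi * I * ∑ i, (k i : ℂ) * y i) =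
        ((-(2 * Real.pi * ∑ i, (k i : ℝ) * y i) : ℝ) : ℂ) * I by push_cast; ring]
      exact Complex.norm_exp_ofReal_mul_I _
    have hGint : Integrable G := by
      refine (integrable_gaussianMat hB).ofReal.bdd_mul (c := 1) ?_ (ae_of_all _ fun y => (hexpn y).le)
      exact Continuous.aestronglyMeasurable (by fun_prop)
    have hGper : ∀ (m : ι → ℤ) (y : ι → ℝ), G (fun i => y i + m i) =
        Complex.exp (-(2 * Real.pi * I * ∑ i, (k i : ℂ) * y i)) *
          (gaussianMat B (fun i => y i + m i) : ℂ) := by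
      intro m y
      rw [hG]
      simp only
      congr 1
      rw [Complex.exp_eq_exp_iff_exists_int]
      refine ⟨-∑ i, k i * m i, ?_⟩
      push_cast
      simp only [mul_add, Finset.sum_add_distrib]
      ring
    set box : (ι → ℤ) → Set (ι → ℝ) := fun m => {x | ∀ i, x i ∈ Set.Ioc (m i : ℝ) (m i + 1)}
      with hbox
    have hboxm : ∀ m, MeasurableSet (box m) := fun m =>
      MeasurableSet.univ_pi' fun i => measurableSet_Ioc
    have hboxd : Pairwise (Function.onFun Disjoint box) := by
      intro m m' hmm
      refine Set.disjoint_left.2 fun x hx hx' => hmm (funext fun i => ?_)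
      have h1 := hx i
      have h2 := hx' i
      have h3 : (m i : ℝ) < m' i + 1 := h1.1.trans_le h2.2
      have h4 : (m' i : ℝ) < m i + 1 := h2.1.trans_le h1.2
      have h3' : m i < m' i + 1 := by exact_mod_cast h3
      have h4' : m' i < m i + 1 := by exact_mod_cast h4
      omega
    have hboxu : ⋃ m, box m = Set.univ := by
      refine Set.eq_univ_of_forall fun x => Set.mem_iUnion.2 ⟨fun i => ⌈x i⌉ - 1, fun i => ?_⟩
      constructor
      · push_cast; linarith [Int.ceil_lt_add_one (x i)]
      · push_cast; linarith [Int.le_ceil (x i)]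
    have hsum := hasSum_integral_iUnion hboxm hboxd (f := G) (μ := volume) hGint.integrableOn
    rw [hboxu, setIntegral_univ] at hsum
    have htrans : ∀ m : ι → ℤ, ∫ y in box m, G y = ∫ y in box 0, G (fun i => y i + m i) :=
      fun m => setIntegral_box_translate G m
    have hnorm : ∀ m : ι → ℤ, ∫ y in box m, ‖G y‖ = ∫ y in box 0, ‖G (fun i => y i + m i)‖ :=
      fun m => setIntegral_box_translate (fun y => ‖G y‖) m
    have hsumn := (hasSum_integral_iUnion hboxm hboxd (f := fun y => ‖G y‖) (μ := volume)
      hGint.norm.integrableOn).summable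
    simp_rw [hnorm] at hsumn
    have h_int : ∀ m : ι → ℤ, IntegrableOn (fun y : ι → ℝ => G (fun i => y i + m i)) (box 0) := by
      intro m
      exact (hGint.comp_add_right (fun i => (m i : ℝ))).integrableOn
    have hswap := hasSum_integral_of_summable_integral_norm h_int hsumn
    simp_rw [htrans] at hsum
    rw [← hsum.unique hswap |>.symm]
    have hset : {x : ι → ℝ | ∀ i, x i ∈ Set.Ioc ((0 : ι → ℝ) i) ((0 : ι → ℝ) i + 1)} = box 0 := by
      simp [hbox]
    rw [hset]
    refine integral_congr_ae (ae_of_all _ fun y => ?_)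
    simp only
    rw [show (fun i => ((y i : ℝ) : UnitAddCircle)) = pr y from rfl, hPpr, hexp, smul_eq_mul]
    simp_rw [hGper, hF]
    rw [tsum_mul_left]
  have hBi : ((B⁻¹).transpose).det ≠ 0 := by
    rw [Matrix.det_transpose, Matrix.det_nonsing_inv]
    simpa using hB
  have hsumm : Summable (UnitAddTorus.mFourierCoeff P) := by
    refine (Complex.summable_ofReal.2 ((summable_gaussianMat hBi).mul_left |B.det|⁻¹)).congr
      fun k => ?_
    rw [hcoef]
  have hfin := UnitAddTorus.hasSum_mFourier_series_apply_of_summable hsumm (pr 0)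
  have h0 : P (pr 0) = ((∑' m : ι → ℤ, gaussianMat B (fun i => (m i : ℝ)) : ℝ) : ℂ) := by
    rw [hPpr, hF, Complex.ofReal_tsum]
    simp
  rw [h0] at hfin
  have h1 : ∀ k : ι → ℤ, UnitAddTorus.mFourierCoeff P k • UnitAddTorus.mFourier k (pr 0) =
      ((|B.det|⁻¹ * gaussianMat (B⁻¹).transpose (fun i => (k i : ℝ)) : ℝ) : ℂ) := by
    intro k
    rw [hcoef]
    simp [UnitAddTorus.mFourier, hpr]
  simp_rw [h1] at hfin
  have h2 := Complex.hasSum_ofReal.1 hfin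
  rw [← h2.tsum_eq, tsum_mul_left]

end Poisson

section NumberFieldTheta

open mixedEmbedding InfinitePlace Module
open scoped Classical

variable {K : Type*} [Field K] [NumberField K]

/-- Coordinates of an element of a number field in Euclidean space; the complex places are scaled
by `√2`, so that the trace form becomes a signed sum of products of coordinates. -/
noncomputable def placeCoord (a : K) : index K → ℝ
  | .inl w => embedding_of_isReal w.2 a
  | .inr (w, j) => if j = 0 then √2 * (w.1.embedding a).re else √2 * (w.1.embedding a).im

/-- The sign with which a coordinate enters the trace form. -/
def placeSign : index K → ℝ
  | .inl _ => 1
  | .inr (_, j) => if j = 0 then 1 else -1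

/-- The place attached to a coordinate. -/
def indexPlace : index K → InfinitePlace K
  | .inl w => w.1
  | .inr (w, _) => w.1

/-- The positive definite form `∑ mult w * exp (x w) * |a|_w ^ 2`. -/
noncomputable def placeForm (x : InfinitePlace K → ℝ) (a : K) : ℝ :=
  ∑ w, (w.mult : ℝ) * Real.exp (x w) * (w a) ^ 2

lemma sum_indexPlace (f : InfinitePlace K → ℝ) :
    ∑ i : index K, f (indexPlace i) = ∑ w, (w.mult : ℝ) * f w := by
  rw [sum_eq_sum_add_sum, Fintype.sum_sum_type, Fintype.sum_prod_type]
  congr 1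
  · refine Finset.sum_congr rfl fun w _ => ?_
    simp [indexPlace, mult_isReal]
  · refine Finset.sum_congr rfl fun w _ => ?_
    simp [indexPlace, mult_isComplex, two_mul]

lemma sum_placeCoord_sq (x : InfinitePlace K → ℝ) (a : K) :
    ∑ i, (Real.exp (x (indexPlace i) / 2) * placeCoord a i) ^ 2 = placeForm x a := by
  rw [placeForm, sum_eq_sum_add_sum, Fintype.sum_sum_type, Fintype.sum_prod_type]
  congr 1
  · refine Finset.sum_congr rfl fun w _ => ?_
    simp only [indexPlace, placeCoord, mult_isReal]
    rw [mul_pow, ← Real.exp_nat_mul, ← norm_embedding_of_isReal w.2, Real.norm_eq_abs, sq_abs]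
    simp only [Nat.cast_ofNat, Nat.cast_one, one_mul]
    congr 2; ring
  · refine Finset.sum_congr rfl fun w _ => ?_
    simp only [indexPlace, placeCoord, mult_isComplex, Fin.sum_univ_two, if_true, one_ne_zero,
      if_false]
    rw [mul_pow, mul_pow, ← Real.exp_nat_mul, ← norm_embedding_eq, ← Complex.normSq_eq_norm_sq,
      Complex.normSq_apply, mul_pow, mul_pow, Real.sq_sqrt (by norm_num)]
    have : ((2 : ℕ) : ℝ) * (x w.1 / 2) = x w.1 := by push_cast; ring
    rw [this]; push_cast; ring_nf
    rw [← Real.exp_nat_mul]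
    push_cast; ring_nf

lemma sum_placeSign_mul (a b : K) :
    ∑ i, placeSign i * (placeCoord a i * placeCoord b i) = (Algebra.trace ℚ K (a * b) : ℝ) := by
  have h := trace_eq_sum_embeddings (K := ℚ) (L := K) ℂ (x := a * b)
  apply Complex.ofReal_injective
  have h2 : ((Algebra.trace ℚ K (a * b) : ℝ) : ℂ) = ∑ i : index K, indexEquiv K i (a * b) := by
    rw [Equiv.sum_comp (indexEquiv K) (fun φ => φ (a * b)),
      Fintype.sum_equiv (RingHom.equivRatAlgHom K ℂ) (fun φ => φ (a * b)) (fun φ => φ (a * b))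
        (fun _ => by simp [RingHom.equivRatAlgHom_apply]), ← h]
    simp
  rw [h2, Fintype.sum_sum_type, Fintype.sum_sum_type, Fintype.sum_prod_type, Fintype.sum_prod_type]
  simp only [Fin.sum_univ_two, indexEquiv_apply_isReal, indexEquiv_apply_isComplex_fst,
    indexEquiv_apply_isComplex_snd, placeSign, placeCoord, if_true, one_ne_zero, if_false]
  push_cast
  congr 1
  · refine Finset.sum_congr rfl fun w _ => ?_
    rw [embedding_of_isReal_apply, embedding_of_isReal_apply, map_mul, one_mul]
  · refine Finset.sum_congr rfl fun w _ => ?_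
    have h2' : ((√2 : ℝ) : ℂ) * (√2 : ℝ) = 2 := by
      rw [← Complex.ofReal_mul, Real.mul_self_sqrt (by norm_num)]; norm_num
    rw [ComplexEmbedding.conjugate_coe_eq, Complex.add_conj, map_mul, Complex.mul_re]
    push_cast
    linear_combination ((w.1.embedding a).re * (w.1.embedding b).re -
      (w.1.embedding a).im * (w.1.embedding b).im : ℂ) * h2'

/-- The matrix of the embedding of a lattice, scaled at each place. -/
noncomputable def placeMat (e : Basis (index K) ℚ K) (x : InfinitePlace K → ℝ) :
    Matrix (index K) (index K) ℝ :=
  Matrix.of fun i j => Real.exp (x (indexPlace i) / 2) * placeCoord (e j) i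

lemma placeCoord_add (a b : K) : placeCoord (a + b) = placeCoord a + placeCoord b := by
  funext i
  rcases i with w | ⟨w, j⟩
  · simp [placeCoord]
  · simp only [placeCoord, map_add, Pi.add_apply, Complex.add_re, Complex.add_im]
    split_ifs <;> ring

lemma placeCoord_sum (e : index K → K) (m : index K → ℤ) (i : index K) :
    placeCoord (∑ j, m j • e j) i = ∑ j, placeCoord (e j) i * m j := by
  let f : K →+ ℝ := ⟨⟨fun a => placeCoord a i, by
    rcases i with w | ⟨w, j⟩ <;> simp [placeCoord]⟩, fun a b => congrFun (placeCoord_add a b) i⟩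
  have : f (∑ j, m j • e j) = ∑ j, f (e j) * m j := by
    rw [map_sum]
    refine Finset.sum_congr rfl fun j _ => ?_
    rw [map_zsmul, zsmul_eq_mul, mul_comm]
  exact this

lemma gaussianMat_placeMat (e : Basis (index K) ℚ K) (x : InfinitePlace K → ℝ)
    (m : index K → ℤ) :
    gaussianMat (placeMat e x) (fun i => (m i : ℝ)) =
      Real.exp (-Real.pi * placeForm x (∑ j, m j • e j)) := by
  rw [gaussianMat, ← sum_placeCoord_sq]
  congr 2
  refine Finset.sum_congr rfl fun i _ => ?_
  congr 1
  rw [placeCoord_sum, Finset.mul_sum]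
  exact Finset.sum_congr rfl fun j _ => by simp [placeMat, mul_assoc]

lemma placeMat_transpose_mul (e f : Basis (index K) ℚ K) (x : InfinitePlace K → ℝ) :
    (placeMat e x).transpose * (Matrix.diagonal placeSign * placeMat f (-x)) =
      Matrix.of fun i j => ((Algebra.trace ℚ K (e i * f j) : ℚ) : ℝ) := by
  ext i j
  rw [Matrix.mul_apply, Matrix.of_apply, ← sum_placeSign_mul]
  refine Finset.sum_congr rfl fun k _ => ?_
  rw [Matrix.diagonal_mul]
  simp only [placeMat, Matrix.transpose_apply, Matrix.of_apply, Pi.neg_apply]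
  have : Real.exp (x (indexPlace k) / 2) * Real.exp (-x (indexPlace k) / 2) = 1 := by
    rw [← Real.exp_add]; simp [neg_div]
  linear_combination (placeCoord (e i) k * placeSign k * placeCoord (f j) k) * this

lemma placeMat_transpose_mul_dual (e : Basis (index K) ℚ K) (x : InfinitePlace K → ℝ) :
    (placeMat e x).transpose * (Matrix.diagonal placeSign * placeMat e.traceDual (-x)) = 1 := by
  rw [placeMat_transpose_mul]
  ext i j
  rw [Matrix.of_apply, Basis.trace_mul_traceDual, Matrix.one_apply]
  split_ifs <;> simp

lemma det_placeMat_ne_zero (e : Basis (index K) ℚ K) (x : InfinitePlace K → ℝ) :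
    (placeMat e x).det ≠ 0 := by
  intro h
  have := congrArg Matrix.det (placeMat_transpose_mul_dual e x)
  rw [Matrix.det_mul, Matrix.det_transpose, h] at this
  simp at this

lemma inv_placeMat_transpose (e : Basis (index K) ℚ K) (x : InfinitePlace K → ℝ) :
    ((placeMat e x)⁻¹).transpose = Matrix.diagonal placeSign * placeMat e.traceDual (-x) := by
  rw [Matrix.transpose_nonsing_inv]
  exact Matrix.inv_eq_right_inv (placeMat_transpose_mul_dual e x)

lemma gaussianMat_diagonal_placeSign_mul (B : Matrix (index K) (index K) ℝ) (y : index K → ℝ) :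
    gaussianMat (Matrix.diagonal placeSign * B) y = gaussianMat B y := by
  unfold gaussianMat
  refine congrArg (fun t => Real.exp (-Real.pi * t)) (Finset.sum_congr rfl fun i _ => ?_)
  rw [← Matrix.mulVec_mulVec, Matrix.mulVec_diagonal, mul_pow]
  have : (placeSign i) ^ 2 = 1 := by
    rcases i with w | ⟨w, j⟩
    · simp [placeSign]
    · simp only [placeSign]; split_ifs <;> norm_num
  rw [this, one_mul]

lemma abs_det_placeMat (e : Basis (index K) ℚ K) (x : InfinitePlace K → ℝ) :
    |(placeMat e x).det| =
      Real.exp ((∑ w, (w.mult : ℝ) * x w) / 2) * √|((Algebra.discr ℚ e : ℚ) : ℝ)| := by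
  have h0 : placeMat e x = Matrix.diagonal (fun i => Real.exp (x (indexPlace i) / 2)) *
      placeMat e 0 := by
    ext i j
    rw [Matrix.diagonal_mul]
    simp [placeMat]
  have h1 := congrArg Matrix.det (placeMat_transpose_mul e e 0)
  rw [neg_zero, Matrix.det_mul, Matrix.det_mul, Matrix.det_transpose, Matrix.det_diagonal] at h1
  have h2 : (Matrix.of fun i j => ((Algebra.trace ℚ K (e i * e j) : ℚ) : ℝ)).det =
      ((Algebra.discr ℚ e : ℚ) : ℝ) := by
    rw [Algebra.discr_def]
    exact ((Rat.castHom ℝ).map_det (Algebra.traceMatrix ℚ e)).symm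
  have h3 : |∏ i : index K, placeSign i| = 1 := by
    rw [Finset.abs_prod]
    refine Finset.prod_eq_one fun i _ => ?_
    rcases i with w | ⟨w, j⟩
    · simp [placeSign]
    · simp only [placeSign]; split_ifs <;> norm_num
  rw [h2] at h1
  have h4 : |(placeMat e 0).det| = √|((Algebra.discr ℚ e : ℚ) : ℝ)| := by
    rw [← h1, abs_mul, abs_mul, h3, one_mul, Real.sqrt_mul_self (abs_nonneg _)]
  rw [h0, Matrix.det_mul, abs_mul, h4, Matrix.det_diagonal, ← Real.exp_sum, Real.abs_exp,
    ← Finset.sum_div, sum_indexPlace]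

end NumberFieldTheta

section IdealTheta

open mixedEmbedding InfinitePlace Module nonZeroDivisors
open scoped Classical

variable {K : Type*} [Field K] [NumberField K]

lemma exists_basis_fractionalIdeal (I : (FractionalIdeal (𝓞 K)⁰ K)ˣ) :
    ∃ e : Basis (index K) ℚ K,
      (∀ a : K, a ∈ Submodule.span ℤ (Set.range e) ↔ a ∈ (I : FractionalIdeal (𝓞 K)⁰ K)) ∧
      |Algebra.discr ℚ e| = FractionalIdeal.absNorm (I : FractionalIdeal (𝓞 K)⁰ K) ^ 2 *
        |(discr K : ℚ)| := by
  have hcard : Fintype.card (Free.ChooseBasisIndex ℤ (𝓞 K)) = Fintype.card (index K) := by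
    rw [← finrank_eq_card_chooseBasisIndex, RingOfIntegers.rank, ← mixedEmbedding.finrank K,
      finrank_eq_card_basis (stdBasis K)]
  have hcard2 : Fintype.card (Free.ChooseBasisIndex ℤ I) = Fintype.card (index K) := by
    rw [← finrank_eq_card_chooseBasisIndex, fractionalIdeal_rank, RingOfIntegers.rank,
      ← mixedEmbedding.finrank K, finrank_eq_card_basis (stdBasis K)]
  let E : Free.ChooseBasisIndex ℤ I ≃ index K := Fintype.equivOfCardEq hcard2
  let E' : Free.ChooseBasisIndex ℤ (𝓞 K) ≃ Free.ChooseBasisIndex ℤ I :=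
    Fintype.equivOfCardEq (hcard.trans hcard2.symm)
  refine ⟨(basisOfFractionalIdeal K I).reindex E, fun a => ?_, ?_⟩
  · rw [Basis.range_reindex]
    exact mem_span_basisOfFractionalIdeal K
  · rw [Basis.coe_reindex, Algebra.discr_reindex]
    have h1 : Algebra.discr ℚ (basisOfFractionalIdeal K I) =
        Algebra.discr ℚ ((basisOfFractionalIdeal K I).reindex E'.symm) := by
      rw [Basis.coe_reindex, Algebra.discr_reindex]
    have h2 := Algebra.discr_of_matrix_vecMul (A := ℚ) (integralBasis K)
      ((integralBasis K).toMatrix ((basisOfFractionalIdeal K I).reindex E'.symm))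
    rw [Basis.toMatrix_map_vecMul] at h2
    rw [h1, h2, ← Basis.det_apply, abs_mul, abs_pow, ← coe_discr]
    congr 2
    exact_mod_cast det_basisOfFractionalIdeal_eq_absNorm K I E'

/-- The sum of `exp (-π * placeForm x a)` over the nonzero elements `a` of a fractional ideal. -/
noncomputable def nzTheta (I : (FractionalIdeal (𝓞 K)⁰ K)ˣ) (x : InfinitePlace K → ℝ) : ENNReal :=
  ∑' a : {a : K // a ∈ (I : FractionalIdeal (𝓞 K)⁰ K) ∧ a ≠ 0},
    ENNReal.ofReal (Real.exp (-Real.pi * placeForm x a.1))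

/-- The dual of an invertible fractional ideal under the trace form. -/
noncomputable def dualUnit (I : (FractionalIdeal (𝓞 K)⁰ K)ˣ) : (FractionalIdeal (𝓞 K)⁰ K)ˣ :=
  Units.mk0 (FractionalIdeal.dual ℤ ℚ (I : FractionalIdeal (𝓞 K)⁰ K))
    (FractionalIdeal.dual_ne_zero ℤ ℚ I.ne_zero)

lemma exists_equiv_nonzero_span {ι : Type*} [Fintype ι] (e : Basis ι ℚ K) (S : Set K)
    (he : ∀ a : K, a ∈ Submodule.span ℤ (Set.range e) ↔ a ∈ S) :
    ∃ E : {m : ι → ℤ // m ≠ 0} ≃ {a : K // a ∈ S ∧ a ≠ 0}, ∀ m, (E m).1 = ∑ j, m.1 j • e j := by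
  have hli : ∀ m : ι → ℤ, (∑ j, m j • e j = 0) ↔ m = 0 := by
    intro m
    constructor
    · intro h
      have h1 := Fintype.linearIndependent_iff.1 e.linearIndependent (fun j => (m j : ℚ)) (by
        simpa only [Int.cast_smul_eq_zsmul] using h)
      funext i
      exact_mod_cast h1 i
    · rintro rfl; simp
  have hinj : Function.Injective fun m : ι → ℤ => ∑ j, m j • e j := by
    intro m m' h
    have := (hli (m - m')).1 (by
      simp only [Pi.sub_apply, sub_smul, Finset.sum_sub_distrib]; exact sub_eq_zero.2 h)
    exact sub_eq_zero.1 this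
  refine ⟨Equiv.ofBijective (fun m => ⟨∑ j, m.1 j • e j, (he _).1 (Submodule.sum_mem _ fun j _ =>
      Submodule.smul_mem _ _ (Submodule.subset_span ⟨j, rfl⟩)), fun h => m.2 ((hli _).1 h)⟩)
    ⟨fun m m' h => Subtype.ext (hinj (congrArg Subtype.val h)), ?_⟩, fun m => rfl⟩
  rintro ⟨a, ha, ha0⟩
  obtain ⟨c, hc⟩ := (Submodule.mem_span_range_iff_exists_fun ℤ).1 ((he a).2 ha)
  refine ⟨⟨c, ?_⟩, Subtype.ext hc⟩
  rintro rfl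
  exact ha0 (by rw [← hc]; simp)

lemma tsum_int_eq_add_nonzero {ι : Type*} (f : (ι → ℤ) → ENNReal) :
    ∑' m, f m = f 0 + ∑' m : {m : ι → ℤ // m ≠ 0}, f m := by
  have h := Summable.tsum_add_tsum_compl (f := f) (s := ({0} : Set (ι → ℤ))) ENNReal.summable
    ENNReal.summable
  rw [tsum_singleton (0 : ι → ℤ) f] at h
  rw [← h]
  congr 1

lemma tsum_gaussianMat_eq_nzTheta (I : (FractionalIdeal (𝓞 K)⁰ K)ˣ)
    (e : Basis (index K) ℚ K) (he : ∀ a : K, a ∈ Submodule.span ℤ (Set.range e) ↔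
      a ∈ (I : FractionalIdeal (𝓞 K)⁰ K)) (x : InfinitePlace K → ℝ) :
    ENNReal.ofReal (∑' m : index K → ℤ, gaussianMat (placeMat e x) (fun i => (m i : ℝ))) =
      1 + nzTheta I x := by
  rw [ENNReal.ofReal_tsum_of_nonneg (fun m => (gaussianMat_pos _ _).le)
    (summable_gaussianMat (det_placeMat_ne_zero e x))]
  obtain ⟨E, hE⟩ := exists_equiv_nonzero_span e {a | a ∈ (I : FractionalIdeal (𝓞 K)⁰ K)} he
  rw [tsum_int_eq_add_nonzero, nzTheta]
  have h2 := Equiv.tsum_eq E (fun a => ENNReal.ofReal (Real.exp (-Real.pi * placeForm x a.1)))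
  simp only [Set.mem_ofPred_eq] at h2
  rw [← h2]
  congr 1
  · rw [gaussianMat_placeMat]
    simp [placeForm]
  · refine tsum_congr fun m => ?_
    rw [gaussianMat_placeMat, hE]

lemma nzTheta_ne_top (I : (FractionalIdeal (𝓞 K)⁰ K)ˣ) (x : InfinitePlace K → ℝ) :
    nzTheta I x ≠ ⊤ := by
  obtain ⟨e, he, -⟩ := exists_basis_fractionalIdeal I
  have := tsum_gaussianMat_eq_nzTheta I e he x
  intro h
  rw [h] at this
  simp at this

lemma span_traceDual (I : (FractionalIdeal (𝓞 K)⁰ K)ˣ)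
    (e : Basis (index K) ℚ K) (he : ∀ a : K, a ∈ Submodule.span ℤ (Set.range e) ↔
      a ∈ (I : FractionalIdeal (𝓞 K)⁰ K)) (a : K) :
    a ∈ Submodule.span ℤ (Set.range e.traceDual) ↔
      a ∈ (dualUnit I : FractionalIdeal (𝓞 K)⁰ K) := by
  have h : ((I : FractionalIdeal (𝓞 K)⁰ K) : Submodule (𝓞 K) K).restrictScalars ℤ =
      Submodule.span ℤ (Set.range e) := by
    ext b; exact (he b).symm
  rw [← Submodule.traceDual_span_of_basis ℤ _ e h, Submodule.restrictScalars_mem,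
    ← FractionalIdeal.coe_dual ℤ ℚ I.ne_zero]
  rfl

lemma absNorm_pos (I : (FractionalIdeal (𝓞 K)⁰ K)ˣ) :
    0 < ((FractionalIdeal.absNorm (I : FractionalIdeal (𝓞 K)⁰ K) : ℚ) : ℝ) := by
  have h0 := FractionalIdeal.absNorm_nonneg (I : FractionalIdeal (𝓞 K)⁰ K)
  have h1 : FractionalIdeal.absNorm (I : FractionalIdeal (𝓞 K)⁰ K) ≠ 0 := by
    rw [Ne, FractionalIdeal.absNorm_eq_zero_iff]
    exact I.ne_zero
  exact_mod_cast lt_of_le_of_ne h0 h1.symm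

lemma sqrt_abs_discr (I : (FractionalIdeal (𝓞 K)⁰ K)ˣ) {e : Basis (index K) ℚ K}
    (h : |Algebra.discr ℚ e| = FractionalIdeal.absNorm (I : FractionalIdeal (𝓞 K)⁰ K) ^ 2 *
        |(discr K : ℚ)|) :
    √|((Algebra.discr ℚ e : ℚ) : ℝ)| =
      (FractionalIdeal.absNorm (I : FractionalIdeal (𝓞 K)⁰ K) : ℚ) * √|(discr K : ℝ)| := by
  have h' : |((Algebra.discr ℚ e : ℚ) : ℝ)| =
      ((FractionalIdeal.absNorm (I : FractionalIdeal (𝓞 K)⁰ K) : ℚ) : ℝ) ^ 2 *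
        |(discr K : ℝ)| := by exact_mod_cast h
  rw [h', Real.sqrt_mul (sq_nonneg _), Real.sqrt_sq (absNorm_pos I).le]

lemma one_add_nzTheta (I : (FractionalIdeal (𝓞 K)⁰ K)ˣ) (x : InfinitePlace K → ℝ) :
    1 + nzTheta I x = ENNReal.ofReal
      (((FractionalIdeal.absNorm (I : FractionalIdeal (𝓞 K)⁰ K) : ℚ) * √|(discr K : ℝ)|)⁻¹ *
        Real.exp (-((∑ w, (w.mult : ℝ) * x w) / 2))) * (1 + nzTheta (dualUnit I) (-x)) := by
  obtain ⟨e, he, hd⟩ := exists_basis_fractionalIdeal I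
  rw [← tsum_gaussianMat_eq_nzTheta I e he,
    ← tsum_gaussianMat_eq_nzTheta (dualUnit I) e.traceDual (span_traceDual I e he),
    tsum_gaussianMat (det_placeMat_ne_zero e x), inv_placeMat_transpose,
    ENNReal.ofReal_mul (inv_nonneg.2 (abs_nonneg _))]
  simp only [gaussianMat_diagonal_placeSign_mul]
  congr 2
  rw [abs_det_placeMat, sqrt_abs_discr I hd, mul_inv, ← Real.exp_neg, mul_comm]

lemma absNorm_dualUnit (I : (FractionalIdeal (𝓞 K)⁰ K)ˣ) :
    ((FractionalIdeal.absNorm (dualUnit I : FractionalIdeal (𝓞 K)⁰ K) : ℚ) : ℝ) =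
      ((FractionalIdeal.absNorm (I : FractionalIdeal (𝓞 K)⁰ K) : ℚ) * |(discr K : ℝ)|)⁻¹ := by
  have hD : 0 < |(discr K : ℝ)| := abs_pos.2 (by exact_mod_cast discr_ne_zero K)
  have e1 := one_add_nzTheta I 0
  have e2 := one_add_nzTheta (dualUnit I) 0
  have hdd : dualUnit (dualUnit I) = I := by
    refine Units.ext ?_
    simp [dualUnit]
  rw [hdd] at e2
  simp only [neg_zero, Pi.zero_apply, mul_zero, Finset.sum_const_zero, zero_div, Real.exp_zero,
    mul_one] at e1 e2
  rw [e2, ← mul_assoc, ← ENNReal.ofReal_mul (by have := absNorm_pos I; positivity)] at e1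
  have ht : 1 + nzTheta I 0 ≠ ⊤ := by simp [nzTheta_ne_top]
  have e3 := congrArg ENNReal.toReal e1
  have hp : 0 < (1 + nzTheta I 0).toReal := ENNReal.toReal_pos (by simp) ht
  have p1 := absNorm_pos I
  have p2 := absNorm_pos (dualUnit I)
  rw [ENNReal.toReal_mul, ENNReal.toReal_ofReal (by positivity)] at e3
  have e4 := mul_right_cancel₀ hp.ne' ((one_mul _).trans e3)
  rw [← mul_inv, eq_comm, inv_eq_one] at e4
  rw [eq_comm, inv_eq_of_mul_eq_one_right]
  have : √|(discr K : ℝ)| * √|(discr K : ℝ)| = |(discr K : ℝ)| := Real.mul_self_sqrt hD.le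
  linear_combination e4 - (FractionalIdeal.absNorm (I : FractionalIdeal (𝓞 K)⁰ K) : ℚ) *
    ((FractionalIdeal.absNorm (dualUnit I : FractionalIdeal (𝓞 K)⁰ K) : ℚ) : ℝ) * this

end IdealTheta

section LogCoordinates

open mixedEmbedding InfinitePlace Module nonZeroDivisors Units.dirichletUnitTheorem
open scoped Classical Pointwise

lemma setLIntegral_neg_of_isAddFundamentalDomain {E : Type*} [AddCommGroup E]
    [MeasurableSpace E] [MeasurableNeg E] [MeasurableAdd E] {Λ : Submodule ℤ E} [Countable Λ]
    {D : Set E} {μ : Measure E} [μ.IsNegInvariant] [μ.IsAddLeftInvariant]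
    (hD : IsAddFundamentalDomain Λ D μ) {F : E → ENNReal}
    (hF : ∀ (g : Λ) (x : E), F (g.1 + x) = F x) :
    ∫⁻ y in D, F (-y) ∂μ = ∫⁻ y in D, F y ∂μ := by
  have hpre : (fun x : E => -x) ⁻¹' (-D) = D := by ext; simp
  have hD' : IsAddFundamentalDomain Λ (-D) μ := by
    have := hD.preimage_of_equiv (f := fun x : E => -x) (e := fun g : Λ => -g)
      (Measure.measurePreserving_neg μ).quasiMeasurePreserving neg_involutive.bijective
      (fun g x => by
        change -((-g : Λ).1 + x) = g.1 + -x
        simp [add_comm])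
    exact this
  have h1 : ∫⁻ y in D, F (-y) ∂μ = ∫⁻ y in -D, F y ∂μ := by
    rw [← (Measure.measurePreserving_neg μ).setLIntegral_comp_preimage_emb
      (MeasurableEquiv.neg E).measurableEmbedding F (-D)]
    change _ = ∫⁻ a in (fun x : E => -x) ⁻¹' (-D), F (-a) ∂μ
    rw [hpre]
  rw [h1]
  have : MeasurableConstVAdd Λ E := ⟨fun g => measurable_const_add g.1⟩
  have : VAddInvariantMeasure Λ E μ :=
    ⟨fun g _ _ => measure_preimage_add μ g.1 _⟩
  exact hD'.setLIntegral_eq hD F hF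

variable {K : Type*} [Field K] [NumberField K]

/-- The point of the trace zero hyperplane with prescribed coordinates away from `w₀`. -/
noncomputable def hyperplanePoint (y : logSpace K) (w : InfinitePlace K) : ℝ :=
  (if h : w ≠ w₀ then y ⟨w, h⟩ else -∑ v, y v) / w.mult

lemma sum_mult_hyperplanePoint (y : logSpace K) :
    ∑ w, (w.mult : ℝ) * hyperplanePoint y w = 0 := by
  have h : ∀ w : InfinitePlace K, (w.mult : ℝ) * hyperplanePoint y w =
      if h : w ≠ w₀ then y ⟨w, h⟩ else -∑ v, y v := fun w =>
    mul_div_cancel₀ _ (by exact_mod_cast mult_ne_zero)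
  simp_rw [h]
  rw [Fintype.sum_eq_add_sum_subtype_ne _ w₀]
  simp only [ne_eq, not_true_eq_false, dite_false]
  rw [neg_add_eq_zero]
  refine Finset.sum_congr rfl fun v _ => ?_
  rw [dif_pos v.2]

lemma hyperplanePoint_neg (y : logSpace K) (w : InfinitePlace K) :
    hyperplanePoint (-y) w = -hyperplanePoint y w := by
  simp only [hyperplanePoint, Pi.neg_apply, Finset.sum_neg_distrib]
  split_ifs <;> ring

lemma hyperplanePoint_add (y z : logSpace K) (w : InfinitePlace K) :
    hyperplanePoint (y + z) w = hyperplanePoint y w + hyperplanePoint z w := by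
  simp only [hyperplanePoint, Pi.add_apply, Finset.sum_add_distrib]
  split_ifs <;> ring

lemma hyperplanePoint_logEmbedding (u : (𝓞 K)ˣ) (w : InfinitePlace K) :
    hyperplanePoint (Units.logEmbedding K (Additive.ofMul u)) w = Real.log (w (u : K)) := by
  have hm : (w.mult : ℝ) ≠ 0 := by exact_mod_cast mult_ne_zero
  rw [hyperplanePoint, div_eq_iff hm]
  split_ifs with h
  · rw [Units.dirichletUnitTheorem.logEmbedding_component, mul_comm]
  · have : w = w₀ := not_not.1 h
    rw [sum_logEmbedding_component, this]; ring

/-- Logarithmic coordinates on `ℝ ^ places`: the first coordinate is half the weighted sum. -/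
noncomputable def logPoint (τ : ℝ) (y : logSpace K) (w : InfinitePlace K) : ℝ :=
  2 * (τ / finrank ℚ K + hyperplanePoint y w)

lemma sum_mult_logPoint (τ : ℝ) (y : logSpace K) :
    ∑ w, (w.mult : ℝ) * logPoint τ y w = 2 * τ := by
  have h : ∀ w : InfinitePlace K, (w.mult : ℝ) * logPoint τ y w =
      2 * (τ / finrank ℚ K) * w.mult + 2 * (w.mult * hyperplanePoint y w) := fun w => by
    rw [logPoint]; ring
  simp_rw [h]
  rw [Finset.sum_add_distrib, ← Finset.mul_sum, ← Finset.mul_sum, sum_mult_hyperplanePoint,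
    ← Nat.cast_sum, sum_mult_eq]
  have : (finrank ℚ K : ℝ) ≠ 0 := by exact_mod_cast (finrank_pos (R := ℚ) (M := K)).ne'
  field_simp
  ring

lemma logPoint_neg (τ : ℝ) (y : logSpace K) : logPoint (-τ) (-y) = -logPoint τ y := by
  funext w
  simp only [logPoint, hyperplanePoint_neg, Pi.neg_apply]
  ring

lemma placeForm_logPoint_unit (τ : ℝ) (y : logSpace K) (u : (𝓞 K)ˣ) (a : K) :
    placeForm (logPoint τ (Units.logEmbedding K (Additive.ofMul u) + y)) a =
      placeForm (logPoint τ y) ((u : K) * a) := by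
  refine Finset.sum_congr rfl fun w _ => ?_
  have hu : 0 < w (u : K) := Units.pos_at_place u w
  have h : logPoint τ (Units.logEmbedding K (Additive.ofMul u) + y) w =
      logPoint τ y w + (2 : ℕ) * Real.log (w (u : K)) := by
    rw [logPoint, logPoint, hyperplanePoint_add, hyperplanePoint_logEmbedding]
    push_cast; ring
  rw [h, Real.exp_add, Real.exp_nat_mul, Real.exp_log hu, map_mul]
  ring

omit [NumberField K] in
lemma unit_mul_mem_iff (I : FractionalIdeal (𝓞 K)⁰ K) (u : (𝓞 K)ˣ) (a : K) :
    (u : K) * a ∈ I ↔ a ∈ I := by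
  have h : ∀ (u : (𝓞 K)ˣ) (a : K), a ∈ I → (u : K) * a ∈ I := fun u a ha => by
    have := (I : Submodule (𝓞 K) K).smul_mem (u : 𝓞 K) ha
    rwa [Algebra.smul_def] at this
  refine ⟨fun h1 => ?_, h u a⟩
  have := h u⁻¹ _ h1
  rwa [← mul_assoc, ← map_mul, Units.inv_mul, map_one, one_mul] at this

/-- Multiplication by a unit on the nonzero elements of a fractional ideal. -/
noncomputable def unitMulEquiv (I : (FractionalIdeal (𝓞 K)⁰ K)ˣ) (u : (𝓞 K)ˣ) :
    {a : K // a ∈ (I : FractionalIdeal (𝓞 K)⁰ K) ∧ a ≠ 0} ≃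
      {a : K // a ∈ (I : FractionalIdeal (𝓞 K)⁰ K) ∧ a ≠ 0} where
  toFun a := ⟨(u : K) * a.1, (unit_mul_mem_iff _ u _).2 a.2.1,
    mul_ne_zero (by simp) a.2.2⟩
  invFun a := ⟨((u⁻¹ : (𝓞 K)ˣ) : K) * a.1, (unit_mul_mem_iff _ u⁻¹ _).2 a.2.1,
    mul_ne_zero (by simp) a.2.2⟩
  left_inv a := Subtype.ext (by simp only; rw [← mul_assoc, ← map_mul, Units.inv_mul, map_one, one_mul])
  right_inv a := Subtype.ext (by simp only; rw [← mul_assoc, ← map_mul, Units.mul_inv, map_one, one_mul])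

lemma nzTheta_logPoint_unit (I : (FractionalIdeal (𝓞 K)⁰ K)ˣ) (τ : ℝ) (y : logSpace K)
    (u : (𝓞 K)ˣ) : nzTheta I (logPoint τ (Units.logEmbedding K (Additive.ofMul u) + y)) =
      nzTheta I (logPoint τ y) := by
  simp only [nzTheta, placeForm_logPoint_unit]
  exact (unitMulEquiv I u).tsum_eq
    fun a => ENNReal.ofReal (Real.exp (-Real.pi * placeForm (logPoint τ y) a.1))

lemma nzTheta_logPoint_vadd (I : (FractionalIdeal (𝓞 K)⁰ K)ˣ) (τ : ℝ)
    (g : Units.unitLattice K) (y : logSpace K) :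
    nzTheta I (logPoint τ (g.1 + y)) = nzTheta I (logPoint τ y) := by
  obtain ⟨g, hg⟩ := g
  obtain ⟨u, -, rfl⟩ := hg
  exact nzTheta_logPoint_unit I τ y u.toMul

variable (K) in
/-- A fundamental domain for the unit lattice. -/
noncomputable def unitDomain : Set (logSpace K) :=
  ZSpan.fundamentalDomain ((Units.basisUnitLattice K).ofZLatticeBasis ℝ (Units.unitLattice K))

lemma isAddFundamentalDomain_unitDomain :
    IsAddFundamentalDomain (Units.unitLattice K) (unitDomain K) volume :=
  ZLattice.isAddFundamentalDomain (Units.basisUnitLattice K) volume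

lemma unitDomain_isBounded : Bornology.IsBounded (unitDomain K) :=
  ZSpan.fundamentalDomain_isBounded _

lemma volume_unitDomain_ne_top : volume (unitDomain K) ≠ ⊤ :=
  (unitDomain_isBounded (K := K)).measure_lt_top.ne

@[fun_prop]
lemma continuous_hyperplanePoint : Continuous (hyperplanePoint : logSpace K → _) := by
  refine continuous_pi fun w => ?_
  unfold hyperplanePoint
  split_ifs <;> fun_prop

lemma continuous_logPoint : Continuous fun p : ℝ × logSpace K => logPoint p.1 p.2 := by
  refine continuous_pi fun w => ?_
  unfold logPoint
  have := (continuous_pi_iff.1 (continuous_hyperplanePoint (K := K)) w)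
  fun_prop

lemma continuous_placeForm (a : K) : Continuous fun x => placeForm x a := by
  unfold placeForm; fun_prop

lemma measurable_nzTheta (I : (FractionalIdeal (𝓞 K)⁰ K)ˣ) : Measurable (nzTheta I) := by
  have : Countable K := by
    exact (finBasis ℚ K).equivFun.injective.countable
  unfold nzTheta
  refine Measurable.tsum fun a => ?_
  have := continuous_placeForm a.1
  fun_prop

/-- The integral of the theta function of a fractional ideal over the unit fundamental domain,
without the contribution of zero. -/
noncomputable def unitTheta (I : (FractionalIdeal (𝓞 K)⁰ K)ˣ) (t : ℝ) : ENNReal :=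
  ∫⁻ y in unitDomain K, nzTheta I (logPoint (Real.log t) y)

lemma measurable_unitTheta (I : (FractionalIdeal (𝓞 K)⁰ K)ˣ) : Measurable (unitTheta I) := by
  have h : Measurable fun p : ℝ × logSpace K => nzTheta I (logPoint (Real.log p.1) p.2) := by
    refine (measurable_nzTheta I).comp ?_
    exact continuous_logPoint.measurable.comp
      ((Real.measurable_log.comp measurable_fst).prodMk measurable_snd)
  exact h.lintegral_prod_right'

lemma unitTheta_inv (I : (FractionalIdeal (𝓞 K)⁰ K)ˣ) {t : ℝ} (ht : 0 < t) :
    volume (unitDomain K) + unitTheta I t⁻¹ = ENNReal.ofReal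
      (((FractionalIdeal.absNorm (I : FractionalIdeal (𝓞 K)⁰ K) : ℚ) * √|(discr K : ℝ)|)⁻¹ * t) *
        (volume (unitDomain K) + unitTheta (dualUnit I) t) := by
  have hm : ∀ (J : (FractionalIdeal (𝓞 K)⁰ K)ˣ) (τ : ℝ),
      Measurable fun y : logSpace K => nzTheta J (logPoint τ y) := fun J τ =>
    (measurable_nzTheta J).comp (continuous_logPoint.comp (by fun_prop : Continuous
      fun y : logSpace K => (τ, y))).measurable
  have h1 : ∀ (J : (FractionalIdeal (𝓞 K)⁰ K)ˣ) (τ : ℝ),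
      volume (unitDomain K) + ∫⁻ y in unitDomain K, nzTheta J (logPoint τ y) =
        ∫⁻ y in unitDomain K, (1 + nzTheta J (logPoint τ y)) := fun J τ => by
    rw [lintegral_add_left measurable_const]; simp
  rw [unitTheta, unitTheta, h1, h1]
  have hc : Countable (Units.unitLattice K) := inferInstance
  rw [← setLIntegral_neg_of_isAddFundamentalDomain (isAddFundamentalDomain_unitDomain (K := K))
    (F := fun y => 1 + nzTheta (dualUnit I) (logPoint (Real.log t) y))
    (fun g x => by rw [nzTheta_logPoint_vadd]), ← lintegral_const_mul']
  · refine lintegral_congr fun y => ?_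
    rw [one_add_nzTheta, sum_mult_logPoint, ← logPoint_neg, Real.log_inv, neg_neg]
    congr 3
    rw [mul_div_cancel_left₀ _ two_ne_zero, neg_neg, Real.exp_log ht]
  · simp

end LogCoordinates

section UnitThetaBounds

open mixedEmbedding InfinitePlace Module nonZeroDivisors Units.dirichletUnitTheorem
open scoped Classical Pointwise

variable {K : Type*} [Field K] [NumberField K]

lemma placeForm_pos (x : InfinitePlace K → ℝ) {a : K} (ha : a ≠ 0) : 0 < placeForm x a :=
  Finset.sum_pos (fun w _ => mul_pos (mul_pos (by exact_mod_cast mult_pos) (Real.exp_pos _))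
    (pow_pos (pos_iff.2 ha) 2)) Finset.univ_nonempty

lemma placeForm_mono {x y : InfinitePlace K → ℝ} (h : x ≤ y) (a : K) :
    placeForm x a ≤ placeForm y a :=
  Finset.sum_le_sum fun w _ => by gcongr; exact h w

lemma placeForm_logPoint_log {t : ℝ} (ht : 0 < t) (y : logSpace K) (a : K) :
    placeForm (logPoint (Real.log t) y) a =
      t ^ (2 / (finrank ℚ K : ℝ)) * placeForm (logPoint 0 y) a := by
  rw [placeForm, placeForm, Finset.mul_sum]
  refine Finset.sum_congr rfl fun w _ => ?_
  rw [Real.rpow_def_of_pos ht, show logPoint (Real.log t) y w =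
    Real.log t * (2 / finrank ℚ K) + logPoint 0 y w by unfold logPoint; ring, Real.exp_add]
  ring

lemma exists_abs_hyperplanePoint_le :
    ∃ C : ℝ, ∀ y ∈ unitDomain K, ∀ w, |hyperplanePoint y w| ≤ C := by
  have hc : IsCompact (closure (unitDomain K)) := unitDomain_isBounded.isCompact_closure
  obtain ⟨C, hC⟩ := hc.exists_bound_of_continuousOn
    (continuous_hyperplanePoint (K := K)).continuousOn
  exact ⟨C, fun y hy w => (norm_le_pi_norm (hyperplanePoint y) w).trans (hC y (subset_closure hy))⟩

lemma exists_le_logPoint :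
    ∃ C : ℝ, ∀ y ∈ unitDomain K, (fun _ => C) ≤ logPoint 0 y := by
  obtain ⟨C, hC⟩ := exists_abs_hyperplanePoint_le (K := K)
  refine ⟨-(2 * C), fun y hy w => ?_⟩
  have := (abs_le.1 (hC y hy w)).1
  simp only [logPoint, zero_div, zero_add]
  linarith

lemma exists_pos_le_placeForm (I : (FractionalIdeal (𝓞 K)⁰ K)ˣ) (x : InfinitePlace K → ℝ) :
    ∃ κ > 0, ∀ a ∈ (I : FractionalIdeal (𝓞 K)⁰ K), a ≠ 0 → κ ≤ placeForm x a := by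
  have hfin := ENNReal.finite_const_le_of_tsum_ne_top (nzTheta_ne_top I x)
    (ε := ENNReal.ofReal (Real.exp (-Real.pi * 1))) (by simp [Real.exp_pos])
  have hfin' := hfin.image fun a => placeForm x a.1
  by_cases hne : (hfin'.toFinset).Nonempty
  · refine ⟨min 1 (hfin'.toFinset.min' hne), lt_min one_pos ?_, fun a ha ha0 => ?_⟩
    · obtain ⟨a, -, h⟩ := hfin'.mem_toFinset.1 (hfin'.toFinset.min'_mem hne)
      exact h ▸ placeForm_pos x a.2.2
    · by_cases h1 : placeForm x a ≤ 1
      · refine (min_le_right _ _).trans (Finset.min'_le _ _ ?_)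
        rw [Set.Finite.mem_toFinset]
        refine ⟨⟨a, ha, ha0⟩, ENNReal.ofReal_le_ofReal (Real.exp_le_exp.2 ?_), rfl⟩
        nlinarith [Real.pi_pos]
      · exact (min_le_left _ _).trans (not_le.1 h1).le
  · refine ⟨1, one_pos, fun a ha ha0 => ?_⟩
    by_contra! h1
    refine hne ⟨placeForm x a, ?_⟩
    rw [Set.Finite.mem_toFinset]
    refine ⟨⟨a, ha, ha0⟩, ENNReal.ofReal_le_ofReal (Real.exp_le_exp.2 ?_), rfl⟩
    nlinarith [Real.pi_pos]

lemma nzTheta_anti (I : (FractionalIdeal (𝓞 K)⁰ K)ˣ) {x y : InfinitePlace K → ℝ} (h : x ≤ y) :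
    nzTheta I y ≤ nzTheta I x := by
  refine ENNReal.tsum_le_tsum fun a => ENNReal.ofReal_le_ofReal (Real.exp_le_exp.2 ?_)
  nlinarith [Real.pi_pos, placeForm_mono h a.1]

lemma unitTheta_anti (I : (FractionalIdeal (𝓞 K)⁰ K)ˣ) {s t : ℝ} (hs : 0 < s) (hst : s ≤ t) :
    unitTheta I t ≤ unitTheta I s := by
  refine lintegral_mono fun y => nzTheta_anti I fun w => ?_
  have := Real.log_le_log hs hst
  unfold logPoint
  gcongr

lemma unitTheta_ne_top (I : (FractionalIdeal (𝓞 K)⁰ K)ˣ) (t : ℝ) :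
    unitTheta I t ≠ ⊤ := by
  obtain ⟨C, hC⟩ := exists_le_logPoint (K := K)
  set x : InfinitePlace K → ℝ := fun _ => 2 * (Real.log t / finrank ℚ K) + C
  have h : unitTheta I t ≤ ∫⁻ y in unitDomain K, nzTheta I x := by
    refine setLIntegral_mono measurable_const fun y hy => nzTheta_anti I fun w => ?_
    have := hC y hy w
    simp only [logPoint, zero_div, zero_add] at this
    simp only [x, logPoint]
    linarith
  refine ne_top_of_le_ne_top ?_ h
  rw [setLIntegral_const]
  exact ENNReal.mul_ne_top (nzTheta_ne_top I x) volume_unitDomain_ne_top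

lemma exists_unitTheta_le (I : (FractionalIdeal (𝓞 K)⁰ K)ˣ) :
    ∃ c > 0, ∀ t ≥ 1, unitTheta I t ≤
      ENNReal.ofReal (Real.exp (-c * (t ^ (2 / (finrank ℚ K : ℝ)) - 1))) * unitTheta I 1 := by
  obtain ⟨C, hC⟩ := exists_le_logPoint (K := K)
  obtain ⟨κ, hκ, hκ'⟩ := exists_pos_le_placeForm I fun _ => C
  refine ⟨Real.pi * κ, by positivity, fun t ht => ?_⟩
  rw [unitTheta, unitTheta, ← lintegral_const_mul' _ _ ENNReal.ofReal_ne_top]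
  refine setLIntegral_mono' (ZSpan.fundamentalDomain_measurableSet _) fun y hy => ?_
  rw [nzTheta, nzTheta, ← ENNReal.tsum_mul_left]
  refine ENNReal.tsum_le_tsum fun a => ?_
  rw [← ENNReal.ofReal_mul (Real.exp_pos _).le, ← Real.exp_add]
  refine ENNReal.ofReal_le_ofReal (Real.exp_le_exp.2 ?_)
  rw [placeForm_logPoint_log (by linarith), Real.log_one]
  have h1 : κ ≤ placeForm (logPoint 0 y) a.1 :=
    (hκ' a.1 a.2.1 a.2.2).trans (placeForm_mono (hC y hy) _)
  have h2 : 0 ≤ t ^ (2 / (finrank ℚ K : ℝ)) - 1 :=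
    sub_nonneg.2 (Real.one_le_rpow ht (by positivity))
  nlinarith [mul_nonneg Real.pi_pos.le (mul_nonneg h2 (sub_nonneg.2 h1))]

/-- The complex-valued theta integral, including the contribution of zero. -/
noncomputable def unitThetaFull (I : (FractionalIdeal (𝓞 K)⁰ K)ˣ) (t : ℝ) : ℂ :=
  (((unitTheta I t).toReal + (volume (unitDomain K)).toReal : ℝ) : ℂ)

lemma locallyIntegrableOn_unitThetaFull (I : (FractionalIdeal (𝓞 K)⁰ K)ˣ) :
    LocallyIntegrableOn (unitThetaFull I) (Set.Ioi 0) := by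
  rw [locallyIntegrableOn_iff isOpen_Ioi.isLocallyClosed]
  intro k hk hkc
  unfold unitThetaFull
  refine Integrable.ofReal ?_
  refine AntitoneOn.integrableOn_isCompact hkc fun s hs t ht hst => ?_
  have := ENNReal.toReal_mono (unitTheta_ne_top I s) (unitTheta_anti I (hk hs) hst)
  change (unitTheta I t).toReal + _ ≤ (unitTheta I s).toReal + _
  linarith

lemma unitThetaFull_one_div (I : (FractionalIdeal (𝓞 K)⁰ K)ˣ) {t : ℝ} (ht : 0 < t) :
    unitThetaFull I (1 / t) =
      (((((FractionalIdeal.absNorm (I : FractionalIdeal (𝓞 K)⁰ K) : ℚ) : ℝ) *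
        √|(discr K : ℝ)|)⁻¹ : ℝ) * t : ℂ) * unitThetaFull (dualUnit I) t := by
  have h := congrArg ENNReal.toReal (unitTheta_inv I ht)
  have hN := absNorm_pos I
  rw [ENNReal.toReal_add volume_unitDomain_ne_top (unitTheta_ne_top _ _), ENNReal.toReal_mul,
    ENNReal.toReal_add volume_unitDomain_ne_top (unitTheta_ne_top _ _),
    ENNReal.toReal_ofReal (by positivity)] at h
  rw [one_div, unitThetaFull, unitThetaFull, add_comm, h, add_comm]
  push_cast
  ring

lemma isBigO_unitThetaFull (I : (FractionalIdeal (𝓞 K)⁰ K)ˣ) (r : ℝ) :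
    (unitThetaFull I · - (((volume (unitDomain K)).toReal : ℝ) : ℂ)) =O[atTop] (· ^ r) := by
  obtain ⟨c, hc, hle⟩ := exists_unitTheta_le I
  set e : ℝ := 2 / (finrank ℚ K : ℝ) with he
  have hn : (0 : ℝ) < finrank ℚ K := by exact_mod_cast finrank_pos (R := ℚ) (M := K)
  have he0 : 0 < e := by positivity
  have h1 := ((isLittleO_exp_neg_mul_rpow_atTop hc (r / e)).comp_tendsto
    (tendsto_rpow_atTop he0)).isBigO
  refine (Asymptotics.IsBigO.of_bound (Real.exp c * (unitTheta I 1).toReal) ?_).trans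
    (h1.congr' (EventuallyEq.refl _ _) ?_)
  · filter_upwards [eventually_ge_atTop 1] with t ht
    have h2 := ENNReal.toReal_mono (ENNReal.mul_ne_top ENNReal.ofReal_ne_top
      (unitTheta_ne_top I 1)) (hle t ht)
    rw [ENNReal.toReal_mul, ENNReal.toReal_ofReal (Real.exp_pos _).le] at h2
    rw [unitThetaFull, ← Complex.ofReal_sub, Complex.norm_real, add_sub_cancel_right,
      Real.norm_of_nonneg ENNReal.toReal_nonneg, Function.comp, Real.norm_of_nonneg
      (Real.exp_pos _).le]
    refine h2.trans (le_of_eq ?_)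
    rw [mul_sub, sub_eq_add_neg, Real.exp_add]
    ring_nf
  · filter_upwards [eventually_gt_atTop 0] with t ht
    rw [Function.comp, ← Real.rpow_mul ht.le, mul_div_cancel₀ _ he0.ne']

/-- The functional equation pair attached to the theta function of a fractional ideal. -/
noncomputable def thetaPair (I : (FractionalIdeal (𝓞 K)⁰ K)ˣ) : WeakFEPair ℂ where
  f := unitThetaFull I
  g := unitThetaFull (dualUnit I)
  k := 1
  ε := ((((FractionalIdeal.absNorm (I : FractionalIdeal (𝓞 K)⁰ K) : ℚ) : ℝ) *
        √|(discr K : ℝ)|)⁻¹ : ℝ)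
  f₀ := (((volume (unitDomain K)).toReal : ℝ) : ℂ)
  g₀ := (((volume (unitDomain K)).toReal : ℝ) : ℂ)
  hf_int := locallyIntegrableOn_unitThetaFull I
  hg_int := locallyIntegrableOn_unitThetaFull _
  hk := one_pos
  hε := by
    have hN := absNorm_pos I
    have hd : 0 < √|(discr K : ℝ)| := Real.sqrt_pos.2 (abs_pos.2 (by exact_mod_cast discr_ne_zero K))
    exact Complex.ofReal_ne_zero.2 (by positivity)
  h_feq x hx := by rw [unitThetaFull_one_div I hx, Real.rpow_one, smul_eq_mul]
  hf_top := isBigO_unitThetaFull I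
  hg_top := isBigO_unitThetaFull _

end UnitThetaBounds

section UnitUnfolding

open mixedEmbedding InfinitePlace Module nonZeroDivisors Units.dirichletUnitTheorem
open scoped Classical Pointwise

variable {K : Type*} [Field K] [NumberField K]

lemma hyperplanePoint_mult_mul {f : InfinitePlace K → ℝ} (hf : ∑ w, (w.mult : ℝ) * f w = 0) :
    hyperplanePoint (fun v => (v.1.mult : ℝ) * f v.1) = f := by
  funext w
  have hm : (w.mult : ℝ) ≠ 0 := by exact_mod_cast mult_ne_zero
  rw [hyperplanePoint, div_eq_iff hm]
  split_ifs with h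
  · ring
  · have hw : w = w₀ := not_not.1 h
    rw [Fintype.sum_eq_add_sum_subtype_ne _ w₀] at hf
    rw [hw]
    linarith

lemma logPoint_add (τ τ' : ℝ) (y y' : logSpace K) :
    logPoint (τ + τ') (y + y') = logPoint τ y + logPoint τ' y' := by
  funext w
  simp only [logPoint, hyperplanePoint_add, Pi.add_apply]
  ring

lemma exists_logPoint_eq (x : InfinitePlace K → ℝ) :
    ∃ y : logSpace K, logPoint ((∑ w, (w.mult : ℝ) * x w) / 2) y = x := by
  have hn : (finrank ℚ K : ℝ) ≠ 0 := by exact_mod_cast (finrank_pos (R := ℚ) (M := K)).ne'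
  set S := ∑ w, (w.mult : ℝ) * x w
  refine ⟨fun v => (v.1.mult : ℝ) * (x v.1 / 2 - S / 2 / finrank ℚ K), ?_⟩
  funext w
  rw [logPoint, hyperplanePoint_mult_mul (f := fun w => x w / 2 - S / 2 / finrank ℚ K)]
  · ring
  · have h : ∀ w : InfinitePlace K, (w.mult : ℝ) * (x w / 2 - S / 2 / finrank ℚ K) =
        w.mult * x w * (1 / 2) - S / 2 / finrank ℚ K * w.mult := fun w => by ring
    simp_rw [h]
    rw [Finset.sum_sub_distrib, ← Finset.sum_mul, ← Finset.mul_sum, ← Nat.cast_sum, sum_mult_eq]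
    field_simp
    ring

lemma exp_sum_mult_log {a : K} (ha : a ≠ 0) :
    Real.exp (∑ w : InfinitePlace K, (w.mult : ℝ) * Real.log (w a)) =
      |(Algebra.norm ℚ a : ℝ)| := by
  rw [Real.exp_sum, ← Rat.cast_abs, ← prod_eq_abs_norm]
  refine Finset.prod_congr rfl fun w _ => ?_
  rw [Real.exp_nat_mul, Real.exp_log (pos_iff.2 ha)]

lemma placeForm_eq_placeForm_one (x : InfinitePlace K → ℝ) {a : K} (ha : a ≠ 0) :
    placeForm x a = placeForm (x + fun w => 2 * Real.log (w a)) 1 := by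
  refine Finset.sum_congr rfl fun w _ => ?_
  rw [Pi.add_apply, Real.exp_add, map_one,
    show (2 : ℝ) * Real.log (w a) = (2 : ℕ) * Real.log (w a) by norm_num,
    Real.exp_nat_mul, Real.exp_log (pos_iff.2 ha)]
  ring

lemma exists_placeForm_logPoint_eq {a : K} (ha : a ≠ 0) :
    ∃ τ' : ℝ, Real.exp τ' = |(Algebra.norm ℚ a : ℝ)| ∧ ∃ y' : logSpace K, ∀ τ y,
      placeForm (logPoint τ y) a = placeForm (logPoint (τ + τ') (y + y')) 1 := by
  obtain ⟨y', hy'⟩ := exists_logPoint_eq fun w : InfinitePlace K => 2 * Real.log (w a)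
  refine ⟨(∑ w : InfinitePlace K, (w.mult : ℝ) * (2 * Real.log (w a))) / 2, ?_, y',
    fun τ y => ?_⟩
  · rw [← exp_sum_mult_log ha]
    congr 1
    rw [Finset.sum_div]
    refine Finset.sum_congr rfl fun w _ => by ring
  · rw [placeForm_eq_placeForm_one _ ha, logPoint_add, hy']

lemma tsum_units_eq (h : logSpace K → ENNReal) :
    ∑' u : (𝓞 K)ˣ, h (Units.logEmbedding K (Additive.ofMul u)) =
      Units.torsionOrder K * ∑' g : Units.unitLattice K, h g.1 := by
  let φ : (𝓞 K)ˣ → Units.unitLattice K := fun u =>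
    ⟨Units.logEmbedding K (Additive.ofMul u), ⟨Additive.ofMul u, trivial, rfl⟩⟩
  rw [← (Equiv.sigmaFiberEquiv φ).tsum_eq, ENNReal.tsum_sigma', ← ENNReal.tsum_mul_left]
  refine tsum_congr fun g => ?_
  obtain ⟨g, u₀, -, rfl⟩ := g
  have h1 : ∀ u : {u // φ u = ⟨_, u₀, trivial, rfl⟩},
      h (Units.logEmbedding K (Additive.ofMul ((Equiv.sigmaFiberEquiv φ) ⟨_, u⟩))) =
        h (Units.logEmbedding K u₀) := fun u => by
    have := congrArg Subtype.val u.2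
    exact congrArg h this
  have e : Units.torsion K ≃ {u // φ u = ⟨_, u₀, trivial, rfl⟩} :=
    { toFun := fun ζ => ⟨u₀.toMul * ζ.1, Subtype.ext (by
        have : Units.logEmbedding K (Additive.ofMul (ζ.1)) = 0 := logEmbedding_eq_zero_iff.2 ζ.2
        change Units.logEmbedding K (u₀ + Additive.ofMul ζ.1) = Units.logEmbedding K u₀
        rw [map_add, this, add_zero])⟩
      invFun := fun u => ⟨u₀.toMul⁻¹ * u.1, by
        have h2 : Units.logEmbedding K (Additive.ofMul u.1) = Units.logEmbedding K u₀ :=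
          congrArg Subtype.val u.2
        refine logEmbedding_eq_zero_iff.1 ?_
        change Units.logEmbedding K (-u₀ + Additive.ofMul u.1) = 0
        rw [map_add, map_neg, h2, neg_add_cancel]⟩
      left_inv := fun ζ => Subtype.ext (by simp)
      right_inv := fun u => Subtype.ext (by simp) }
  have h3 : ∑' u : {u // φ u = ⟨_, u₀, trivial, rfl⟩},
      h (Units.logEmbedding K (Additive.ofMul ((Equiv.sigmaFiberEquiv φ) ⟨_, u⟩))) =
      ∑' _ : Units.torsion K, h (Units.logEmbedding K u₀) := by
    rw [← e.tsum_eq]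
    exact tsum_congr fun ζ => h1 _
  refine h3.trans ?_
  have := Fintype.ofFinite (Units.torsion K)
  rw [tsum_fintype, Finset.sum_const, nsmul_eq_mul, Finset.card_univ, Units.torsionOrder,
    Nat.card_eq_fintype_card]
  rfl

/-- The Gaussian integral attached to a number field. -/
noncomputable def placeGamma (K : Type*) [Field K] [NumberField K] (σ : ℝ) : ENNReal :=
  ∫⁻ τ : ℝ, ENNReal.ofReal (Real.exp (σ * τ)) * ∫⁻ y : logSpace K,
    ENNReal.ofReal (Real.exp (-Real.pi * placeForm (logPoint τ y) (1 : K)))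

lemma measurable_exp_placeForm (a : K) :
    Measurable fun p : ℝ × logSpace K =>
      ENNReal.ofReal (Real.exp (-Real.pi * placeForm (logPoint p.1 p.2) a)) := by
  have : Continuous fun p : ℝ × logSpace K => placeForm (logPoint p.1 p.2) a :=
    (continuous_placeForm a).comp continuous_logPoint
  exact (ENNReal.continuous_ofReal.comp
    (Real.continuous_exp.comp (continuous_const.mul this))).measurable

lemma countable_of_numberField : Countable K := (finBasis ℚ K).equivFun.injective.countable

lemma countable_units : Countable (𝓞 K)ˣ := by
  have := countable_of_numberField (K := K)
  exact Function.Injective.countable (f := fun u : (𝓞 K)ˣ => (u : K)) fun u v h =>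
    Units.ext (RingOfIntegers.ext h)

lemma lintegral_unitDomain_translates (F : logSpace K → ENNReal) (y' : logSpace K) :
    ∑' u : (𝓞 K)ˣ, ∫⁻ y in unitDomain K, F (Units.logEmbedding K (Additive.ofMul u) + y + y') =
      Units.torsionOrder K * ∫⁻ y, F y := by
  have : MeasurableConstVAdd (Units.unitLattice K) (logSpace K) :=
    ⟨fun g => measurable_const_add g.1⟩
  have : VAddInvariantMeasure (Units.unitLattice K) (logSpace K) volume :=
    ⟨fun g _ _ => measure_preimage_add volume g.1 _⟩
  have h3 := (isAddFundamentalDomain_unitDomain (K := K)).lintegral_eq_tsum''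
    fun y => F (y + y')
  rw [lintegral_add_right_eq_self F] at h3
  rw [tsum_units_eq fun g => ∫⁻ y in unitDomain K, F (g + y + y'), h3]
  rfl

lemma tsum_units_lintegral_aux {F : ℝ → logSpace K → ENNReal} (hFm : Measurable (Function.uncurry F))
    (σ τ' : ℝ) (y' : logSpace K) :
    ∑' u : (𝓞 K)ˣ, ∫⁻ τ : ℝ, ENNReal.ofReal (Real.exp (σ * τ)) * ∫⁻ y in unitDomain K,
      F (τ + τ') (Units.logEmbedding K (Additive.ofMul u) + y + y') =
    Units.torsionOrder K * (∫⁻ τ : ℝ, ENNReal.ofReal (Real.exp (σ * τ)) * ∫⁻ y, F τ y) *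
      ENNReal.ofReal (Real.exp (-σ * τ')) := by
  have := countable_units (K := K)
  rw [← lintegral_tsum]
  · have h2 : ∀ τ : ℝ, ∑' u : (𝓞 K)ˣ, ENNReal.ofReal (Real.exp (σ * τ)) *
        ∫⁻ y in unitDomain K, F (τ + τ') (Units.logEmbedding K (Additive.ofMul u) + y + y') =
        (Units.torsionOrder K * ENNReal.ofReal (Real.exp (-σ * τ'))) *
          (ENNReal.ofReal (Real.exp (σ * (τ + τ'))) * ∫⁻ y, F (τ + τ') y) := fun τ => by
      rw [ENNReal.tsum_mul_left, lintegral_unitDomain_translates (F (τ + τ')) y',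
        show σ * τ = -σ * τ' + σ * (τ + τ') by ring, Real.exp_add,
        ENNReal.ofReal_mul (Real.exp_pos _).le]
      ring
    rw [lintegral_congr h2, lintegral_const_mul' _ _
      (ENNReal.mul_ne_top (by simp) ENNReal.ofReal_ne_top),
      lintegral_add_right_eq_self (fun τ => ENNReal.ofReal (Real.exp (σ * τ)) * ∫⁻ y, F τ y) τ',
      mul_right_comm]
  · intro u
    refine Measurable.aemeasurable ?_
    refine (by fun_prop : Measurable fun τ : ℝ => ENNReal.ofReal (Real.exp (σ * τ))).mul ?_
    refine Measurable.lintegral_prod_right' (f := fun p : ℝ × logSpace K =>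
      F (p.1 + τ') (Units.logEmbedding K (Additive.ofMul u) + p.2 + y')) ?_
    exact hFm.comp ((measurable_fst.add_const _).prodMk
      ((measurable_snd.const_add _).add_const _))

lemma tsum_units_lintegral {a : K} (ha : a ≠ 0) (σ : ℝ) :
    ∑' u : (𝓞 K)ˣ, ∫⁻ τ : ℝ, ENNReal.ofReal (Real.exp (σ * τ)) * ∫⁻ y in unitDomain K,
      ENNReal.ofReal (Real.exp (-Real.pi * placeForm (logPoint τ y) ((u : K) * a))) =
    Units.torsionOrder K * placeGamma K σ *
      ENNReal.ofReal (|(Algebra.norm ℚ a : ℝ)| ^ (-σ)) := by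
  obtain ⟨τ', hτ', y', hy'⟩ := exists_placeForm_logPoint_eq ha
  have h := tsum_units_lintegral_aux (F := fun τ y =>
    ENNReal.ofReal (Real.exp (-Real.pi * placeForm (logPoint τ y) (1 : K))))
    (measurable_exp_placeForm (1 : K)) σ τ' y'
  rw [← hτ', ← Real.exp_mul, mul_comm τ', placeGamma, ← h]
  refine tsum_congr fun u => lintegral_congr fun τ => ?_
  congr 1
  refine lintegral_congr fun y => ?_
  rw [← placeForm_logPoint_unit, hy']

end UnitUnfolding

section ThetaMellin

open mixedEmbedding InfinitePlace Module nonZeroDivisors Units.dirichletUnitTheorem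
open scoped Classical Pointwise

variable {K : Type*} [Field K] [NumberField K]

lemma lintegral_Ioi_rpow_mul (σ : ℝ) (f : ℝ → ENNReal) :
    ∫⁻ t in Set.Ioi (0 : ℝ), ENNReal.ofReal (t ^ (σ - 1)) * f t =
      ∫⁻ τ : ℝ, ENNReal.ofReal (Real.exp (σ * τ)) * f (Real.exp τ) := by
  have h := lintegral_image_eq_lintegral_abs_deriv_mul (s := Set.univ) (f := Real.exp)
    (f' := Real.exp) MeasurableSet.univ (fun x _ => (Real.hasDerivAt_exp x).hasDerivWithinAt)
    Real.exp_injective.injOn fun t => ENNReal.ofReal (t ^ (σ - 1)) * f t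
  rw [Set.image_univ, Real.range_exp, setLIntegral_univ] at h
  rw [h]
  refine lintegral_congr fun τ => ?_
  rw [← mul_assoc, ← ENNReal.ofReal_mul (abs_nonneg _), abs_of_pos (Real.exp_pos _),
    ← Real.exp_mul, ← Real.exp_add]
  ring_nf

/-- The contribution of a single element of the field to the Mellin transform of `unitTheta`. -/
noncomputable def elementMellin (σ : ℝ) (a : K) : ENNReal :=
  ∫⁻ τ : ℝ, ENNReal.ofReal (Real.exp (σ * τ)) * ∫⁻ y in unitDomain K,
      ENNReal.ofReal (Real.exp (-Real.pi * placeForm (logPoint τ y) a))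

lemma lintegral_unitTheta_eq_tsum (I : (FractionalIdeal (𝓞 K)⁰ K)ˣ) (σ : ℝ) :
    ∫⁻ t in Set.Ioi (0 : ℝ), ENNReal.ofReal (t ^ (σ - 1)) * unitTheta I t =
      ∑' a : {a : K // a ∈ (I : FractionalIdeal (𝓞 K)⁰ K) ∧ a ≠ 0}, elementMellin σ a.1 := by
  have := countable_of_numberField (K := K)
  rw [lintegral_Ioi_rpow_mul]
  simp only [unitTheta, Real.log_exp, nzTheta, elementMellin]
  rw [← lintegral_tsum]
  · refine lintegral_congr fun τ => ?_
    rw [lintegral_tsum, ENNReal.tsum_mul_left]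
    intro a
    exact ((measurable_exp_placeForm a.1).comp measurable_prodMk_left).aemeasurable
  · intro a
    refine Measurable.aemeasurable ?_
    refine (by fun_prop : Measurable fun τ : ℝ => ENNReal.ofReal (Real.exp (σ * τ))).mul ?_
    exact Measurable.lintegral_prod_right' (measurable_exp_placeForm a.1)

lemma exists_ideal_mul_eq_span (I : (FractionalIdeal (𝓞 K)⁰ K)ˣ)
    (a : {a : K // a ∈ (I : FractionalIdeal (𝓞 K)⁰ K) ∧ a ≠ 0}) :
    ∃ A : (Ideal (𝓞 K))⁰, ((A : Ideal (𝓞 K)) : FractionalIdeal (𝓞 K)⁰ K) * I =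
      FractionalIdeal.spanSingleton (𝓞 K)⁰ a.1 := by
  have h1 : FractionalIdeal.spanSingleton (𝓞 K)⁰ a.1 * ((I⁻¹ : (FractionalIdeal (𝓞 K)⁰ K)ˣ) :
      FractionalIdeal (𝓞 K)⁰ K) ≤ 1 := by
    rw [← Units.mul_inv I]
    gcongr
    exact FractionalIdeal.spanSingleton_le_iff_mem.2 a.2.1
  obtain ⟨A, hA⟩ := FractionalIdeal.le_one_iff_exists_coeIdeal.1 h1
  have h2 : (A : FractionalIdeal (𝓞 K)⁰ K) * I = FractionalIdeal.spanSingleton (𝓞 K)⁰ a.1 := by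
    rw [hA, mul_assoc, Units.inv_mul, mul_one]
  refine ⟨⟨A, mem_nonZeroDivisors_of_ne_zero ?_⟩, h2⟩
  rintro rfl
  rw [Ideal.zero_eq_bot, FractionalIdeal.coeIdeal_bot, zero_mul] at h2
  exact a.2.2 (FractionalIdeal.spanSingleton_eq_zero_iff.1 h2.symm)

lemma mk0_mul_mk_eq_one_iff (I : (FractionalIdeal (𝓞 K)⁰ K)ˣ) (A : (Ideal (𝓞 K))⁰) :
    ClassGroup.mk0 A * ClassGroup.mk K I = 1 ↔
      ∃ a : {a : K // a ∈ (I : FractionalIdeal (𝓞 K)⁰ K) ∧ a ≠ 0},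
        ((A : Ideal (𝓞 K)) : FractionalIdeal (𝓞 K)⁰ K) * I =
          FractionalIdeal.spanSingleton (𝓞 K)⁰ a.1 := by
  rw [← ClassGroup.mk_mk0 K, ← map_mul, ClassGroup.mk_eq_one_iff, FractionalIdeal.isPrincipal_iff]
  rw [Units.val_mul, FractionalIdeal.coe_mk0]
  constructor
  · rintro ⟨a, ha⟩
    have h0 : a ≠ 0 := by
      rintro rfl
      rw [FractionalIdeal.spanSingleton_zero, mul_eq_zero] at ha
      rcases ha with ha | ha
      · exact nonZeroDivisors.ne_zero A.2 (FractionalIdeal.coeIdeal_eq_zero.1 ha)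
      · exact I.ne_zero ha
    refine ⟨⟨a, ?_, h0⟩, ha⟩
    rw [← FractionalIdeal.spanSingleton_le_iff_mem, ← ha]
    exact (mul_le_mul_left FractionalIdeal.coeIdeal_le_one _).trans_eq (one_mul _)
  · rintro ⟨a, ha⟩
    exact ⟨a.1, ha⟩

lemma tsum_elementMellin_fiber (I : (FractionalIdeal (𝓞 K)⁰ K)ˣ) (σ : ℝ)
    (φ : {a : K // a ∈ (I : FractionalIdeal (𝓞 K)⁰ K) ∧ a ≠ 0} → (Ideal (𝓞 K))⁰)
    (hφ : ∀ a, ((φ a : Ideal (𝓞 K)) : FractionalIdeal (𝓞 K)⁰ K) * I =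
      FractionalIdeal.spanSingleton (𝓞 K)⁰ a.1) (A : (Ideal (𝓞 K))⁰) :
    ∑' a : {a // φ a = A}, elementMellin σ a.1.1 =
      if ClassGroup.mk0 A * ClassGroup.mk K I = 1 then
        Units.torsionOrder K * placeGamma K σ * ENNReal.ofReal
          (((Ideal.absNorm (A : Ideal (𝓞 K)) : ℝ) *
            (FractionalIdeal.absNorm (I : FractionalIdeal (𝓞 K)⁰ K) : ℚ)) ^ (-σ)) else 0 := by
  split_ifs with h
  · obtain ⟨a, ha⟩ := (mk0_mul_mk_eq_one_iff I A).1 h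
    have hinj : ∀ b, φ b = A ↔ FractionalIdeal.spanSingleton (𝓞 K)⁰ b.1 =
        FractionalIdeal.spanSingleton (𝓞 K)⁰ a.1 := fun b => by
      rw [← ha, ← hφ b, Units.mul_left_inj, FractionalIdeal.coeIdeal_inj]
      exact Subtype.ext_iff
    have hu : ∀ u : (𝓞 K)ˣ, φ (unitMulEquiv I u a) = A := fun u => by
      rw [hinj, FractionalIdeal.spanSingleton_eq_spanSingleton]
      refine ⟨u⁻¹, ?_⟩
      change u⁻¹ • ((u : K) * a.1) = a.1
      rw [Units.smul_def, Algebra.smul_def, ← mul_assoc, ← map_mul, Units.inv_mul, map_one, one_mul]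
    have hbij : Function.Bijective fun u : (𝓞 K)ˣ =>
        (⟨unitMulEquiv I u a, hu u⟩ : {a // φ a = A}) := by
      constructor
      · intro u v huv
        have h1 : (u : K) * a.1 = (v : K) * a.1 := congrArg (fun x => x.1.1) huv
        exact Units.ext (RingOfIntegers.ext (mul_right_cancel₀ a.2.2 h1))
      · rintro ⟨b, hb⟩
        obtain ⟨z, hz⟩ := FractionalIdeal.spanSingleton_eq_spanSingleton.1 ((hinj b).1 hb).symm
        refine ⟨z, Subtype.ext (Subtype.ext ?_)⟩
        rw [← hz, Units.smul_def, Algebra.smul_def]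
        rfl
    rw [← (Equiv.ofBijective _ hbij).tsum_eq]
    have hn : ((Ideal.absNorm (A : Ideal (𝓞 K)) : ℝ) *
        (FractionalIdeal.absNorm (I : FractionalIdeal (𝓞 K)⁰ K) : ℚ)) =
          |(Algebra.norm ℚ a.1 : ℝ)| := by
      have h2 := congrArg FractionalIdeal.absNorm ha
      rw [map_mul, FractionalIdeal.coeIdeal_absNorm, FractionalIdeal.absNorm_span_singleton] at h2
      exact_mod_cast h2
    rw [hn, ← tsum_units_lintegral a.2.2]
    rfl
  · have : IsEmpty {a // φ a = A} :=
      ⟨fun a => h ((mk0_mul_mk_eq_one_iff I A).2 ⟨a.1, by rw [← hφ a.1, a.2]⟩)⟩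
    rw [tsum_empty]

lemma lintegral_unitTheta_eq (I : (FractionalIdeal (𝓞 K)⁰ K)ˣ) (σ : ℝ) :
    ∫⁻ t in Set.Ioi (0 : ℝ), ENNReal.ofReal (t ^ (σ - 1)) * unitTheta I t =
      ∑' A : (Ideal (𝓞 K))⁰, if ClassGroup.mk0 A * ClassGroup.mk K I = 1 then
        Units.torsionOrder K * placeGamma K σ * ENNReal.ofReal
          (((Ideal.absNorm (A : Ideal (𝓞 K)) : ℝ) *
            (FractionalIdeal.absNorm (I : FractionalIdeal (𝓞 K)⁰ K) : ℚ)) ^ (-σ)) else 0 := by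
  choose φ hφ using exists_ideal_mul_eq_span I
  rw [lintegral_unitTheta_eq_tsum]
  have h := (Equiv.sigmaFiberEquiv φ).tsum_eq fun a => elementMellin σ a.1
  rw [← h, ENNReal.tsum_sigma']
  exact tsum_congr fun A => tsum_elementMellin_fiber I σ φ hφ A

end ThetaMellin

section PlaceGammaEval

open mixedEmbedding InfinitePlace Module nonZeroDivisors Units.dirichletUnitTheorem
open scoped Classical Pointwise

lemma integrable_and_integral_exp_mul_exp_neg_exp {a r : ℝ} (ha : 0 < a) (hr : 0 < r) :
    Integrable (fun x : ℝ => Real.exp (a * x) * Real.exp (-(r * Real.exp x))) ∧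
      ∫ x : ℝ, Real.exp (a * x) * Real.exp (-(r * Real.exp x)) = (1 / r) ^ a * Real.Gamma a := by
  have h0 : ∀ x : ℝ, |Real.exp x| • (Real.exp x ^ (a - 1) * Real.exp (-(r * Real.exp x))) =
      Real.exp (a * x) * Real.exp (-(r * Real.exp x)) := fun x => by
    rw [abs_of_pos (Real.exp_pos _), smul_eq_mul, ← mul_assoc, ← Real.exp_mul, ← Real.exp_add]
    ring_nf
  have hder : ∀ x ∈ Set.univ, HasDerivWithinAt Real.exp (Real.exp x) Set.univ x :=
    fun x _ => (Real.hasDerivAt_exp x).hasDerivWithinAt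
  constructor
  · have h := (integrableOn_image_iff_integrableOn_abs_deriv_smul MeasurableSet.univ hder
      Real.exp_injective.injOn fun t => t ^ (a - 1) * Real.exp (-(r * t))).1 (by
        rw [Set.image_univ, Real.range_exp]
        have := integrableOn_rpow_mul_exp_neg_mul_rpow (s := a - 1) (p := 1) (b := r)
          (by linarith) one_pos hr
        simpa using this)
    rw [integrableOn_univ] at h
    simpa only [h0] using h
  · have h := integral_image_eq_integral_abs_deriv_smul MeasurableSet.univ hder
      Real.exp_injective.injOn fun t => t ^ (a - 1) * Real.exp (-(r * t))
    rw [Set.image_univ, Real.range_exp, Real.integral_rpow_mul_exp_neg_mul_Ioi ha hr,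
      setIntegral_univ] at h
    rw [h]
    exact integral_congr_ae (.of_forall fun x => (h0 x).symm)

variable (K : Type*) [Field K] [NumberField K]

/-- `logPoint` as a linear map. -/
noncomputable def logPointLinear : (ℝ × logSpace K) →ₗ[ℝ] (InfinitePlace K → ℝ) where
  toFun p := logPoint p.1 p.2
  map_add' p q := logPoint_add _ _ _ _
  map_smul' c p := by
    funext w
    simp only [logPoint, hyperplanePoint, Prod.smul_fst, Prod.smul_snd, Pi.smul_apply, smul_eq_mul,
      RingHom.id_apply, ← Finset.mul_sum]
    split_ifs <;> ring

lemma bijective_logPointLinear : Function.Bijective (logPointLinear K) := by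
  have hs : Function.Surjective (logPointLinear K) := fun x => by
    obtain ⟨y, hy⟩ := exists_logPoint_eq x
    exact ⟨(_, y), hy⟩
  refine ⟨(LinearMap.injective_iff_surjective_of_finrank_eq_finrank ?_).2 hs, hs⟩
  rw [finrank_prod, finrank_self, finrank_fintype_fun_eq_card, finrank_fintype_fun_eq_card]
  have h : Fintype.card {w : InfinitePlace K // w ≠ w₀} = Fintype.card (InfinitePlace K) - 1 := by
    rw [Fintype.card_subtype_compl, Fintype.card_subtype_eq]
  have := Fintype.card_pos (α := InfinitePlace K)
  omega

lemma exists_lintegral_logPoint : ∃ c : ENNReal, c ≠ 0 ∧ c ≠ ⊤ ∧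
    ∀ F : (InfinitePlace K → ℝ) → ENNReal, Measurable F →
      ∫⁻ p : ℝ × logSpace K, F (logPoint p.1 p.2) = c * ∫⁻ x, F x := by
  let L : (ℝ × logSpace K) ≃L[ℝ] (InfinitePlace K → ℝ) :=
    (LinearEquiv.ofBijective _ (bijective_logPointLinear K)).toContinuousLinearEquiv
  have hv : (volume : Measure (ℝ × logSpace K)).IsAddHaarMeasure :=
    inferInstanceAs (Measure.prod (volume : Measure ℝ) (volume : Measure (logSpace K))).IsAddHaarMeasure
  have hL : (volume.map L : Measure (InfinitePlace K → ℝ)).IsAddHaarMeasure :=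
    L.isAddHaarMeasure_map volume
  obtain ⟨c, hc0, hc⟩ : ∃ c : NNReal, 0 < c ∧ volume.map L = c • volume :=
    ⟨_, Measure.addHaarScalarFactor_pos_of_isAddHaarMeasure _ _,
      Measure.isAddLeftInvariant_eq_smul (volume.map L) (volume : Measure (InfinitePlace K → ℝ))⟩
  refine ⟨c, by exact_mod_cast hc0.ne', ENNReal.coe_ne_top, fun F hF => ?_⟩
  have h1 : ∫⁻ x, F x ∂(volume.map L) = ∫⁻ p : ℝ × logSpace K, F (logPoint p.1 p.2) :=
    lintegral_map hF L.continuous.measurable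
  rw [← h1, hc, lintegral_smul_measure]
  rfl

/-- The Gamma factor of a number field at a real argument, as a product over places. -/
noncomputable def gammaProd (σ : ℝ) : ℝ :=
  ∏ w : InfinitePlace K, (1 / (Real.pi * w.mult)) ^ (σ * w.mult / 2) *
    Real.Gamma (σ * w.mult / 2)

lemma lintegral_exp_sum {σ : ℝ} (hσ : 0 < σ) :
    ∫⁻ x : InfinitePlace K → ℝ, ENNReal.ofReal (Real.exp (σ * ((∑ w, (w.mult : ℝ) * x w) / 2)) *
      Real.exp (-Real.pi * placeForm x (1 : K))) = ENNReal.ofReal (gammaProd K σ) := by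
  have hm : ∀ w : InfinitePlace K, (0 : ℝ) < w.mult := fun w => by exact_mod_cast mult_pos
  have h1 : ∀ x : InfinitePlace K → ℝ, Real.exp (σ * ((∑ w, (w.mult : ℝ) * x w) / 2)) *
      Real.exp (-Real.pi * placeForm x (1 : K)) = ∏ w : InfinitePlace K,
        (Real.exp (σ * w.mult / 2 * x w) * Real.exp (-(Real.pi * w.mult * Real.exp (x w)))) :=
    fun x => by
      rw [Finset.prod_mul_distrib, ← Real.exp_sum, ← Real.exp_sum]
      congr 2
      · rw [Finset.sum_div, Finset.mul_sum]
        exact Finset.sum_congr rfl fun w _ => by ring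
      · rw [placeForm, Finset.mul_sum]
        exact Finset.sum_congr rfl fun w _ => by rw [map_one]; ring
  have h2 := fun w : InfinitePlace K => integrable_and_integral_exp_mul_exp_neg_exp
    (a := σ * w.mult / 2) (r := Real.pi * w.mult) (by have := hm w; positivity)
    (mul_pos Real.pi_pos (hm w))
  simp_rw [h1]
  rw [← ofReal_integral_eq_lintegral_ofReal]
  · rw [integral_fintype_prod_volume_eq_prod (fun (w : InfinitePlace K) (x : ℝ) =>
      Real.exp (σ * w.mult / 2 * x) * Real.exp (-(Real.pi * w.mult * Real.exp x))), gammaProd]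
    congr 1
    exact Finset.prod_congr rfl fun w _ => (h2 w).2
  · exact Integrable.fintype_prod (f := fun (w : InfinitePlace K) (x : ℝ) =>
      Real.exp (σ * w.mult / 2 * x) * Real.exp (-(Real.pi * w.mult * Real.exp x)))
      fun w => (h2 w).1
  · exact .of_forall fun x => Finset.prod_nonneg fun w _ => by positivity

lemma exists_placeGamma_eq : ∃ c : ℝ, 0 < c ∧ ∀ σ : ℝ, 0 < σ →
    placeGamma K σ = ENNReal.ofReal (c * gammaProd K σ) := by
  obtain ⟨c, hc0, hct, h⟩ := exists_lintegral_logPoint K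
  refine ⟨c.toReal, ENNReal.toReal_pos hc0 hct, fun σ hσ => ?_⟩
  have hm : Measurable fun x : InfinitePlace K → ℝ => ENNReal.ofReal
      (Real.exp (σ * ((∑ w, (w.mult : ℝ) * x w) / 2)) *
        Real.exp (-Real.pi * placeForm x (1 : K))) := by
    have := continuous_placeForm (1 : K)
    exact (ENNReal.continuous_ofReal.comp ((by fun_prop : Continuous fun x : InfinitePlace K → ℝ =>
      Real.exp (σ * ((∑ w, (w.mult : ℝ) * x w) / 2))).mul
        (Real.continuous_exp.comp (continuous_const.mul this)))).measurable
  rw [ENNReal.ofReal_mul ENNReal.toReal_nonneg, ENNReal.ofReal_toReal hct, ← lintegral_exp_sum K hσ,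
    ← h _ hm, placeGamma, Measure.volume_eq_prod, lintegral_prod]
  · refine lintegral_congr fun τ => ?_
    rw [← lintegral_const_mul']
    · refine lintegral_congr fun y => ?_
      rw [sum_mult_logPoint, mul_div_cancel_left₀ _ two_ne_zero, ENNReal.ofReal_mul (Real.exp_pos _).le]
    · exact ENNReal.ofReal_ne_top
  · exact (hm.comp continuous_logPoint.measurable).aemeasurable

lemma gammaProd_eq {σ : ℝ} :
    gammaProd K σ = ((1 / Real.pi) ^ (σ / 2) * Real.Gamma (σ / 2)) ^ nrRealPlaces K *
      ((1 / (2 * Real.pi)) ^ σ * Real.Gamma σ) ^ nrComplexPlaces K := by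
  rw [gammaProd, prod_eq_prod_mul_prod]
  congr 1
  · rw [Finset.prod_congr rfl fun w _ => by rw [mult_isReal], Finset.prod_const, Finset.card_univ,
      nrRealPlaces]
    simp
  · rw [Finset.prod_congr rfl fun w _ => by rw [mult_isComplex], Finset.prod_const, Finset.card_univ,
      nrComplexPlaces]
    simp [mul_comm]

end PlaceGammaEval

section CompletedZeta

open mixedEmbedding InfinitePlace Module nonZeroDivisors Units.dirichletUnitTheorem
open scoped Classical Pointwise

lemma WeakFEPair.exists_norm_Λ₀_le (P : WeakFEPair ℂ) (a b : ℝ) :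
    ∃ C, ∀ s : ℂ, a ≤ s.re → s.re ≤ b → ‖P.Λ₀ s‖ ≤ C := by
  have hc : ∀ s : ℂ, IntegrableOn (fun t : ℝ => ‖(t : ℂ) ^ (s - 1) • P.f_modif t‖) (Set.Ioi 0) :=
    fun s => Integrable.norm (P.isStrongFEPair_toStrongFEPair.hasMellin s).1
  refine ⟨(∫ t in Set.Ioi (0 : ℝ), (‖(t : ℂ) ^ ((a : ℂ) - 1) • P.f_modif t‖ +
    ‖(t : ℂ) ^ ((b : ℂ) - 1) • P.f_modif t‖)), fun s hs hs' => ?_⟩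
  refine (norm_integral_le_integral_norm _).trans ?_
  refine setIntegral_mono_on (hc s) ((hc a).add (hc b)) measurableSet_Ioi fun t ht => ?_
  have ht : 0 < t := ht
  simp only [_root_.norm_smul, ← add_mul]
  refine mul_le_mul_of_nonneg_right ?_ (norm_nonneg _)
  simp only [norm_cpow_eq_rpow_re_of_pos ht, sub_re, ofReal_re, one_re]
  rcases le_total 1 t with h | h
  · exact (Real.rpow_le_rpow_of_exponent_le h (by linarith)).trans
      (le_add_of_nonneg_left (by positivity))
  · exact (Real.rpow_le_rpow_of_exponent_ge ht h (by linarith)).trans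
      (le_add_of_nonneg_right (by positivity))

variable {K : Type*} [Field K] [NumberField K]

/-- The completed zeta function of an ideal class, at a real argument. -/
noncomputable def classZeta (c : ClassGroup (𝓞 K)) (σ : ℝ) : ENNReal :=
  ∑' A : (Ideal (𝓞 K))⁰, if ClassGroup.mk0 A * c = 1 then
    Units.torsionOrder K * placeGamma K σ *
      ENNReal.ofReal ((Ideal.absNorm (A : Ideal (𝓞 K)) : ℝ) ^ (-σ)) else 0

lemma lintegral_unitTheta_eq_classZeta (I : (FractionalIdeal (𝓞 K)⁰ K)ˣ) (σ : ℝ) :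
    ∫⁻ t in Set.Ioi (0 : ℝ), ENNReal.ofReal (t ^ (σ - 1)) * unitTheta I t =
      classZeta (ClassGroup.mk K I) σ * ENNReal.ofReal
        (((FractionalIdeal.absNorm (I : FractionalIdeal (𝓞 K)⁰ K) : ℚ) : ℝ) ^ (-σ)) := by
  rw [lintegral_unitTheta_eq, classZeta, ← ENNReal.tsum_mul_right]
  refine tsum_congr fun A => ?_
  split_ifs
  · rw [Real.mul_rpow (Nat.cast_nonneg _) (absNorm_pos I).le, ENNReal.ofReal_mul (by positivity),
      mul_assoc, mul_assoc, mul_assoc]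
  · rw [zero_mul]

lemma hasMellin_unitTheta (I : (FractionalIdeal (𝓞 K)⁰ K)ˣ) {s : ℂ} (hs : 1 < s.re) :
    HasMellin (fun t => (((unitTheta I t).toReal : ℝ) : ℂ)) s ((thetaPair I).Λ s) := by
  have h := (thetaPair I).hasMellin (s := s) (by simpa [thetaPair] using hs)
  simpa [thetaPair, unitThetaFull] using h

lemma lintegral_unitTheta_ne_top (I : (FractionalIdeal (𝓞 K)⁰ K)ˣ) {σ : ℝ} (hσ : 1 < σ) :
    ∫⁻ t in Set.Ioi (0 : ℝ), ENNReal.ofReal (t ^ (σ - 1)) * unitTheta I t ≠ ⊤ := by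
  have h := (hasMellin_unitTheta I (s := (σ : ℂ)) (by simpa using hσ)).1.2
  refine (lt_of_eq_of_lt ?_ h).ne
  refine setLIntegral_congr_fun measurableSet_Ioi fun t ht => ?_
  have ht : 0 < t := ht
  have e : ((t : ℂ) ^ ((σ : ℂ) - 1)) = ((t ^ (σ - 1) : ℝ) : ℂ) := by
    rw [ofReal_cpow ht.le]; push_cast; rfl
  simp only [e, smul_eq_mul]
  rw [← ofReal_mul, ← ofReal_norm, Complex.norm_real, Real.norm_of_nonneg (by positivity),
    ENNReal.ofReal_mul (by positivity), ENNReal.ofReal_toReal (unitTheta_ne_top I t)]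

lemma thetaPair_Λ_eq (I : (FractionalIdeal (𝓞 K)⁰ K)ˣ) {σ : ℝ} (hσ : 1 < σ) :
    (thetaPair I).Λ σ = (((classZeta (ClassGroup.mk K I) σ).toReal *
      ((FractionalIdeal.absNorm (I : FractionalIdeal (𝓞 K)⁰ K) : ℚ) : ℝ) ^ (-σ) : ℝ) : ℂ) := by
  have h := (hasMellin_unitTheta I (s := (σ : ℂ)) (by simpa using hσ)).2
  have hN := absNorm_pos I
  rw [← h, ← ENNReal.toReal_ofReal (r := _ ^ (-σ)) (by positivity), ← ENNReal.toReal_mul,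
    ← lintegral_unitTheta_eq_classZeta, mellin]
  have e : ∀ t ∈ Set.Ioi (0 : ℝ), ((t : ℂ) ^ ((σ : ℂ) - 1)) • (((unitTheta I t).toReal : ℝ) : ℂ) =
      (((ENNReal.ofReal (t ^ (σ - 1)) * unitTheta I t).toReal : ℝ) : ℂ) := fun t ht => by
    have ht : 0 < t := ht
    rw [ENNReal.toReal_mul, ENNReal.toReal_ofReal (by positivity), ofReal_mul, ofReal_cpow ht.le]
    push_cast; rfl
  rw [setIntegral_congr_fun measurableSet_Ioi e, integral_complex_ofReal, integral_toReal]
  · refine (Measurable.mul ?_ (measurable_unitTheta I)).aemeasurable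
    exact ENNReal.measurable_ofReal.comp (measurable_id.pow_const _)
  · exact .of_forall fun t => ENNReal.mul_lt_top ENNReal.ofReal_lt_top
      (lt_top_iff_ne_top.2 (unitTheta_ne_top I t))

lemma exists_mk_eq (c : ClassGroup (𝓞 K)) :
    ∃ I : (FractionalIdeal (𝓞 K)⁰ K)ˣ, ClassGroup.mk K I = c :=
  ClassGroup.induction K (fun I => ⟨I, rfl⟩) c

lemma classZeta_ne_top (c : ClassGroup (𝓞 K)) {σ : ℝ} (hσ : 1 < σ) : classZeta c σ ≠ ⊤ := by
  obtain ⟨I, rfl⟩ := exists_mk_eq c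
  intro h
  have h1 := lintegral_unitTheta_ne_top I hσ
  rw [lintegral_unitTheta_eq_classZeta, h, ENNReal.top_mul] at h1
  · exact h1 rfl
  · have hN := absNorm_pos I
    exact (ENNReal.ofReal_pos.2 (by positivity)).ne'

lemma sum_classZeta (σ : ℝ) : ∑ c : ClassGroup (𝓞 K), classZeta c σ =
    Units.torsionOrder K * placeGamma K σ * ∑' A : (Ideal (𝓞 K))⁰,
      ENNReal.ofReal ((Ideal.absNorm (A : Ideal (𝓞 K)) : ℝ) ^ (-σ)) := by
  simp only [classZeta]
  rw [← Summable.tsum_finsetSum fun _ _ => ENNReal.summable, ← ENNReal.tsum_mul_left]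
  refine tsum_congr fun A => ?_
  rw [Finset.sum_eq_single ((ClassGroup.mk0 A)⁻¹)]
  · simp
  · intro c _ hc
    rw [if_neg fun h => hc (eq_inv_of_mul_eq_one_right h)]
  · simp

lemma mk_dualUnit (I : (FractionalIdeal (𝓞 K)⁰ K)ˣ) :
    ClassGroup.mk K (dualUnit I) = ClassGroup.mk K (dualUnit 1) * (ClassGroup.mk K I)⁻¹ := by
  rw [← map_inv, ← map_mul]
  congr 1
  ext1
  simp only [dualUnit, Units.val_mk0, Units.val_mul, Units.val_inv_eq_inv_val, Units.val_one]
  exact FractionalIdeal.dual_eq_mul_inv _ _ _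

lemma thetaPair_Λ_one_sub (I : (FractionalIdeal (𝓞 K)⁰ K)ˣ) {σ : ℝ} (hσ : 1 < σ) :
    (thetaPair I).Λ (1 - σ) = (thetaPair I).ε * (thetaPair (dualUnit I)).Λ σ := by
  have h := (thetaPair I).functional_equation σ
  have hk : (((thetaPair I).k : ℝ) : ℂ) = 1 := by simp [thetaPair]
  rw [hk] at h
  rw [h, smul_eq_mul]
  congr 1
  have h1 := ((thetaPair I).symm.hasMellin (s := σ) (by simpa [thetaPair] using hσ)).2
  have h2 := ((thetaPair (dualUnit I)).hasMellin (s := σ) (by simpa [thetaPair] using hσ)).2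
  rw [← h1, ← h2]
  rfl

variable (K) in
/-- The completed Dedekind zeta function, up to a constant factor and a power of the
discriminant. -/
noncomputable def completedDedekind (s : ℂ) : ℂ :=
  ∑ c : ClassGroup (𝓞 K), (((FractionalIdeal.absNorm
    ((exists_mk_eq c).choose : FractionalIdeal (𝓞 K)⁰ K) : ℚ) : ℝ) : ℂ) ^ s *
      (thetaPair (exists_mk_eq c).choose).Λ s

lemma completedDedekind_ofReal {σ : ℝ} (hσ : 1 < σ) :
    completedDedekind K σ = (((∑ c : ClassGroup (𝓞 K), classZeta c σ).toReal : ℝ) : ℂ) := by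
  rw [completedDedekind, ENNReal.toReal_sum fun c _ => classZeta_ne_top c hσ, ofReal_sum]
  refine Finset.sum_congr rfl fun c _ => ?_
  have hN := absNorm_pos (exists_mk_eq c).choose
  rw [thetaPair_Λ_eq _ hσ, (exists_mk_eq c).choose_spec, ← ofReal_cpow hN.le, ← ofReal_mul,
    mul_left_comm, ← Real.rpow_add hN, add_neg_cancel, Real.rpow_zero, mul_one]

lemma completedDedekind_one_sub_ofReal {σ : ℝ} (hσ : 1 < σ) :
    completedDedekind K (1 - σ) =
      ((|(discr K : ℝ)| ^ (σ - 1 / 2) : ℝ) : ℂ) * completedDedekind K σ := by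
  have hd : 0 < |(discr K : ℝ)| := abs_pos.2 (by exact_mod_cast discr_ne_zero K)
  rw [completedDedekind_ofReal hσ, ENNReal.toReal_sum fun c _ => classZeta_ne_top c hσ, ofReal_sum,
    ← Equiv.sum_comp ((Equiv.inv _).trans (Equiv.mulLeft (ClassGroup.mk K (dualUnit (K := K) 1)))),
    Finset.mul_sum, completedDedekind]
  refine Finset.sum_congr rfl fun c _ => ?_
  have hN := absNorm_pos (exists_mk_eq c).choose
  rw [thetaPair_Λ_one_sub _ hσ, thetaPair_Λ_eq _ hσ, mk_dualUnit, (exists_mk_eq c).choose_spec,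
    absNorm_dualUnit]
  set N : ℝ := ((FractionalIdeal.absNorm
    ((exists_mk_eq c).choose : FractionalIdeal (𝓞 K)⁰ K) : ℚ) : ℝ)
  have e : ((N : ℂ) ^ (1 - (σ : ℂ))) = ((N ^ (1 - σ) : ℝ) : ℂ) := by
    rw [ofReal_cpow hN.le]; push_cast; rfl
  change (N : ℂ) ^ (1 - (σ : ℂ)) * (((N * √|(discr K : ℝ)|)⁻¹ : ℝ) * _) = _
  rw [e, ← ofReal_mul, ← ofReal_mul, ← ofReal_mul]
  congr 1
  simp only [Equiv.trans_apply, Equiv.inv_apply, Equiv.coe_mulLeft]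
  rw [Real.inv_rpow (by positivity), Real.rpow_neg (by positivity), inv_inv,
    Real.mul_rpow hN.le hd.le, Real.rpow_sub hN, Real.rpow_sub hd, Real.rpow_one, Real.sqrt_eq_rpow]
  field_simp

lemma differentiableAt_completedDedekind {s : ℂ} (h0 : s ≠ 0) (h1 : s ≠ 1) :
    DifferentiableAt ℂ (completedDedekind K) s := by
  refine DifferentiableAt.fun_sum fun c _ => ?_
  have hN := absNorm_pos (exists_mk_eq c).choose
  refine DifferentiableAt.mul ?_ ?_
  · exact differentiableAt_id.const_cpow (Or.inl (ofReal_ne_zero.2 hN.ne'))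
  · exact (thetaPair _).differentiableAt_Λ (Or.inl h0) (Or.inl (by simpa [thetaPair] using h1))

end CompletedZeta

section FunctionalEquation

open InfinitePlace nonZeroDivisors

lemma isPreconnected_compl_zero_one : IsPreconnected ({0, 1}ᶜ : Set ℂ) :=
  ((Set.toFinite {(0 : ℂ), 1}).countable.isConnected_compl_of_one_lt_rank
    (by rw [Complex.rank_real_complex]; norm_num)).isPreconnected

lemma eq_of_forall_ofReal_eq {f g : ℂ → ℂ} (hf : ∀ s, s ≠ 0 → s ≠ 1 → DifferentiableAt ℂ f s)
    (hg : ∀ s, s ≠ 0 → s ≠ 1 → DifferentiableAt ℂ g s) (h : ∀ σ : ℝ, 1 < σ → f σ = g σ)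
    {s : ℂ} (h0 : s ≠ 0) (h1 : s ≠ 1) : f s = g s := by
  have hU : IsOpen ({0, 1}ᶜ : Set ℂ) := (Set.toFinite {(0 : ℂ), 1}).isClosed.isOpen_compl
  have hd : ∀ {f : ℂ → ℂ}, (∀ s, s ≠ 0 → s ≠ 1 → DifferentiableAt ℂ f s) →
      AnalyticOnNhd ℂ f ({0, 1}ᶜ : Set ℂ) := fun {f} hf =>
    DifferentiableOn.analyticOnNhd (fun s hs => by
      simp only [Set.mem_compl_iff, Set.mem_insert_iff, Set.mem_singleton_iff, not_or] at hs
      exact (hf s hs.1 hs.2).differentiableWithinAt) hU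
  refine (hd hf).eqOn_of_preconnected_of_frequently_eq (hd hg) isPreconnected_compl_zero_one
    (z₀ := 2) (by simp) ?_ (by simp [h0, h1])
  have ht : Tendsto (fun t : ℝ => (t : ℂ)) (𝓝[>] 2) (𝓝[≠] 2) := by
    refine tendsto_nhdsWithin_iff.2 ⟨?_, ?_⟩
    · exact (Complex.continuous_ofReal.tendsto' 2 2 (by simp)).mono_left nhdsWithin_le_nhds
    · filter_upwards [self_mem_nhdsWithin] with t ht
      have : (2 : ℝ) < t := ht
      simp only [Set.mem_compl_iff, Set.mem_singleton_iff]
      exact_mod_cast this.ne'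
  refine ht.frequently (Eventually.frequently ?_)
  filter_upwards [self_mem_nhdsWithin] with t ht
  have : (2 : ℝ) < t := ht
  exact h t (by linarith)

variable (K : Type*) [Field K] [NumberField K]

lemma abs_discr_pos : 0 < |(discr K : ℝ)| := abs_pos.2 (by exact_mod_cast discr_ne_zero K)

lemma completedDedekind_one_sub {s : ℂ} (h0 : s ≠ 0) (h1 : s ≠ 1) :
    completedDedekind K (1 - s) =
      ((|(discr K : ℝ)| : ℝ) : ℂ) ^ (s - 1 / 2) * completedDedekind K s := by
  have hd := abs_discr_pos K
  have hd' := ofReal_ne_zero.2 hd.ne'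
  refine eq_of_forall_ofReal_eq (f := fun s => completedDedekind K (1 - s))
    (g := fun s => ((|(discr K : ℝ)| : ℝ) : ℂ) ^ (s - 1 / 2) * completedDedekind K s)
    (fun s h0 h1 => ?_) (fun s h0 h1 => ?_) (fun σ hσ => ?_) h0 h1
  · exact DifferentiableAt.fun_comp' s (differentiableAt_completedDedekind (sub_ne_zero.2 h1.symm)
      (by simpa using h0)) (by fun_prop)
  · exact ((differentiableAt_id.sub_const _).const_cpow (Or.inl hd')).mul
      (differentiableAt_completedDedekind h0 h1)
  · rw [completedDedekind_one_sub_ofReal hσ, ofReal_cpow hd.le]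
    push_cast; rfl

/-- The reciprocal of the archimedean factor of the Dedekind zeta function. -/
noncomputable def archInv (r₁ r₂ : ℕ) (s : ℂ) : ℂ :=
  ((Real.pi : ℂ) ^ (s / 2) * (Gamma (s / 2))⁻¹) ^ r₁ *
    ((2 * Real.pi : ℂ) ^ s * (Gamma s)⁻¹) ^ r₂

lemma differentiable_archInv (r₁ r₂ : ℕ) : Differentiable ℂ (archInv r₁ r₂) := by
  have hp : (Real.pi : ℂ) ≠ 0 := ofReal_ne_zero.2 Real.pi_ne_zero
  have h2p : (2 * Real.pi : ℂ) ≠ 0 := mul_ne_zero two_ne_zero hp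
  intro s
  refine DifferentiableAt.mul (DifferentiableAt.pow (DifferentiableAt.mul ?_ ?_) _)
    (DifferentiableAt.pow (DifferentiableAt.mul ?_ ?_) _)
  · exact (differentiableAt_id.div_const 2).const_cpow (Or.inl hp)
  · exact DifferentiableAt.fun_comp' (g := fun z => (Gamma z)⁻¹) (f := fun z => z / 2) s
      (differentiable_one_div_Gamma _) (by fun_prop)
  · exact differentiableAt_id.const_cpow (Or.inl h2p)
  · exact differentiable_one_div_Gamma s

lemma archInv_ofReal {σ : ℝ} (hσ : 0 < σ) :
    archInv (nrRealPlaces K) (nrComplexPlaces K) σ * (gammaProd K σ : ℂ) = 1 := by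
  have hp := Real.pi_pos
  have hG := Real.Gamma_pos_of_pos hσ
  have hG2 := Real.Gamma_pos_of_pos (half_pos hσ)
  have e : archInv (nrRealPlaces K) (nrComplexPlaces K) σ = ((
      (Real.pi ^ (σ / 2) * (Real.Gamma (σ / 2))⁻¹) ^ nrRealPlaces K *
      ((2 * Real.pi) ^ σ * (Real.Gamma σ)⁻¹) ^ nrComplexPlaces K : ℝ) : ℂ) := by
    rw [archInv]
    push_cast
    rw [ofReal_cpow hp.le, ofReal_cpow (by positivity), Gamma_ofReal, ← Gamma_ofReal (σ / 2)]
    push_cast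
    rfl
  rw [e, gammaProd_eq, ← ofReal_mul, ← ofReal_one]
  congr 1
  rw [mul_mul_mul_comm, ← mul_pow, ← mul_pow, Real.div_rpow one_pos.le hp.le,
    Real.div_rpow one_pos.le (by positivity), Real.one_rpow, Real.one_rpow]
  have h1 : 0 < Real.pi ^ (σ / 2) := by positivity
  have h2 : 0 < (2 * Real.pi) ^ σ := by positivity
  have e1 : Real.pi ^ (σ / 2) * (Real.Gamma (σ / 2))⁻¹ *
    (1 / Real.pi ^ (σ / 2) * Real.Gamma (σ / 2)) = 1 := by field_simp
  have e2 : (2 * Real.pi) ^ σ * (Real.Gamma σ)⁻¹ *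
    (1 / (2 * Real.pi) ^ σ * Real.Gamma σ) = 1 := by field_simp
  rw [e1, e2, one_pow, one_pow, one_mul]

variable {ζK : ℂ → ℂ}

lemma tsum_ideal_eq (hζ_ser : ∀ s : ℂ, 1 < s.re →
      HasSum (fun I : {I : Ideal (𝓞 K) // I ≠ ⊥} =>
        ((Ideal.absNorm I.1 : ℕ) : ℂ) ^ (-s)) (ζK s)) {σ : ℝ} (hσ : 1 < σ) :
    ζK σ = (((∑' A : (Ideal (𝓞 K))⁰,
      ENNReal.ofReal ((Ideal.absNorm (A : Ideal (𝓞 K)) : ℝ) ^ (-σ))).toReal : ℝ) : ℂ) := by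
  have h := hζ_ser σ (by simpa using hσ)
  have e : ∀ I : {I : Ideal (𝓞 K) // I ≠ ⊥}, ((Ideal.absNorm I.1 : ℕ) : ℂ) ^ (-(σ : ℂ)) =
      ((((Ideal.absNorm I.1 : ℕ) : ℝ) ^ (-σ) : ℝ) : ℂ) := fun I => by
    rw [ofReal_cpow (Nat.cast_nonneg _)]; push_cast; rfl
  simp only [e] at h
  have hs := Complex.hasSum_re h
  simp only [ofReal_re] at hs
  rw [← h.tsum_eq, ← Complex.ofReal_tsum]
  congr 1
  rw [← (Equiv.subtypeEquivRight fun I : Ideal (𝓞 K) =>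
      (mem_nonZeroDivisors_iff_ne_zero (x := I)).symm).tsum_eq fun A : (Ideal (𝓞 K))⁰ =>
      ENNReal.ofReal ((Ideal.absNorm (A : Ideal (𝓞 K)) : ℝ) ^ (-σ)),
    ENNReal.tsum_toReal_eq fun _ => ENNReal.ofReal_ne_top]
  exact tsum_congr fun I => (ENNReal.toReal_ofReal (by positivity)).symm

lemma exists_mul_zeta_eq (hζ_an : ∀ s : ℂ, s ≠ 1 → DifferentiableAt ℂ ζK s)
    (hζ_ser : ∀ s : ℂ, 1 < s.re →
      HasSum (fun I : {I : Ideal (𝓞 K) // I ≠ ⊥} =>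
        ((Ideal.absNorm I.1 : ℕ) : ℂ) ^ (-s)) (ζK s)) :
    ∃ c : ℂ, c ≠ 0 ∧ ∀ s : ℂ, s ≠ 0 → s ≠ 1 → c * ζK s =
      completedDedekind K s * archInv (nrRealPlaces K) (nrComplexPlaces K) s := by
  obtain ⟨c, hc, h⟩ := exists_placeGamma_eq K
  refine ⟨(((Units.torsionOrder K : ℝ) * c : ℝ) : ℂ), ?_, fun s h0 h1 =>
    eq_of_forall_ofReal_eq (f := fun s => (((Units.torsionOrder K : ℝ) * c : ℝ) : ℂ) * ζK s)
      (g := fun s => completedDedekind K s * archInv (nrRealPlaces K) (nrComplexPlaces K) s)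
      (fun s _ h1 => (hζ_an s h1).const_mul _) (fun s h0 h1 => ?_) (fun σ hσ => ?_) h0 h1⟩
  · have : (Units.torsionOrder K : ℝ) ≠ 0 := Nat.cast_ne_zero.2 (NeZero.ne _)
    exact ofReal_ne_zero.2 (mul_ne_zero this hc.ne')
  · exact (differentiableAt_completedDedekind h0 h1).mul (differentiable_archInv _ _ s)
  · have hσ0 : 0 < σ := by linarith
    have hg : 0 ≤ gammaProd K σ := by
      have h1 := Real.Gamma_pos_of_pos hσ0
      have h2 := Real.Gamma_pos_of_pos (half_pos hσ0)
      rw [gammaProd_eq]; positivity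
    have hA := archInv_ofReal K hσ0
    rw [completedDedekind_ofReal hσ, sum_classZeta, h σ hσ0, tsum_ideal_eq K hζ_ser hσ,
      ENNReal.toReal_mul, ENNReal.toReal_mul, ENNReal.toReal_ofReal (by positivity),
      ENNReal.toReal_natCast]
    push_cast
    linear_combination (-((Units.torsionOrder K : ℂ) * c * ((∑' A : (Ideal (𝓞 K))⁰,
      ENNReal.ofReal ((Ideal.absNorm (A : Ideal (𝓞 K)) : ℝ) ^ (-σ))).toReal : ℂ))) * hA

/-- The product of Gamma functions attached to a signature. -/
noncomputable def archGamma (r₁ r₂ : ℕ) (s : ℂ) : ℂ := Gamma (s / 2) ^ r₁ * Gamma s ^ r₂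

lemma archInv_mul_archGamma (r₁ r₂ : ℕ) {s : ℂ} (hs : ∀ m : ℕ, s ≠ -m) :
    archInv r₁ r₂ s * archGamma r₁ r₂ s =
      ((Real.pi : ℂ) ^ (s / 2)) ^ r₁ * ((2 * Real.pi : ℂ) ^ s) ^ r₂ := by
  have h1 : Gamma s ≠ 0 := Gamma_ne_zero hs
  have h2 : Gamma (s / 2) ≠ 0 := Gamma_ne_zero fun m h => hs (2 * m) (by
    push_cast; linear_combination 2 * h)
  rw [archInv, archGamma]
  rw [mul_pow, mul_pow, inv_pow, inv_pow]
  field_simp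

lemma zeta_functional_equation (hζ_an : ∀ s : ℂ, s ≠ 1 → DifferentiableAt ℂ ζK s)
    (hζ_ser : ∀ s : ℂ, 1 < s.re →
      HasSum (fun I : {I : Ideal (𝓞 K) // I ≠ ⊥} =>
        ((Ideal.absNorm I.1 : ℕ) : ℂ) ^ (-s)) (ζK s)) {η : ℝ}
    (hη : η = 4 ^ nrComplexPlaces K * Real.pi ^ Module.finrank ℚ K / |(discr K : ℝ)|)
    {s : ℂ} (hs : ∀ m : ℤ, s ≠ m) :
    ζK (1 - s) * archGamma (nrRealPlaces K) (nrComplexPlaces K) (1 - s) * (η : ℂ) ^ (s - 1 / 2) =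
      ζK s * archGamma (nrRealPlaces K) (nrComplexPlaces K) s := by
  obtain ⟨c, hc, h⟩ := exists_mul_zeta_eq K hζ_an hζ_ser
  have h0 : s ≠ 0 := by simpa using hs 0
  have h1 : s ≠ 1 := by simpa using hs 1
  have e1 := h s h0 h1
  have e2 := h (1 - s) (sub_ne_zero.2 h1.symm) (by simpa using h0)
  have e3 := completedDedekind_one_sub K h0 h1
  have e4 := archInv_mul_archGamma (nrRealPlaces K) (nrComplexPlaces K) (s := s)
    fun m => by simpa using hs (-m)
  have e5 := archInv_mul_archGamma (nrRealPlaces K) (nrComplexPlaces K) (s := 1 - s)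
    fun m hm => hs (1 + m) (by push_cast; linear_combination -hm)
  have hd := abs_discr_pos K
  have hp := Real.pi_pos
  have hη0 : 0 < η := by rw [hη]; positivity
  have e6 : ((Real.pi : ℂ) ^ ((1 - s) / 2)) ^ nrRealPlaces K *
      ((2 * Real.pi : ℂ) ^ (1 - s)) ^ nrComplexPlaces K *
      (((|(discr K : ℝ)| : ℝ) : ℂ) ^ (s - 1 / 2) * (η : ℂ) ^ (s - 1 / 2)) =
      ((Real.pi : ℂ) ^ (s / 2)) ^ nrRealPlaces K * ((2 * Real.pi : ℂ) ^ s) ^ nrComplexPlaces K := by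
    have hl : Real.log |(discr K : ℝ)| + Real.log η =
        nrRealPlaces K * Real.log Real.pi + 2 * nrComplexPlaces K * Real.log (2 * Real.pi) := by
      rw [← Real.log_mul hd.ne' hη0.ne', hη, mul_div_cancel₀ _ hd.ne', ←
        card_add_two_mul_card_eq_rank, pow_add, pow_mul, Real.log_mul (by positivity) (by positivity),
        Real.log_mul (by positivity) (by positivity), Real.log_mul (by positivity) (by positivity),
        Real.log_pow, Real.log_pow, Real.log_pow, Real.log_pow,
        show (4 : ℝ) = 2 ^ 2 by norm_num, Real.log_pow]
      push_cast; ring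
    have hl' : ((Real.log |(discr K : ℝ)| : ℝ) : ℂ) + (Real.log η : ℝ) =
        nrRealPlaces K * (Real.log Real.pi : ℝ) +
          2 * nrComplexPlaces K * (Real.log (2 * Real.pi) : ℝ) := by exact_mod_cast hl
    have h2p : (2 * Real.pi : ℂ) = ((2 * Real.pi : ℝ) : ℂ) := by push_cast; rfl
    have hcp : ∀ {x : ℝ}, 0 < x → ∀ z : ℂ, (x : ℂ) ^ z = exp ((Real.log x : ℝ) * z) :=
      fun {x} hx z => by rw [cpow_def_of_ne_zero (ofReal_ne_zero.2 hx.ne'), ofReal_log hx.le]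
    rw [h2p]
    simp only [hcp hp, hcp hd, hcp hη0, hcp (mul_pos two_pos hp), ← exp_nat_mul, ← exp_add]
    congr 1
    linear_combination (s - 1 / 2) * hl'
  refine mul_left_cancel₀ hc ?_
  rw [e3] at e2
  linear_combination archGamma (nrRealPlaces K) (nrComplexPlaces K) (1 - s) * (η : ℂ) ^ (s - 1 / 2)
    * e2 - archGamma (nrRealPlaces K) (nrComplexPlaces K) s * e1 +
    ((|(discr K : ℝ)| : ℝ) : ℂ) ^ (s - 1 / 2) * completedDedekind K s * (η : ℂ) ^ (s - 1 / 2) * e5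
    - completedDedekind K s * e4 + completedDedekind K s * e6

end FunctionalEquation

section VonMangoldt

open UniqueFactorizationMonoid
open scoped Classical

variable {K : Type*} [Field K] [NumberField K]

variable (K) in
/-- The logarithm of the norm of a prime ideal, extended by zero to all ideals. -/
noncomputable def primeLog (P : Ideal (𝓞 K)) : ℝ :=
  if Prime P then Real.log (Ideal.absNorm P) else 0

lemma primeLog_nonneg (P : Ideal (𝓞 K)) : 0 ≤ primeLog K P := by
  rw [primeLog]; split_ifs
  · exact Real.log_natCast_nonneg _
  · exact le_rfl

lemma absNorm_pos_of_ne_bot {I : Ideal (𝓞 K)} (hI : I ≠ ⊥) : 0 < Ideal.absNorm I :=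
  Nat.pos_of_ne_zero fun h => hI (Ideal.absNorm_eq_zero_iff.1 h)

lemma hasSum_primeLog {I : Ideal (𝓞 K)} (hI : I ≠ ⊥) :
    HasSum (fun q : Ideal (𝓞 K) × ℕ => if q.1 ^ (q.2 + 1) ∣ I then primeLog K q.1 else 0)
      (Real.log (Ideal.absNorm I)) := by
  set M := normalizedFactors I with hM
  have hp : ∀ P ∈ M, Prime P := fun P hP => prime_of_normalized_factor P hP
  have hdvd : ∀ (P : Ideal (𝓞 K)) (k : ℕ), Prime P → (P ^ k ∣ I ↔ k ≤ M.count P) := fun P k hP => by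
    rw [pow_dvd_iff_le_emultiplicity, emultiplicity_eq_count_normalizedFactors hP.irreducible hI,
      normalize_eq, Nat.cast_le]
  have e : Real.log (Ideal.absNorm I) = ∑ q ∈ M.toFinset ×ˢ Finset.range M.card,
      if q.1 ^ (q.2 + 1) ∣ I then primeLog K q.1 else 0 := by
    have h1 : Real.log (Ideal.absNorm I) = (M.map fun P => Real.log (Ideal.absNorm P)).sum := by
      conv_lhs => rw [← Ideal.prod_normalizedFactors_eq_self hI]
      rw [map_multiset_prod, ← hM]
      have : ∀ M : Multiset (Ideal (𝓞 K)), (∀ P ∈ M, P ≠ ⊥) →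
          Real.log ((M.map Ideal.absNorm).prod : ℕ) =
            (M.map fun P => Real.log (Ideal.absNorm P)).sum := fun M => by
        induction M using Multiset.induction with
        | empty => simp
        | cons P M ih =>
          intro h
          have hP := absNorm_pos_of_ne_bot (h P (Multiset.mem_cons_self _ _))
          have hM : (M.map Ideal.absNorm).prod ≠ 0 := by
            refine Multiset.prod_ne_zero fun h0 => ?_
            obtain ⟨Q, hQ, hQ0⟩ := Multiset.mem_map.1 h0
            exact (absNorm_pos_of_ne_bot (h Q (Multiset.mem_cons_of_mem hQ))).ne' hQ0
          rw [Multiset.map_cons, Multiset.map_cons, Multiset.prod_cons, Multiset.sum_cons,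
            Nat.cast_mul, Real.log_mul (by exact_mod_cast hP.ne') (by exact_mod_cast hM),
            ih fun Q hQ => h Q (Multiset.mem_cons_of_mem hQ)]
      exact this M fun P hP => (hp P hP).ne_zero
    rw [h1, Finset.sum_multiset_map_count, Finset.sum_product]
    refine Finset.sum_congr rfl fun P hP => ?_
    have hP' := hp P (Multiset.mem_toFinset.1 hP)
    simp only [hdvd P _ hP', primeLog, if_pos hP', Nat.succ_le_iff]
    rw [← Finset.sum_filter, Finset.sum_const]
    congr 1
    rw [show (Finset.range M.card).filter (fun k => k < M.count P) = Finset.range (M.count P) by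
      ext k
      simp only [Finset.mem_filter, Finset.mem_range]
      exact ⟨And.right, fun h => ⟨h.trans_le (Multiset.count_le_card _ _), h⟩⟩, Finset.card_range]
  rw [e]
  refine hasSum_sum_of_ne_finset_zero fun q hq => ?_
  by_cases hP : Prime q.1
  · rw [if_neg]
    intro h
    have h1 := (hdvd _ _ hP).1 h
    refine hq (Finset.mem_product.2 ⟨Multiset.mem_toFinset.2 (Multiset.count_pos.1 (by omega)),
      Finset.mem_range.2 (lt_of_lt_of_le (by omega) (Multiset.count_le_card q.1 M))⟩)
  · simp [primeLog, hP]

variable {ζK : ℂ → ℂ}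
  (hζ_ser : ∀ s : ℂ, 1 < s.re →
      HasSum (fun I : {I : Ideal (𝓞 K) // I ≠ ⊥} =>
        ((Ideal.absNorm I.1 : ℕ) : ℂ) ^ (-s)) (ζK s))

include hζ_ser in
lemma hasSum_log_mul_cpow {s : ℂ} (hs : 1 < s.re) :
    HasSum (fun I : {I : Ideal (𝓞 K) // I ≠ ⊥} => (Real.log (Ideal.absNorm I.1) : ℂ) *
        ((Ideal.absNorm I.1 : ℕ) : ℂ) ^ (-s)) (-deriv ζK s) := by
  obtain ⟨σ, h1, h2⟩ := exists_between hs
  have hc : ∀ I : {I : Ideal (𝓞 K) // I ≠ ⊥}, ((Ideal.absNorm I.1 : ℕ) : ℂ) ≠ 0 := fun I => by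
    exact_mod_cast (absNorm_pos_of_ne_bot I.2).ne'
  have hU : IsOpen {w : ℂ | σ < w.re} := isOpen_lt continuous_const continuous_re
  have hd : ∀ (I : {I : Ideal (𝓞 K) // I ≠ ⊥}) (w : ℂ),
      HasDerivAt (fun w : ℂ => ((Ideal.absNorm I.1 : ℕ) : ℂ) ^ (-w))
        (((Ideal.absNorm I.1 : ℕ) : ℂ) ^ (-w) * Complex.log (Ideal.absNorm I.1 : ℕ) * -1) w :=
    fun I w => (hasDerivAt_neg w).const_cpow (Or.inl (hc I))
  have h := hasSum_deriv_of_summable_norm (U := {w : ℂ | σ < w.re}) (z := s)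
    (F := fun (I : {I : Ideal (𝓞 K) // I ≠ ⊥}) w => ((Ideal.absNorm I.1 : ℕ) : ℂ) ^ (-w))
    ((hζ_ser σ (by simpa using h1)).summable.norm)
    (fun I w _ => (hd I w).differentiableAt.differentiableWithinAt) hU
    (fun I w hw => by
      have hp := absNorm_pos_of_ne_bot I.2
      rw [norm_natCast_cpow_of_pos hp, norm_natCast_cpow_of_pos hp]
      refine Real.rpow_le_rpow_of_exponent_le (by exact_mod_cast hp) ?_
      simpa using (show σ < w.re from hw).le) h2
  have e : deriv (fun w => ∑' I : {I : Ideal (𝓞 K) // I ≠ ⊥},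
      ((Ideal.absNorm I.1 : ℕ) : ℂ) ^ (-w)) s = deriv ζK s := by
    refine Filter.EventuallyEq.deriv_eq ?_
    filter_upwards [hU.mem_nhds h2] with w hw
    exact (hζ_ser w (h1.trans hw)).tsum_eq
  rw [e] at h
  have e2 : (fun I : {I : Ideal (𝓞 K) // I ≠ ⊥} => (Real.log (Ideal.absNorm I.1) : ℂ) *
      ((Ideal.absNorm I.1 : ℕ) : ℂ) ^ (-s)) = fun I : {I : Ideal (𝓞 K) // I ≠ ⊥} =>
      -deriv (fun w => ((Ideal.absNorm I.1 : ℕ) : ℂ) ^ (-w)) s := by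
    funext I
    rw [(hd I s).deriv, ← natCast_log]
    push_cast; ring
  rw [e2]
  exact h.neg

include hζ_ser in
lemma tsum_primeLog_mul_zeta {s : ℂ} (hs : 1 < s.re) (hs0 : ζK s ≠ 0) :
    HasSum (fun q : Ideal (𝓞 K) × ℕ => (primeLog K q.1 : ℂ) *
      ((Ideal.absNorm (q.1 ^ (q.2 + 1)) : ℕ) : ℂ) ^ (-s)) (-deriv ζK s / ζK s) := by
  set u : {I : Ideal (𝓞 K) // I ≠ ⊥} → Ideal (𝓞 K) × ℕ → ℂ := fun I q =>
    ((if q.1 ^ (q.2 + 1) ∣ I.1 then primeLog K q.1 else 0 : ℝ) : ℂ) *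
      ((Ideal.absNorm I.1 : ℕ) : ℂ) ^ (-s) with hu
  have hl := hasSum_log_mul_cpow hζ_ser hs
  have hsum : Summable (Function.uncurry u) := by
    refine Summable.of_norm ((summable_prod_of_nonneg fun _ => norm_nonneg _).2 ⟨fun I => ?_, ?_⟩)
    · simp only [Function.uncurry_apply_pair, hu, norm_mul, Complex.norm_real]
      exact (hasSum_primeLog I.2).summable.norm.mul_right _
    · refine hl.summable.norm.congr fun I => ?_
      simp only [Function.uncurry_apply_pair, hu, norm_mul, Complex.norm_real]
      rw [tsum_mul_right, Real.norm_of_nonneg (Real.log_natCast_nonneg _)]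
      congr 1
      rw [← (hasSum_primeLog I.2).tsum_eq]
      refine tsum_congr fun q => (Real.norm_of_nonneg ?_).symm
      split_ifs
      exacts [primeLog_nonneg _, le_rfl]
  have h1 : ∀ q, ∑' I, u I q = (primeLog K q.1 : ℂ) *
      ((Ideal.absNorm (q.1 ^ (q.2 + 1)) : ℕ) : ℂ) ^ (-s) * ζK s := fun q => by
    by_cases hP : Prime q.1
    · have hQ : q.1 ^ (q.2 + 1) ≠ ⊥ := pow_ne_zero _ hP.ne_zero
      let m : {I : Ideal (𝓞 K) // I ≠ ⊥} → {I : Ideal (𝓞 K) // I ≠ ⊥} :=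
        fun B => ⟨q.1 ^ (q.2 + 1) * B.1, mul_ne_zero hQ B.2⟩
      have hm : Function.Injective m := fun B C h =>
        Subtype.ext (mul_left_cancel₀ hQ (Subtype.ext_iff.1 h))
      rw [← hm.tsum_eq (f := fun I => u I q), ← (hζ_ser s hs).tsum_eq, ← tsum_mul_left]
      · refine tsum_congr fun B => ?_
        simp only [hu, m, dvd_mul_right, if_true, map_mul, Nat.cast_mul]
        rw [natCast_mul_natCast_cpow, mul_assoc]
      · intro I hI
        have hd : q.1 ^ (q.2 + 1) ∣ I.1 := by
          by_contra h
          simp [hu, h] at hI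
        obtain ⟨B, hB⟩ := hd
        exact ⟨⟨B, fun h => I.2 (by rw [hB, h]; exact mul_zero _)⟩, Subtype.ext hB.symm⟩
    · simp [hu, primeLog, hP]
  have h2 : HasSum (fun q => ∑' I, u I q) (-deriv ζK s) := by
    have hs' : Summable (Function.uncurry fun q I => u I q) :=
      (Equiv.prodComm _ _).summable_iff.2 hsum
    have h3 : Summable fun q => ∑' I, u I q := hs'.prod
    refine h3.hasSum_iff.2 ?_
    rw [hsum.tsum_comm, ← hl.tsum_eq]
    refine tsum_congr fun I => ?_
    rw [tsum_mul_right, ← ofReal_tsum, (hasSum_primeLog I.2).tsum_eq]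
  simp only [h1] at h2
  simpa [mul_div_cancel_right₀ _ hs0] using h2.div_const (ζK s)

end VonMangoldt

section Nonvanishing

open UniqueFactorizationMonoid InfinitePlace
open scoped Classical

lemma exists_tendsto_mul_logDeriv {f : ℂ → ℂ} {z₀ : ℂ} (hf : AnalyticAt ℂ f z₀)
    (h : ¬ ∀ᶠ z in 𝓝 z₀, f z = 0) : ∃ n : ℕ, (f z₀ = 0 → n ≠ 0) ∧ (f z₀ ≠ 0 → n = 0) ∧
      Tendsto (fun z => (z - z₀) * (deriv f z / f z)) (𝓝[≠] z₀) (𝓝 n) := by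
  obtain ⟨n, g, hg, hg0, he⟩ := hf.exists_eventuallyEq_pow_smul_nonzero_iff.2 h
  have hz : f z₀ = (z₀ - z₀) ^ n * g z₀ := he.self_of_nhds
  refine ⟨n, fun h0 hn => ?_, fun h0 => ?_, ?_⟩
  · rw [hn, pow_zero, one_mul] at hz; exact hg0 (hz ▸ h0)
  · by_contra hn
    rw [sub_self, zero_pow hn, zero_mul] at hz; exact h0 hz
  · have h1 : Tendsto (fun z => (n : ℂ) + (z - z₀) * (deriv g z / g z)) (𝓝[≠] z₀)
        (𝓝 ((n : ℂ) + (z₀ - z₀) * (deriv g z₀ / g z₀))) := by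
      refine Tendsto.mono_left (ContinuousAt.tendsto ?_) nhdsWithin_le_nhds
      exact continuousAt_const.add ((continuousAt_id.sub continuousAt_const).mul
        (hg.deriv.continuousAt.div hg.continuousAt hg0))
    rw [sub_self, zero_mul, add_zero] at h1
    refine h1.congr' ?_
    have h2 := (hg.eventually_analyticAt.and ((hg.continuousAt.eventually_ne hg0).and
      (he.eventually_nhds)))
    filter_upwards [nhdsWithin_le_nhds h2, self_mem_nhdsWithin] with z hz hne
    obtain ⟨hga, hgz, hfz⟩ := hz
    have hne' : z - z₀ ≠ 0 := sub_ne_zero.2 hne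
    have hd : deriv f z = n * (z - z₀) ^ (n - 1) * g z + (z - z₀) ^ n * deriv g z := by
      rw [Filter.EventuallyEq.deriv_eq hfz]
      have := (((hasDerivAt_id z).sub_const z₀).pow n).mul hga.differentiableAt.hasDerivAt
      have h3 : deriv (fun x => (x - z₀) ^ n * g x) z = _ := this.deriv
      simpa using h3
    rw [hd, hfz.self_of_nhds, smul_eq_mul]
    rcases n with _ | n
    · simp
    · rw [Nat.add_sub_cancel]
      field_simp
      ring

variable {K : Type*} [Field K] [NumberField K] {ζK : ℂ → ℂ}

lemma analyticAt_zeta (hζ_an : ∀ s : ℂ, s ≠ 1 → DifferentiableAt ℂ ζK s) {s : ℂ} (hs : s ≠ 1) :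
    AnalyticAt ℂ ζK s :=
  DifferentiableOn.analyticAt (s := {1}ᶜ) (fun z hz => (hζ_an z hz).differentiableWithinAt)
    (isOpen_compl_singleton.mem_nhds hs)

lemma not_eventually_zeta_eq_zero (hζ_an : ∀ s : ℂ, s ≠ 1 → DifferentiableAt ℂ ζK s)
    (hζ_pole : ∃ A : ℂ, A ≠ 0 ∧
      Tendsto (fun s : ℂ => (s - 1) * ζK s) (𝓝[≠] (1 : ℂ)) (𝓝 A)) {s : ℂ} (hs : s ≠ 1) :
    ¬ ∀ᶠ z in 𝓝 s, ζK z = 0 := fun h => by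
  obtain ⟨A, hA, hl⟩ := hζ_pole
  have hc : IsPreconnected ({1}ᶜ : Set ℂ) :=
    (isConnected_compl_singleton_of_one_lt_rank (by rw [Complex.rank_real_complex]; norm_num)
      1).isPreconnected
  have h1 : Set.EqOn ζK 0 {1}ᶜ := AnalyticOnNhd.eqOn_zero_of_preconnected_of_eventuallyEq_zero
    (fun z hz => analyticAt_zeta hζ_an hz) hc hs h
  refine hA (tendsto_nhds_unique hl ?_)
  refine tendsto_const_nhds.congr' ?_
  filter_upwards [self_mem_nhdsWithin] with z hz
  rw [h1 hz, Pi.zero_apply, mul_zero]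

lemma zeta_ne_zero_of_one_lt_re (hζ_an : ∀ s : ℂ, s ≠ 1 → DifferentiableAt ℂ ζK s)
    (hζ_pole : ∃ A : ℂ, A ≠ 0 ∧
      Tendsto (fun s : ℂ => (s - 1) * ζK s) (𝓝[≠] (1 : ℂ)) (𝓝 A)) {b : ℕ → ℝ}
    (hb : ∀ s : ℂ, 1 < s.re →
      HasSum (fun m : ℕ => (b m : ℂ) * (m : ℂ) ^ (-s)) (ζK s)⁻¹) {s : ℂ} (hs : 1 < s.re) :
    ζK s ≠ 0 := fun h0 => by
  have hs1 : s ≠ 1 := fun h => by simp [h] at hs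
  have hterm : ∀ z : ℂ, 1 < z.re → LSeries.term (fun m => (b m : ℂ)) z =
      fun m : ℕ => (b m : ℂ) * (m : ℂ) ^ (-z) := fun z hz => by
    funext m
    rcases eq_or_ne m 0 with rfl | hm
    · have : -z ≠ 0 := neg_ne_zero.2 fun h => by simp [h] at hz; linarith
      simp [Complex.zero_cpow this]
    · rw [LSeries.term_of_ne_zero hm, cpow_neg, div_eq_mul_inv]
  have hG : ∀ z : ℂ, 1 < z.re → LSeries (fun m => (b m : ℂ)) z = (ζK z)⁻¹ := fun z hz => by
    rw [LSeries, hterm z hz, (hb z hz).tsum_eq]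
  have habs : LSeries.abscissaOfAbsConv (fun m => (b m : ℂ)) < s.re := by
    obtain ⟨σ, h1, h2⟩ := exists_between hs
    have : LSeriesSummable (fun m => (b m : ℂ)) σ := by
      rw [LSeriesSummable, hterm σ (by simpa using h1)]
      exact (hb σ (by simpa using h1)).summable
    exact this.abscissaOfAbsConv_le.trans_lt (by simpa using h2)
  have hGc : ContinuousAt (LSeries fun m => (b m : ℂ)) s :=
    (LSeries_hasDerivAt habs).continuousAt
  have hne : ∀ᶠ z in 𝓝[≠] s, ζK z ≠ 0 :=
    (analyticAt_zeta hζ_an hs1).eventually_eq_zero_or_eventually_ne_zero.resolve_left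
      (not_eventually_zeta_eq_zero hζ_an hζ_pole hs1)
  have hl : Tendsto (fun z => LSeries (fun m => (b m : ℂ)) z * ζK z) (𝓝[≠] s) (𝓝 1) := by
    refine tendsto_const_nhds.congr' ?_
    filter_upwards [hne, nhdsWithin_le_nhds
      ((isOpen_lt continuous_const continuous_re).mem_nhds hs)] with z hz hz'
    rw [hG z hz', inv_mul_cancel₀ hz]
  have hl2 : Tendsto (fun z => LSeries (fun m => (b m : ℂ)) z * ζK z) (𝓝[≠] s)
      (𝓝 (LSeries (fun m => (b m : ℂ)) s * ζK s)) :=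
    (hGc.mul (hζ_an s hs1).continuousAt).tendsto.mono_left nhdsWithin_le_nhds
  rw [h0, mul_zero] at hl2
  exact one_ne_zero (tendsto_nhds_unique hl hl2)

lemma tendsto_sub_mul_logDeriv_zeta_one (hζ_an : ∀ s : ℂ, s ≠ 1 → DifferentiableAt ℂ ζK s)
    (hζ_pole : ∃ A : ℂ, A ≠ 0 ∧
      Tendsto (fun s : ℂ => (s - 1) * ζK s) (𝓝[≠] (1 : ℂ)) (𝓝 A)) :
    Tendsto (fun z => (z - 1) * (deriv ζK z / ζK z)) (𝓝[≠] 1) (𝓝 (-1)) := by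
  obtain ⟨A, hA, hl⟩ := hζ_pole
  set G : ℂ → ℂ := Function.update (fun s => (s - 1) * ζK s) 1 A with hGdef
  have hG1 : G 1 = A := Function.update_self _ _ _
  have hGe : ∀ z, z ≠ 1 → G =ᶠ[𝓝 z] fun s => (s - 1) * ζK s := fun z hz => by
    filter_upwards [isOpen_compl_singleton.mem_nhds hz] with s hs
    exact Function.update_of_ne hs _ _
  have hGa : AnalyticAt ℂ G 1 := by
    refine analyticAt_of_differentiable_on_punctured_nhds_of_continuousAt ?_
      (continuousAt_update_same.2 hl)
    filter_upwards [self_mem_nhdsWithin] with z hz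
    exact ((hGe z hz).differentiableAt_iff).2
      ((differentiableAt_id.sub_const _).mul (hζ_an z hz))
  have hGn : ∀ᶠ z in 𝓝 1, G z ≠ 0 := hGa.continuousAt.eventually_ne (by rwa [hG1])
  obtain ⟨n, -, hn, ht⟩ := exists_tendsto_mul_logDeriv hGa fun h => by
    obtain ⟨z, h1, h2⟩ := (h.and hGn).exists
    exact h2 h1
  rw [hn (by rwa [hG1]), Nat.cast_zero] at ht
  have ht' := ht.sub_const 1
  rw [zero_sub] at ht'
  refine ht'.congr' ?_
  filter_upwards [self_mem_nhdsWithin, nhdsWithin_le_nhds hGn] with z hz hz'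
  have hz1 : z - 1 ≠ 0 := sub_ne_zero.2 hz
  rw [(hGe z hz).self_of_nhds] at hz'
  have hζ := right_ne_zero_of_mul hz'
  rw [(hGe z hz).deriv_eq, (hGe z hz).self_of_nhds]
  have hd : deriv (fun s => (s - 1) * ζK s) z = _ :=
    (((hasDerivAt_id z).sub_const 1).mul (hζ_an z hz).hasDerivAt).deriv
  have hd' : deriv (fun s => (s - 1) * ζK s) z = ζK z + (z - 1) * deriv ζK z := by
    simpa using hd
  rw [hd']
  field_simp
  ring

lemma tendsto_ofReal_add_nhdsNE (z : ℂ) :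
    Tendsto (fun x : ℝ => z + x) (𝓝[>] 0) (𝓝[≠] z) := by
  refine tendsto_nhdsWithin_iff.2 ⟨?_, ?_⟩
  · have : Continuous fun x : ℝ => z + x := by fun_prop
    exact (this.tendsto' 0 z (by simp)).mono_left nhdsWithin_le_nhds
  · filter_upwards [self_mem_nhdsWithin] with x hx
    have : (0 : ℝ) < x := hx
    simpa using this.ne'

lemma zeta_ne_zero_of_re_eq_one (hζ_an : ∀ s : ℂ, s ≠ 1 → DifferentiableAt ℂ ζK s)
    (hζ_ser : ∀ s : ℂ, 1 < s.re →
      HasSum (fun I : {I : Ideal (𝓞 K) // I ≠ ⊥} =>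
        ((Ideal.absNorm I.1 : ℕ) : ℂ) ^ (-s)) (ζK s))
    (hζ_pole : ∃ A : ℂ, A ≠ 0 ∧
      Tendsto (fun s : ℂ => (s - 1) * ζK s) (𝓝[≠] (1 : ℂ)) (𝓝 A))
    (hne : ∀ s : ℂ, 1 < s.re → ζK s ≠ 0) {t : ℝ} (ht : t ≠ 0) :
    ζK (1 + t * I) ≠ 0 := fun h0 => by
  have hs1 : ∀ t : ℝ, t ≠ 0 → (1 + t * I : ℂ) ≠ 1 := fun t ht h => by
    simp [ht] at h
  have hl : ∀ t : ℝ, t ≠ 0 → ∃ n : ℕ, (ζK (1 + t * I) = 0 → n ≠ 0) ∧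
      Tendsto (fun x : ℝ => x * (deriv ζK (1 + t * I + x) / ζK (1 + t * I + x)).re)
        (𝓝[>] 0) (𝓝 n) := fun t ht => by
    obtain ⟨n, h1, -, h2⟩ := exists_tendsto_mul_logDeriv (analyticAt_zeta hζ_an (hs1 t ht))
      (not_eventually_zeta_eq_zero hζ_an hζ_pole (hs1 t ht))
    refine ⟨n, h1, ?_⟩
    have h3 := (Complex.continuous_re.tendsto _).comp (h2.comp (tendsto_ofReal_add_nhdsNE _))
    simp only [natCast_re] at h3
    refine h3.congr fun x => ?_
    simp only [Function.comp_apply, add_sub_cancel_left, re_ofReal_mul]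
  obtain ⟨m, hm, hml⟩ := hl t ht
  obtain ⟨k, -, hkl⟩ := hl (2 * t) (by simpa using ht)
  have h1 : Tendsto (fun x : ℝ => x * (deriv ζK (1 + x) / ζK (1 + x)).re) (𝓝[>] 0) (𝓝 (-1)) := by
    have h3 := (Complex.continuous_re.tendsto _).comp
      ((tendsto_sub_mul_logDeriv_zeta_one hζ_an hζ_pole).comp (tendsto_ofReal_add_nhdsNE _))
    simp only [neg_re, one_re] at h3
    refine h3.congr fun x => ?_
    simp only [Function.comp_apply, add_sub_cancel_left, re_ofReal_mul]
  have hlim := ((h1.const_mul 3).add (hml.const_mul 4)).add hkl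
  have hle : ∀ᶠ x : ℝ in 𝓝[>] 0, 3 * (x * (deriv ζK (1 + x) / ζK (1 + x)).re) +
      4 * (x * (deriv ζK (1 + t * I + x) / ζK (1 + t * I + x)).re) +
      x * (deriv ζK (1 + (2 * t : ℝ) * I + x) / ζK (1 + (2 * t : ℝ) * I + x)).re ≤ 0 := by
    filter_upwards [self_mem_nhdsWithin] with x hx
    have hx : 0 < x := hx
    have hre : ∀ u : ℝ, 1 < (1 + u * I + x : ℂ).re := fun u => by simpa using hx
    have hV : ∀ u : ℝ, HasSum (fun q : Ideal (𝓞 K) × ℕ => primeLog K q.1 *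
        ((((Ideal.absNorm (q.1 ^ (q.2 + 1)) : ℕ) : ℂ) ^ (-(1 + u * I + x : ℂ))).re))
        (-(deriv ζK (1 + u * I + x) / ζK (1 + u * I + x)).re) := fun u => by
      have := hasSum_re (tsum_primeLog_mul_zeta hζ_ser (hre u) (hne _ (hre u)))
      simpa only [re_ofReal_mul, neg_div, neg_re] using this
    have h3 := hV 0
    rw [ofReal_zero, zero_mul, add_zero] at h3
    have hsum := ((h3.mul_left 3).add ((hV t).mul_left 4)).add (hV (2 * t))
    have hnn := hsum.nonneg fun q => ?_
    · nlinarith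
    · by_cases hP : Prime q.1
      · have hQ : 0 < Ideal.absNorm (q.1 ^ (q.2 + 1)) :=
          absNorm_pos_of_ne_bot (pow_ne_zero _ hP.ne_zero)
        set N := Ideal.absNorm (q.1 ^ (q.2 + 1))
        have hN : (0 : ℝ) < N := by exact_mod_cast hQ
        have hcos : ∀ u : ℝ, ((N : ℂ) ^ (-(1 + u * I + x : ℂ))).re =
            (N : ℝ) ^ (-(1 + x)) * Real.cos (u * Real.log N) := fun u => by
          have e : (-(1 + u * I + x : ℂ)) = ((-(1 + x) : ℝ) : ℂ) + ((-u : ℝ) : ℂ) * I := by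
            push_cast; ring
          rw [e, cpow_add _ _ (by exact_mod_cast hQ.ne'), ← ofReal_natCast, ← ofReal_cpow hN.le,
            re_ofReal_mul, cpow_def_of_ne_zero (ofReal_ne_zero.2 hN.ne'), ← ofReal_log hN.le,
            show ((Real.log N : ℝ) : ℂ) * (((-u : ℝ) : ℂ) * I) =
              ((-(u * Real.log N) : ℝ) : ℂ) * I by push_cast; ring, exp_ofReal_mul_I_re,
            Real.cos_neg]
        have h3' := hcos 0
        rw [ofReal_zero, zero_mul, add_zero, zero_mul, Real.cos_zero, mul_one] at h3'
        rw [hcos, h3', hcos, mul_assoc 2 t, Real.cos_two_mul]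
        have hp := primeLog_nonneg q.1
        have hr : 0 ≤ (N : ℝ) ^ (-(1 + x)) := by positivity
        have : 0 ≤ primeLog K q.1 * (N : ℝ) ^ (-(1 + x)) *
          (2 * (1 + Real.cos (t * Real.log N)) ^ 2) := by positivity
        nlinarith
      · simp [primeLog, hP]
  have hfin := le_of_tendsto hlim hle
  have : (1 : ℝ) ≤ m := by exact_mod_cast Nat.one_le_iff_ne_zero.2 (hm h0)
  have : (0 : ℝ) ≤ k := Nat.cast_nonneg k
  linarith

lemma zeta_ne_zero_of_one_le_re (hζ_an : ∀ s : ℂ, s ≠ 1 → DifferentiableAt ℂ ζK s)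
    (hζ_ser : ∀ s : ℂ, 1 < s.re →
      HasSum (fun I : {I : Ideal (𝓞 K) // I ≠ ⊥} =>
        ((Ideal.absNorm I.1 : ℕ) : ℂ) ^ (-s)) (ζK s))
    (hζ_pole : ∃ A : ℂ, A ≠ 0 ∧
      Tendsto (fun s : ℂ => (s - 1) * ζK s) (𝓝[≠] (1 : ℂ)) (𝓝 A)) {b : ℕ → ℝ}
    (hb : ∀ s : ℂ, 1 < s.re →
      HasSum (fun m : ℕ => (b m : ℂ) * (m : ℂ) ^ (-s)) (ζK s)⁻¹) {s : ℂ} (hs : 1 ≤ s.re)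
    (hs1 : s ≠ 1) : ζK s ≠ 0 := by
  have hne := fun s hs => zeta_ne_zero_of_one_lt_re hζ_an hζ_pole hb (s := s) hs
  rcases hs.lt_or_eq with h | h
  · exact hne s h
  · have e : s = 1 + s.im * I := by
      apply Complex.ext <;> simp [← h]
    rw [e]
    refine zeta_ne_zero_of_re_eq_one hζ_an hζ_ser hζ_pole hne fun h0 => hs1 ?_
    rw [e, h0]; simp

lemma zeta_ne_zero_of_re_nonpos (hζ_an : ∀ s : ℂ, s ≠ 1 → DifferentiableAt ℂ ζK s)
    (hζ_ser : ∀ s : ℂ, 1 < s.re →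
      HasSum (fun I : {I : Ideal (𝓞 K) // I ≠ ⊥} =>
        ((Ideal.absNorm I.1 : ℕ) : ℂ) ^ (-s)) (ζK s))
    (hζ_pole : ∃ A : ℂ, A ≠ 0 ∧
      Tendsto (fun s : ℂ => (s - 1) * ζK s) (𝓝[≠] (1 : ℂ)) (𝓝 A)) {b : ℕ → ℝ}
    (hb : ∀ s : ℂ, 1 < s.re →
      HasSum (fun m : ℕ => (b m : ℂ) * (m : ℂ) ^ (-s)) (ζK s)⁻¹) {s : ℂ} (hs : s.re ≤ 0)
    (hs1 : ∀ m : ℤ, s ≠ m) : ζK s ≠ 0 := fun h0 => by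
  have hd := abs_discr_pos K
  have hη : 0 < 4 ^ nrComplexPlaces K * Real.pi ^ Module.finrank ℚ K / |(discr K : ℝ)| := by
    have := Real.pi_pos
    positivity
  have hFE := zeta_functional_equation K hζ_an hζ_ser rfl hs1
  have h1 : ζK (1 - s) ≠ 0 := zeta_ne_zero_of_one_le_re hζ_an hζ_ser hζ_pole hb
    (by simpa using hs) (by simpa using hs1 0)
  rw [h0, zero_mul] at hFE
  refine mul_ne_zero (mul_ne_zero h1 ?_) ?_ hFE
  · refine mul_ne_zero (pow_ne_zero _ (Gamma_ne_zero fun m h => hs1 (2 * m + 1) ?_))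
      (pow_ne_zero _ (Gamma_ne_zero fun m h => hs1 (m + 1) ?_))
    · push_cast; linear_combination -2 * h
    · push_cast; linear_combination -h
  · exact (cpow_ne_zero_iff_of_exponent_ne_zero fun h => hs1 0 (by
      exfalso
      have : s = 1 / 2 := by linear_combination h
      rw [this] at hs
      norm_num at hs)).2 (ofReal_ne_zero.2 hη.ne')

end Nonvanishing

section Kernel

open scoped ENNReal

/-- A Cauchy kernel with an auxiliary far-away pole, so that it is integrable on vertical lines. -/
noncomputable def cauchyKernel (w : ℂ) : ℂ := 1 / w - 1 / (w + 5)

lemma integrable_and_integral_div_sq_add_sq {a : ℝ} (ha : a ≠ 0) :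
    Integrable (fun t : ℝ => a / (a ^ 2 + t ^ 2)) ∧
    ∫ t : ℝ, a / (a ^ 2 + t ^ 2) = |a| / a * Real.pi := by
  have he : (fun t : ℝ => a / (a ^ 2 + t ^ 2)) = fun t => a⁻¹ * (1 + (t / a) ^ 2)⁻¹ := by
    funext t
    have h1 : a ^ 2 + t ^ 2 ≠ 0 := by positivity
    have h2 : 1 + (t / a) ^ 2 ≠ 0 := by positivity
    field_simp
  rw [he]
  refine ⟨(integrable_inv_one_add_sq.comp_div ha).const_mul _, ?_⟩
  rw [integral_const_mul, Measure.integral_comp_div (fun x : ℝ => (1 + x ^ 2)⁻¹),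
    integral_univ_inv_one_add_sq, smul_eq_mul]
  ring

lemma add_ofReal_mul_I_ne_zero {a : ℝ} (ha : a ≠ 0) (t : ℝ) : (a : ℂ) + t * I ≠ 0 := by
  intro h
  apply ha
  simpa using congrArg re h

lemma norm_add_ofReal_mul_I_sq (a t : ℝ) : ‖(a : ℂ) + t * I‖ ^ 2 = a ^ 2 + t ^ 2 := by
  rw [← normSq_eq_norm_sq, normSq_add_mul_I]

lemma cauchyKernel_eq {w : ℂ} (h0 : w ≠ 0) (h5 : w + 5 ≠ 0) :
    cauchyKernel w = 5 / (w * (w + 5)) := by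
  rw [cauchyKernel]; field_simp; ring

lemma norm_cauchyKernel_line_le {a : ℝ} (ha : 1 / 4 ≤ |a|) (ha' : |a| ≤ 2) (t : ℝ) :
    ‖cauchyKernel (a + t * I)‖ ≤ 20 * (1 + t ^ 2)⁻¹ := by
  have ha0 : a ≠ 0 := fun h => by rw [h, abs_zero] at ha; norm_num at ha
  have h2 := abs_le.1 ha'
  have ha5 : a + 5 ≠ 0 := by linarith [h2.1]
  have e5 : (a : ℂ) + t * I + 5 = ((a + 5 : ℝ) : ℂ) + t * I := by push_cast; ring
  rw [cauchyKernel_eq (add_ofReal_mul_I_ne_zero ha0 t)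
    (by rw [e5]; exact add_ofReal_mul_I_ne_zero ha5 t), e5, norm_div, norm_mul]
  have n1 : (1 / 4) ^ 2 * (1 + t ^ 2) ≤ ‖(a : ℂ) + t * I‖ ^ 2 := by
    rw [norm_add_ofReal_mul_I_sq, ← sq_abs a]
    have : (1 / 4 : ℝ) ^ 2 ≤ |a| ^ 2 := by gcongr
    nlinarith [sq_nonneg t]
  have n2 : 1 + t ^ 2 ≤ ‖((a + 5 : ℝ) : ℂ) + t * I‖ ^ 2 := by
    rw [norm_add_ofReal_mul_I_sq]
    nlinarith [h2.1]
  have h1t : 0 < 1 + t ^ 2 := by positivity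
  have n3 : (1 / 4) * (1 + t ^ 2) ≤ ‖(a : ℂ) + t * I‖ * ‖((a + 5 : ℝ) : ℂ) + t * I‖ := by
    refine le_of_sq_le_sq ?_ (by positivity)
    rw [mul_pow, mul_pow]
    calc (1 / 4 : ℝ) ^ 2 * (1 + t ^ 2) ^ 2 = ((1 / 4) ^ 2 * (1 + t ^ 2)) * (1 + t ^ 2) := by ring
      _ ≤ _ := mul_le_mul n1 n2 h1t.le (by positivity)
  calc ‖(5 : ℂ)‖ / (‖(a : ℂ) + t * I‖ * ‖((a + 5 : ℝ) : ℂ) + t * I‖)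
      ≤ 5 / ((1 / 4) * (1 + t ^ 2)) := by
        rw [show ‖(5 : ℂ)‖ = 5 by simp]
        exact div_le_div_of_nonneg_left (by norm_num) (by positivity) n3
    _ = _ := by field_simp; norm_num

lemma continuous_cauchyKernel_line {a : ℝ} (ha0 : a ≠ 0) (ha5 : a + 5 ≠ 0) :
    Continuous fun t : ℝ => cauchyKernel (a + t * I) := by
  unfold cauchyKernel
  refine (Continuous.div (by fun_prop) (by fun_prop) (add_ofReal_mul_I_ne_zero ha0)).sub
    (Continuous.div (by fun_prop) (by fun_prop) fun t => ?_)
  have := add_ofReal_mul_I_ne_zero ha5 t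
  push_cast at this
  rwa [add_right_comm] at this

lemma integrable_cauchyKernel_line {a : ℝ} (ha : 1 / 4 ≤ |a|) (ha' : |a| ≤ 2) :
    Integrable fun t : ℝ => cauchyKernel (a + t * I) := by
  have ha0 : a ≠ 0 := fun h => by rw [h, abs_zero] at ha; norm_num at ha
  have ha5 : a + 5 ≠ 0 := by linarith [(abs_le.1 ha').1]
  exact (integrable_inv_one_add_sq.const_mul 20).mono'
    (continuous_cauchyKernel_line ha0 ha5).aestronglyMeasurable
    (Eventually.of_forall (norm_cauchyKernel_line_le ha ha'))

lemma integral_cauchyKernel_line {a : ℝ} (ha : 1 / 4 ≤ |a|) (ha' : |a| ≤ 2) :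
    ∫ t : ℝ, cauchyKernel (a + t * I) = ((|a| / a - 1) * Real.pi : ℝ) := by
  have ha0 : a ≠ 0 := fun h => by rw [h, abs_zero] at ha; norm_num at ha
  have ha5 : 0 < a + 5 := by linarith [(abs_le.1 ha').1]
  have hi := integrable_cauchyKernel_line ha ha'
  have hneg : ∫ t : ℝ, cauchyKernel (a + (-t : ℝ) * I) = ∫ t : ℝ, cauchyKernel (a + t * I) :=
    integral_neg_eq_self (fun t : ℝ => cauchyKernel (a + t * I)) volume
  have hi' : Integrable fun t : ℝ => cauchyKernel (a + (-t : ℝ) * I) := hi.comp_neg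
  have hsum : ∀ t : ℝ, cauchyKernel (a + t * I) + cauchyKernel (a + (-t : ℝ) * I)
      = ((2 * (a / (a ^ 2 + t ^ 2) - (a + 5) / ((a + 5) ^ 2 + t ^ 2)) : ℝ) : ℂ) := by
    intro t
    have k : ∀ c : ℝ, c ≠ 0 → 1 / ((c : ℂ) + t * I) + 1 / ((c : ℂ) + (-t : ℝ) * I)
        = 2 * (c / (c ^ 2 + t ^ 2)) := by
      intro c hc
      have h1 := add_ofReal_mul_I_ne_zero hc t
      have h2 := add_ofReal_mul_I_ne_zero hc (-t)
      have h3 : ((c : ℂ) + t * I) * (c + (-t : ℝ) * I) = c ^ 2 + t ^ 2 := by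
        push_cast; linear_combination (-(t : ℂ) ^ 2) * I_sq
      have h4 : ((c : ℂ) ^ 2 + t ^ 2) ≠ 0 := h3 ▸ mul_ne_zero h1 h2
      rw [div_add_div _ _ h1 h2, h3]
      push_cast
      field_simp
      ring
    have e1 := k a ha0
    have e2 := k (a + 5) ha5.ne'
    push_cast at e1 e2 ⊢
    unfold cauchyKernel
    rw [add_right_comm (a : ℂ) _ 5, add_right_comm (a : ℂ) _ 5]
    linear_combination e1 - e2
  have key : 2 * ∫ t : ℝ, cauchyKernel (a + t * I)
      = ((2 * (|a| / a * Real.pi - |a + 5| / (a + 5) * Real.pi) : ℝ) : ℂ) := by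
    rw [two_mul]
    nth_rewrite 2 [← hneg]
    rw [← integral_add hi hi', integral_congr_ae (Eventually.of_forall hsum),
      integral_complex_ofReal, integral_const_mul,
      integral_sub (integrable_and_integral_div_sq_add_sq ha0).1 (integrable_and_integral_div_sq_add_sq ha5.ne').1,
      (integrable_and_integral_div_sq_add_sq ha0).2, (integrable_and_integral_div_sq_add_sq ha5.ne').2]
  rw [abs_of_pos ha5, div_self ha5.ne', one_mul] at key
  push_cast at key ⊢
  linear_combination key / 2

lemma integrable_inv_pow_line {a : ℝ} (ha : a ≠ 0) {j : ℕ} (hj : 2 ≤ j) :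
    Integrable (fun t : ℝ => (((a : ℂ) + t * I) ^ j)⁻¹) := by
  have hb := (integrable_and_integral_div_sq_add_sq ha).1.const_mul (|a| ^ (j - 2))⁻¹ |>.const_mul a⁻¹
  refine hb.mono' (Continuous.aestronglyMeasurable ?_) (Eventually.of_forall fun t => ?_)
  · exact Continuous.inv₀ (by fun_prop) fun t => pow_ne_zero _ (add_ofReal_mul_I_ne_zero ha t)
  · obtain ⟨k, rfl⟩ := Nat.exists_eq_add_of_le hj
    rw [norm_inv, norm_pow, pow_add, mul_inv, norm_add_ofReal_mul_I_sq, Nat.add_sub_cancel_left]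
    have h1 : |a| ≤ ‖(a : ℂ) + t * I‖ := by
      simpa using abs_re_le_norm ((a : ℂ) + t * I)
    have h2 : (‖(a : ℂ) + t * I‖ ^ k)⁻¹ ≤ (|a| ^ k)⁻¹ :=
      inv_anti₀ (pow_pos (abs_pos.2 ha) _) (pow_le_pow_left₀ (abs_nonneg a) h1 k)
    have h3 : 0 < a ^ 2 + t ^ 2 := by positivity
    calc _ ≤ (a ^ 2 + t ^ 2)⁻¹ * (|a| ^ k)⁻¹ := by gcongr
      _ = _ := by field_simp

lemma integral_inv_pow_line {a : ℝ} (ha : a ≠ 0) {j : ℕ} (hj : 2 ≤ j) :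
    ∫ t : ℝ, (((a : ℂ) + t * I) ^ j)⁻¹ = 0 := by
  obtain ⟨k, rfl⟩ := Nat.exists_eq_add_of_le hj
  have hn := add_ofReal_mul_I_ne_zero ha
  have hd : ∀ t : ℝ, HasDerivAt
      (fun t : ℝ => -(((k : ℂ) + 1) * I)⁻¹ * (((a : ℂ) + t * I) ^ (k + 1))⁻¹)
      ((((a : ℂ) + t * I) ^ (2 + k))⁻¹) t := by
    intro t
    have h1 : HasDerivAt (fun t : ℝ => (a : ℂ) + t * I) I t := by
      simpa using ((hasDerivAt_id t).ofReal_comp.mul_const I).const_add (a : ℂ)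
    have h2 := ((h1.pow (k + 1)).inv (pow_ne_zero _ (hn t))).const_mul (-(((k : ℂ) + 1) * I)⁻¹)
    refine h2.congr_deriv ?_
    have hk : (k : ℂ) + 1 ≠ 0 := by exact_mod_cast k.succ_ne_zero
    have := hn t
    rw [Pi.pow_apply]
    simp only [Nat.add_sub_cancel]
    generalize (a : ℂ) + t * I = w at this ⊢
    push_cast
    field_simp
    ring
  have hlim : ∀ l : Filter ℝ, Tendsto (fun t : ℝ => |t|) l atTop →
      Tendsto (fun t : ℝ => -(((k : ℂ) + 1) * I)⁻¹ * (((a : ℂ) + t * I) ^ (k + 1))⁻¹) l (𝓝 0) := by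
    intro l hl
    have h0 : Tendsto (fun t : ℝ => ‖(a : ℂ) + t * I‖) l atTop := by
      refine tendsto_atTop_mono (fun t => ?_) hl
      simpa using abs_im_le_norm ((a : ℂ) + t * I)
    have h1 : Tendsto (fun t : ℝ => (((a : ℂ) + t * I) ^ (k + 1))⁻¹) l (𝓝 0) := by
      rw [tendsto_zero_iff_norm_tendsto_zero]
      simp_rw [norm_inv, norm_pow]
      exact tendsto_inv_atTop_zero.comp ((tendsto_pow_atTop k.succ_ne_zero).comp h0)
    simpa using h1.const_mul (-(((k : ℂ) + 1) * I)⁻¹)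
  simpa using integral_of_hasDerivAt_of_tendsto hd (integrable_inv_pow_line ha hj)
    (hlim _ tendsto_abs_atBot_atTop) (hlim _ tendsto_abs_atTop_atTop)

lemma lintegral_ball_inv_norm_lt_top :
    ∫⁻ w in Metric.ball (0 : ℂ) 1, ENNReal.ofReal ‖w‖⁻¹ < ⊤ := by
  rw [← lintegral_indicator Metric.isOpen_ball.measurableSet,
    ← Complex.lintegral_comp_polarCoord_symm]
  have hs : MeasurableSet (Set.Ioo (0 : ℝ) 1 ×ˢ Set.Ioo (-Real.pi) Real.pi) :=
    measurableSet_Ioo.prod measurableSet_Ioo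
  calc _ ≤ ∫⁻ p : ℝ × ℝ, (Set.Ioo (0 : ℝ) 1 ×ˢ Set.Ioo (-Real.pi) Real.pi).indicator
        (fun _ => (1 : ℝ≥0∞)) p := by
        rw [← lintegral_indicator (by exact measurableSet_Ioi.prod measurableSet_Ioo)]
        refine lintegral_mono fun p => ?_
        by_cases hp : p ∈ polarCoord.target
        · have hp' := hp
          rw [polarCoord_target] at hp'
          have h0 : 0 < p.1 := hp'.1
          rw [Set.indicator_of_mem hp]
          by_cases h1 : p.1 < 1
          · have hm1 : Complex.polarCoord.symm p ∈ Metric.ball (0 : ℂ) 1 := by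
              rw [mem_ball_zero_iff, Complex.norm_polarCoord_symm, abs_of_pos h0]; exact h1
            have hm2 : p ∈ Set.Ioo (0 : ℝ) 1 ×ˢ Set.Ioo (-Real.pi) Real.pi := ⟨⟨h0, h1⟩, hp'.2⟩
            rw [Set.indicator_of_mem hm1, Set.indicator_of_mem hm2,
              Complex.norm_polarCoord_symm, abs_of_pos h0, smul_eq_mul,
              ← ENNReal.ofReal_mul h0.le, mul_inv_cancel₀ h0.ne', ENNReal.ofReal_one]
          · rw [Set.indicator_of_notMem (s := Metric.ball (0 : ℂ) 1)
              (by rw [mem_ball_zero_iff, Complex.norm_polarCoord_symm, abs_of_pos h0]; exact h1)]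
            simp
        · rw [Set.indicator_of_notMem hp]; exact zero_le
    _ = volume (Set.Ioo (0 : ℝ) 1 ×ˢ Set.Ioo (-Real.pi) Real.pi) := by
        rw [lintegral_indicator hs, setLIntegral_one]
    _ < ⊤ := by
        rw [Measure.volume_eq_prod, Measure.prod_prod, Real.volume_Ioo, Real.volume_Ioo]
        exact ENNReal.mul_lt_top ENNReal.ofReal_lt_top ENNReal.ofReal_lt_top

lemma norm_cauchyKernel_le {w : ℂ} (hw : -4 ≤ w.re) : ‖cauchyKernel w‖ ≤ ‖w‖⁻¹ + 1 := by
  rw [cauchyKernel]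
  refine (norm_sub_le _ _).trans ?_
  rw [norm_div, norm_one, one_div, norm_div, norm_one, one_div]
  gcongr
  refine inv_le_one_of_one_le₀ ?_
  have := re_le_norm (w + 5)
  simp only [add_re, re_ofNat] at this
  linarith

/-- Area integrals of the kernel over small balls are uniformly bounded. -/
lemma exists_lintegral_cauchyKernel_le : ∃ C : ℝ≥0∞, C ≠ ⊤ ∧ ∀ (z ρ : ℂ) (R : ℝ), R ≤ 1 →
    (∀ s ∈ Metric.ball z R, -4 ≤ (s - ρ).re) →
    ∫⁻ s in Metric.ball z R, ENNReal.ofReal ‖cauchyKernel (s - ρ)‖ ≤ C := by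
  refine ⟨(∫⁻ w in Metric.ball (0 : ℂ) 1, ENNReal.ofReal ‖w‖⁻¹) +
    2 * volume (Metric.ball (0 : ℂ) 1), ?_, fun z ρ R hR h => ?_⟩
  · exact ENNReal.add_ne_top.2 ⟨lintegral_ball_inv_norm_lt_top.ne,
      ENNReal.mul_ne_top (by simp) measure_ball_lt_top.ne⟩
  · have hb : ∀ s ∈ Metric.ball z R, ENNReal.ofReal ‖cauchyKernel (s - ρ)‖ ≤
        (Metric.ball ρ 1).indicator (fun s => ENNReal.ofReal ‖s - ρ‖⁻¹) s + 2 := by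
      intro s hs
      have h1 := norm_cauchyKernel_le (h s hs)
      by_cases h2 : s ∈ Metric.ball ρ 1
      · rw [Set.indicator_of_mem h2]
        calc _ ≤ ENNReal.ofReal (‖s - ρ‖⁻¹ + 1) := ENNReal.ofReal_le_ofReal h1
          _ = ENNReal.ofReal ‖s - ρ‖⁻¹ + 1 := by
            rw [ENNReal.ofReal_add (by positivity) zero_le_one, ENNReal.ofReal_one]
          _ ≤ _ := by gcongr; norm_num
      · rw [Set.indicator_of_notMem h2, zero_add]
        rw [Metric.mem_ball, dist_eq_norm, not_lt] at h2
        have h3 : ‖s - ρ‖⁻¹ ≤ 1 := inv_le_one_of_one_le₀ h2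
        calc _ ≤ ENNReal.ofReal 2 := ENNReal.ofReal_le_ofReal (by linarith)
          _ = 2 := by simp
    calc _ ≤ ∫⁻ s in Metric.ball z R,
          ((Metric.ball ρ 1).indicator (fun s => ENNReal.ofReal ‖s - ρ‖⁻¹) s + 2) :=
          setLIntegral_mono' Metric.isOpen_ball.measurableSet hb
      _ = (∫⁻ s in Metric.ball z R,
          (Metric.ball ρ 1).indicator (fun s => ENNReal.ofReal ‖s - ρ‖⁻¹) s) +
          2 * volume (Metric.ball z R) := by
          rw [lintegral_add_right _ measurable_const, setLIntegral_const]
      _ ≤ _ := by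
          gcongr ?_ + 2 * ?_
          · refine (setLIntegral_le_lintegral _ _).trans_eq ?_
            rw [← lintegral_indicator Metric.isOpen_ball.measurableSet,
              ← lintegral_add_right_eq_self (fun s => (Metric.ball ρ 1).indicator
                (fun s => ENNReal.ofReal ‖s - ρ‖⁻¹) s) ρ]
            refine lintegral_congr fun s => ?_
            simp only [Set.indicator, Metric.mem_ball, dist_eq_norm, add_sub_cancel_right,
              sub_zero]
          · rw [← Measure.addHaar_ball_center volume z]
            exact measure_mono (Metric.ball_subset_ball hR)

end Kernel

section Submean

open scoped ENNReal
open Real (circleAverage posLog)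

lemma setLIntegral_ball_eq_polar {u : ℂ → ℝ≥0∞} (hu : Measurable u) (c : ℂ) (R : ℝ) :
    ∫⁻ z in Metric.ball c R, u z = ∫⁻ r in Set.Ioo 0 R, ENNReal.ofReal r *
      ∫⁻ θ in Set.Ioo (-Real.pi) Real.pi, u (circleMap c r θ) := by
  have hm : Measurable ((Metric.ball c R).indicator u) :=
    hu.indicator Metric.isOpen_ball.measurableSet
  have hcm : Measurable fun p : ℝ × ℝ => circleMap c p.1 p.2 := by
    unfold circleMap
    fun_prop
  rw [← lintegral_indicator Metric.isOpen_ball.measurableSet,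
    ← lintegral_add_left_eq_self _ c, ← Complex.lintegral_comp_polarCoord_symm]
  have he : ∀ p : ℝ × ℝ, c + Complex.polarCoord.symm p = circleMap c p.1 p.2 := by
    intro p
    rw [Complex.polarCoord_symm_apply, circleMap, exp_mul_I, ofReal_cos, ofReal_sin]
  simp_rw [he, polarCoord_target, smul_eq_mul]
  rw [Measure.volume_eq_prod, setLIntegral_prod _ (by
    refine (Measurable.mul ?_ (hm.comp hcm)).aemeasurable
    fun_prop)]
  simp only
  rw [← lintegral_indicator measurableSet_Ioi, ← lintegral_indicator measurableSet_Ioo]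
  refine lintegral_congr fun r => ?_
  by_cases h0 : 0 < r
  · rw [Set.indicator_of_mem (Set.mem_Ioi.2 h0)]
    have hmem : ∀ θ, circleMap c r θ ∈ Metric.ball c R ↔ r < R := by
      intro θ
      rw [Metric.mem_ball, dist_eq_norm, circleMap_sub_center, norm_circleMap_zero, abs_of_pos h0]
    rw [lintegral_const_mul _ (by exact hm.comp (hcm.comp (measurable_const.prodMk measurable_id)))]
    by_cases h1 : r < R
    · rw [Set.indicator_of_mem (Set.mem_Ioo.2 ⟨h0, h1⟩)]
      simp_rw [Set.indicator_of_mem ((hmem _).2 h1)]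
    · rw [Set.indicator_of_notMem (fun h => h1 h.2)]
      simp_rw [Set.indicator_of_notMem (fun h => h1 ((hmem _).1 h))]
      simp
  · rw [Set.indicator_of_notMem (by simpa using h0), Set.indicator_of_notMem (fun h => h0 h.1)]

lemma setLIntegral_ball_mono_of_circle {u v : ℂ → ℝ≥0∞} (hu : Measurable u) (hv : Measurable v)
    {c : ℂ} {R : ℝ} (h : ∀ r, 0 < r → r < R →
      ∫⁻ θ in Set.Ioo (-Real.pi) Real.pi, u (circleMap c r θ) ≤
        ∫⁻ θ in Set.Ioo (-Real.pi) Real.pi, v (circleMap c r θ)) :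
    ∫⁻ z in Metric.ball c R, u z ≤ ∫⁻ z in Metric.ball c R, v z := by
  rw [setLIntegral_ball_eq_polar hu, setLIntegral_ball_eq_polar hv]
  refine setLIntegral_mono' measurableSet_Ioo fun r hr => ?_
  exact mul_le_mul_right (h r hr.1 hr.2) _

lemma lintegral_circleMap_eq_ofReal_circleAverage {w : ℂ → ℝ} {c : ℂ} {r : ℝ}
    (hw : CircleIntegrable w c r) (h0 : ∀ z, 0 ≤ w z) :
    ∫⁻ θ in Set.Ioo (-Real.pi) Real.pi, ENNReal.ofReal (w (circleMap c r θ)) =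
      ENNReal.ofReal (2 * Real.pi * circleAverage w c r) := by
  have hper : Function.Periodic (fun θ => w (circleMap c r θ)) (2 * Real.pi) :=
    fun θ => congrArg w (periodic_circleMap c r θ)
  have hi : IntervalIntegrable (fun θ => w (circleMap c r θ)) volume (-Real.pi) Real.pi := by
    refine hper.intervalIntegrable Real.two_pi_pos.ne' (t := 0) ?_ _ _
    rw [zero_add]; exact hw
  have hle : -Real.pi ≤ Real.pi := by linarith [Real.pi_pos]
  rw [Real.circleAverage_eq_integral_add (-Real.pi),
    intervalIntegral.integral_comp_add_right (fun θ => w (circleMap c r θ)), smul_eq_mul,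
    mul_inv_cancel_left₀ Real.two_pi_pos.ne', show 0 + -Real.pi = -Real.pi by ring,
    show 2 * Real.pi + -Real.pi = Real.pi by ring, intervalIntegral.integral_of_le hle,
    integral_Ioc_eq_integral_Ioo, ofReal_integral_eq_lintegral_ofReal]
  · exact ((intervalIntegrable_iff_integrableOn_Ioo_of_le hle).1 hi)
  · exact Eventually.of_forall fun θ => h0 _

lemma log_norm_le_circleAverage {f : ℂ → ℂ} {c : ℂ} {r : ℝ} (hr : 0 < r)
    (hf : AnalyticOnNhd ℂ f (Metric.closedBall c r)) (hc : f c ≠ 0) :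
    Real.log ‖f c‖ ≤ circleAverage (fun z => Real.log ‖f z‖) c r := by
  have hf' : AnalyticOnNhd ℂ f (Metric.closedBall c |r|) := by rwa [abs_of_pos hr]
  rw [hf'.circleAverage_log_norm hr.ne' hc]
  refine le_add_of_nonneg_left (finsum_nonneg fun u => ?_)
  by_cases h1 : u ∈ Metric.closedBall c |r|
  · refine mul_nonneg (mod_cast MeromorphicOn.AnalyticOnNhd.divisor_nonneg hf' u) ?_
    by_cases h : u = c
    · simp [h]
    · apply Real.log_nonneg
      rw [abs_of_pos hr, Metric.mem_closedBall, dist_eq_norm'] at h1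
      have : 0 < ‖c - u‖ := norm_pos_iff.2 (sub_ne_zero.2 (Ne.symm h))
      rw [← div_eq_mul_inv, le_div_iff₀ this, one_mul]
      exact h1
  · rw [Function.locallyFinsuppWithin.apply_eq_zero_of_notMem _ h1]
    simp

lemma circleAverage_posLog_inv_add_le {f : ℂ → ℂ} {c : ℂ} {r : ℝ} (hr : 0 < r)
    (hf : AnalyticOnNhd ℂ f (Metric.closedBall c r)) (hc : f c ≠ 0) :
    circleAverage (fun z => posLog ‖f z‖⁻¹) c r + posLog ‖f c‖ ≤
      circleAverage (fun z => posLog ‖f z‖) c r + posLog ‖f c‖⁻¹ := by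
  have h1 := log_norm_le_circleAverage hr hf hc
  have hf' : MeromorphicOn f (Metric.sphere c |r|) :=
    (hf.mono (by rw [abs_of_pos hr]; exact Metric.sphere_subset_closedBall)).meromorphicOn
  have hi1 := hf'.circleIntegrable_posLog_norm
  have hi2 : CircleIntegrable (fun z => posLog ‖f z‖⁻¹) c r := by
    simpa using hf'.inv.circleIntegrable_posLog_norm
  have h2 : circleAverage (fun z => Real.log ‖f z‖) c r =
      circleAverage (fun z => posLog ‖f z‖) c r - circleAverage (fun z => posLog ‖f z‖⁻¹) c r := by
    rw [← Real.circleAverage_fun_sub hi1 hi2]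
    simp_rw [Real.posLog_sub_posLog_inv]
  rw [h2, ← Real.posLog_sub_posLog_inv] at h1
  linarith

/-- An area version of Jensen's inequality. -/
lemma lintegral_ball_posLog_inv_add_le {f : ℂ → ℂ} {c : ℂ} {R : ℝ}
    (hf : AnalyticOnNhd ℂ f (Metric.ball c R)) (hc : f c ≠ 0) :
    (∫⁻ z in Metric.ball c R, ENNReal.ofReal (posLog ‖f z‖⁻¹)) +
      ENNReal.ofReal (posLog ‖f c‖) * volume (Metric.ball c R) ≤
    (∫⁻ z in Metric.ball c R, ENNReal.ofReal (posLog ‖f z‖)) +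
      ENNReal.ofReal (posLog ‖f c‖⁻¹) * volume (Metric.ball c R) := by
  classical
  have hb := (Metric.isOpen_ball (x := c) (ε := R)).measurableSet
  set F : ℂ → ℂ := (Metric.ball c R).piecewise f 0 with hF
  have hFm : Measurable F := hf.continuousOn.measurable_piecewise continuousOn_const hb
  have hFf : ∀ z ∈ Metric.ball c R, F z = f z := fun z hz => Set.piecewise_eq_of_mem _ _ _ hz
  have hpm : Measurable posLog := Real.continuous_posLog.measurable
  have hm1 : Measurable fun z => ENNReal.ofReal (posLog ‖F z‖⁻¹) :=
    (hpm.comp hFm.norm.inv).ennreal_ofReal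
  have hm2 : Measurable fun z => ENNReal.ofReal (posLog ‖F z‖) :=
    (hpm.comp hFm.norm).ennreal_ofReal
  have key := setLIntegral_ball_mono_of_circle
    (hm1.add (measurable_const (a := ENNReal.ofReal (posLog ‖f c‖))))
    (hm2.add (measurable_const (a := ENNReal.ofReal (posLog ‖f c‖⁻¹)))) (c := c) (R := R) ?_
  · simp only [Pi.add_apply] at key
    rw [lintegral_add_right _ measurable_const, lintegral_add_right _ measurable_const,
      setLIntegral_const, setLIntegral_const] at key
    rw [setLIntegral_congr_fun hb (fun z hz => by rw [← hFf z hz]),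
      setLIntegral_congr_fun (f := fun z => ENNReal.ofReal (posLog ‖f z‖))
        (g := fun z => ENNReal.ofReal (posLog ‖F z‖)) hb (fun z hz => by
          change _ = ENNReal.ofReal (posLog ‖F z‖)
          rw [hFf z hz])]
    exact key
  · intro r hr hrR
    have hsub : Metric.closedBall c r ⊆ Metric.ball c R := Metric.closedBall_subset_ball hrR
    have hsp : ∀ θ, F (circleMap c r θ) = f (circleMap c r θ) := fun θ =>
      hFf _ (hsub (by
        rw [Metric.mem_closedBall, dist_eq_norm, circleMap_sub_center, norm_circleMap_zero,
          abs_of_pos hr]))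
    have hfr := hf.mono hsub
    have hf' : MeromorphicOn f (Metric.sphere c |r|) :=
      (hfr.mono (by rw [abs_of_pos hr]; exact Metric.sphere_subset_closedBall)).meromorphicOn
    have hi1 := hf'.circleIntegrable_posLog_norm
    have hi2 : CircleIntegrable (fun z => posLog ‖f z‖⁻¹) c r := by
      simpa using hf'.inv.circleIntegrable_posLog_norm
    simp only [Pi.add_apply, hsp]
    rw [lintegral_add_right _ measurable_const, lintegral_add_right _ measurable_const,
      lintegral_circleMap_eq_ofReal_circleAverage hi1 (fun z => Real.posLog_nonneg),
      lintegral_circleMap_eq_ofReal_circleAverage hi2 (fun z => Real.posLog_nonneg),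
      setLIntegral_const, setLIntegral_const, Real.volume_Ioo,
      show Real.pi - -Real.pi = 2 * Real.pi by ring, ← ENNReal.ofReal_mul Real.posLog_nonneg,
      ← ENNReal.ofReal_mul Real.posLog_nonneg, ← ENNReal.ofReal_add, ← ENNReal.ofReal_add]
    · refine ENNReal.ofReal_le_ofReal ?_
      have := circleAverage_posLog_inv_add_le hr hfr hc
      nlinarith [Real.pi_pos]
    all_goals first
      | exact mul_nonneg Real.posLog_nonneg Real.two_pi_pos.le
      | exact mul_nonneg Real.two_pi_pos.le
          (Real.circleAverage_nonneg_of_nonneg fun z _ => Real.posLog_nonneg)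

end Submean

section GammaBounds

lemma norm_Gamma_le_Gamma_re {z : ℂ} (hz : 0 < z.re) : ‖Gamma z‖ ≤ Real.Gamma z.re := by
  rw [Gamma_eq_integral hz, Real.Gamma_eq_integral hz, GammaIntegral]
  refine (norm_integral_le_integral_norm _).trans_eq ?_
  refine setIntegral_congr_fun measurableSet_Ioi fun x hx => ?_
  rw [norm_mul, norm_real, Real.norm_of_nonneg (Real.exp_pos _).le,
    norm_cpow_eq_rpow_re_of_pos hx, sub_re, one_re]

lemma exists_norm_Gamma_le_of_pos {a b : ℝ} (ha : 0 < a) :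
    ∃ C, 0 ≤ C ∧ ∀ z : ℂ, a ≤ z.re → z.re ≤ b → ‖Gamma z‖ ≤ C := by
  have hc : ContinuousOn Real.Gamma (Set.Icc a b) := fun x hx =>
    (Real.differentiableAt_Gamma (fun m => by
      have := ha.trans_le hx.1
      have hm : (0 : ℝ) ≤ m := m.cast_nonneg
      linarith)).continuousAt.continuousWithinAt
  obtain ⟨C, hC⟩ := isCompact_Icc.bddAbove_image hc
  refine ⟨max C 0, le_max_right _ _, fun z h1 h2 => ?_⟩
  exact (norm_Gamma_le_Gamma_re (ha.trans_le h1)).trans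
    ((hC (Set.mem_image_of_mem _ ⟨h1, h2⟩)).trans (le_max_left _ _))

lemma exists_norm_Gamma_mul_pow_le (k : ℕ) : ∀ (N : ℕ) (a b : ℝ), 0 < a + N →
    ∃ C, 0 ≤ C ∧ ∀ z : ℂ, a ≤ z.re → z.re ≤ b → 1 / 2 ≤ |z.im| → ‖Gamma z‖ * |z.im| ^ k ≤ C := by
  have step : ∀ (k : ℕ) (a b C : ℝ), (∀ z : ℂ, a + 1 ≤ z.re → z.re ≤ b + 1 → 1 / 2 ≤ |z.im| →
      ‖Gamma z‖ * |z.im| ^ k ≤ C) → ∀ z : ℂ, a ≤ z.re → z.re ≤ b → 1 / 2 ≤ |z.im| →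
      ‖Gamma z‖ * |z.im| ^ (k + 1) ≤ C := by
    intro k a b C h z h1 h2 h3
    have hz : z ≠ 0 := by
      rintro rfl
      rw [zero_im, abs_zero] at h3
      norm_num at h3
    have hk := h (z + 1) (by rw [add_re, one_re]; linarith) (by rw [add_re, one_re]; linarith)
      (by simpa using h3)
    rw [Gamma_add_one z hz, norm_mul, add_im, one_im, add_zero] at hk
    refine le_trans ?_ hk
    rw [pow_succ]
    have := abs_im_le_norm z
    calc ‖Gamma z‖ * (|z.im| ^ k * |z.im|) = |z.im| * (‖Gamma z‖ * |z.im| ^ k) := by ring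
      _ ≤ ‖z‖ * (‖Gamma z‖ * |z.im| ^ k) := by gcongr
      _ = _ := by ring
  have pos : ∀ (k : ℕ) (a b : ℝ), 0 < a →
      ∃ C, 0 ≤ C ∧ ∀ z : ℂ, a ≤ z.re → z.re ≤ b → 1 / 2 ≤ |z.im| →
        ‖Gamma z‖ * |z.im| ^ k ≤ C := by
    intro k
    induction k with
    | zero =>
      intro a b ha
      obtain ⟨C, h0, hC⟩ := exists_norm_Gamma_le_of_pos (b := b) ha
      exact ⟨C, h0, fun z h1 h2 _ => by simpa using hC z h1 h2⟩
    | succ k ih =>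
      intro a b ha
      obtain ⟨C, h0, hC⟩ := ih (a + 1) (b + 1) (by linarith)
      exact ⟨C, h0, step k a b C hC⟩
  intro N
  induction N with
  | zero =>
    intro a b ha
    exact pos k a b (by simpa using ha)
  | succ N ih =>
    intro a b ha
    obtain ⟨C, h0, hC⟩ := ih (a + 1) (b + 1) (by push_cast at ha; linarith)
    refine ⟨2 * C, by linarith, fun z h1 h2 h3 => ?_⟩
    have := step k a b C hC z h1 h2 h3
    rw [pow_succ, ← mul_assoc] at this
    nlinarith [mul_nonneg (norm_nonneg (Gamma z)) (pow_nonneg (abs_nonneg z.im) k)]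

lemma exists_norm_Gamma_mul_pow_le' (k : ℕ) (a b : ℝ) :
    ∃ C, 0 ≤ C ∧ ∀ z : ℂ, a ≤ z.re → z.re ≤ b → 1 / 2 ≤ |z.im| →
      ‖Gamma z‖ * |z.im| ^ k ≤ C := by
  obtain ⟨N, hN⟩ := exists_nat_gt (-a)
  exact exists_norm_Gamma_mul_pow_le k N a b (by linarith)

lemma norm_sin_le (z : ℂ) : ‖sin z‖ ≤ Real.exp |z.im| := by
  rw [Complex.sin, norm_div, norm_mul, norm_I, mul_one, Complex.norm_two]
  have h1 : ‖cexp (-z * I)‖ ≤ Real.exp |z.im| := by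
    rw [norm_exp]
    apply Real.exp_le_exp.2
    simpa using le_abs_self z.im
  have h2 : ‖cexp (z * I)‖ ≤ Real.exp |z.im| := by
    rw [norm_exp]
    apply Real.exp_le_exp.2
    simpa using neg_le_abs z.im
  have := norm_sub_le (cexp (-z * I)) (cexp (z * I))
  linarith

lemma exists_norm_Gamma_inv_le (a b : ℝ) :
    ∃ C, 1 ≤ C ∧ ∀ z : ℂ, a ≤ z.re → z.re ≤ b → 1 / 2 ≤ |z.im| →
      ‖(Gamma z)⁻¹‖ ≤ C * Real.exp (Real.pi * |z.im|) := by
  obtain ⟨C, h0, hC⟩ := exists_norm_Gamma_mul_pow_le' 0 (1 - b) (1 - a)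
  refine ⟨max C 1, le_max_right _ _, fun z h1 h2 h3 => ?_⟩
  have hG := hC (1 - z) (by rw [sub_re, one_re]; linarith) (by rw [sub_re, one_re]; linarith)
    (by simpa using h3)
  rw [pow_zero, mul_one] at hG
  have hz : Gamma (1 - z) ≠ 0 := Gamma_ne_zero fun m hm => by
    have := congrArg im hm
    simp at this
    rw [this, abs_zero] at h3
    norm_num at h3
  have href : (Gamma z)⁻¹ = Gamma (1 - z) * sin (Real.pi * z) / Real.pi := by
    have h := Gamma_mul_Gamma_one_sub z
    have hpi : (Real.pi : ℂ) ≠ 0 := ofReal_ne_zero.2 Real.pi_ne_zero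
    by_cases hs : sin (Real.pi * z) = 0
    · rw [hs, div_zero] at h
      rw [hs, (mul_eq_zero.1 h).resolve_right hz]; simp
    · have hz' : Gamma z ≠ 0 := fun h' => by
        rw [h', zero_mul] at h
        exact div_ne_zero hpi hs h.symm
      rw [eq_div_iff hs] at h
      rw [eq_div_iff hpi, inv_mul_eq_iff_eq_mul₀ hz', ← mul_assoc]
      exact h.symm
  have hs := norm_sin_le (Real.pi * z)
  rw [im_ofReal_mul, abs_mul, abs_of_pos Real.pi_pos] at hs
  rw [href, norm_div, norm_mul, norm_real, Real.norm_of_nonneg Real.pi_pos.le]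
  calc ‖Gamma (1 - z)‖ * ‖sin (Real.pi * z)‖ / Real.pi
      ≤ ‖Gamma (1 - z)‖ * ‖sin (Real.pi * z)‖ :=
        div_le_self (by positivity) (by linarith [Real.pi_gt_three])
    _ ≤ _ := mul_le_mul (hG.trans (le_max_left _ _)) hs (norm_nonneg _) (by positivity)

lemma exists_norm_archGamma_le (r₁ r₂ : ℕ) (h : 1 ≤ r₁ + r₂) (a b : ℝ) :
    ∃ C, 1 ≤ C ∧ ∀ z : ℂ, a ≤ z.re → z.re ≤ b → 1 ≤ |z.im| →
      ‖archGamma r₁ r₂ z‖ ≤ C * (z.im ^ 2)⁻¹ := by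
  obtain ⟨C, h0, hC⟩ := exists_norm_Gamma_mul_pow_le' 2 a b
  obtain ⟨D, hD0, hD⟩ := exists_norm_Gamma_mul_pow_le' 2 (a / 2) (b / 2)
  set M := max (max C (4 * D)) 1
  have hM1 : 1 ≤ M := le_max_right _ _
  refine ⟨M ^ (r₁ + r₂), one_le_pow₀ hM1, fun z h1 h2 h3 => ?_⟩
  have hsq : 1 ≤ z.im ^ 2 := by rw [← sq_abs]; nlinarith
  have e1 : ‖Gamma z‖ ≤ M * (z.im ^ 2)⁻¹ := by
    rw [← div_eq_mul_inv, le_div_iff₀ (by linarith), ← sq_abs]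
    exact (hC z h1 h2 (by linarith)).trans ((le_max_left _ _).trans (le_max_left _ _))
  have e2 : ‖Gamma (z / 2)‖ ≤ M * (z.im ^ 2)⁻¹ := by
    have hre : (z / 2).re = z.re / 2 := by simp
    have him : (z / 2).im = z.im / 2 := by simp
    have := hD (z / 2) (by rw [hre]; linarith) (by rw [hre]; linarith)
      (by rw [him, abs_div, abs_two]; linarith)
    rw [him, sq_abs, div_pow] at this
    rw [← div_eq_mul_inv, le_div_iff₀ (by linarith)]
    have h4 : 4 * D ≤ M := (le_max_right _ _).trans (le_max_left _ _)
    linarith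
  rw [archGamma, norm_mul, norm_pow, norm_pow]
  calc _ ≤ (M * (z.im ^ 2)⁻¹) ^ r₁ * (M * (z.im ^ 2)⁻¹) ^ r₂ := by gcongr
    _ = M ^ (r₁ + r₂) * ((z.im ^ 2)⁻¹) ^ (r₁ + r₂) := by rw [← pow_add, mul_pow]
    _ ≤ _ := by
      gcongr
      exact pow_le_of_le_one (by positivity) (inv_le_one_of_one_le₀ hsq) (by omega)

end GammaBounds

section ZetaGrowth

open InfinitePlace
open scoped Classical ENNReal
open Real (posLog)

/-- `f` grows at most exponentially in the imaginary direction on `S`. -/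
def HasLogGrowth (f : ℂ → ℂ) (S : Set ℂ) : Prop :=
  ∃ C : ℝ, 0 ≤ C ∧ ∀ s ∈ S, posLog ‖f s‖ ≤ C * (1 + |s.im|)

lemma HasLogGrowth.of_bounded {f : ℂ → ℂ} {S : Set ℂ} {C : ℝ} (h : ∀ s ∈ S, ‖f s‖ ≤ C) :
    HasLogGrowth f S :=
  ⟨posLog C, Real.posLog_nonneg, fun s hs =>
    (Real.posLog_le_posLog (norm_nonneg _) (h s hs)).trans
      (le_mul_of_one_le_right Real.posLog_nonneg (by linarith [abs_nonneg s.im]))⟩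

lemma HasLogGrowth.mul {f g : ℂ → ℂ} {S : Set ℂ} (hf : HasLogGrowth f S)
    (hg : HasLogGrowth g S) : HasLogGrowth (fun s => f s * g s) S := by
  obtain ⟨C, h0, hC⟩ := hf
  obtain ⟨D, hD0, hD⟩ := hg
  refine ⟨C + D, add_nonneg h0 hD0, fun s hs => ?_⟩
  rw [norm_mul, add_mul]
  exact Real.posLog_mul.trans (add_le_add (hC s hs) (hD s hs))

lemma HasLogGrowth.pow {f : ℂ → ℂ} {S : Set ℂ} (hf : HasLogGrowth f S) (n : ℕ) :
    HasLogGrowth (fun s => f s ^ n) S := by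
  obtain ⟨C, h0, hC⟩ := hf
  refine ⟨n * C, by positivity, fun s hs => ?_⟩
  rw [norm_pow, Real.posLog_pow, mul_assoc]
  exact mul_le_mul_of_nonneg_left (hC s hs) n.cast_nonneg

lemma HasLogGrowth.of_le_exp {f : ℂ → ℂ} {S : Set ℂ} {C c : ℝ} (hc : 0 ≤ c)
    (h : ∀ s ∈ S, ‖f s‖ ≤ C * Real.exp (c * |s.im|)) : HasLogGrowth f S := by
  refine ⟨posLog C + c, add_nonneg Real.posLog_nonneg hc, fun s hs => ?_⟩
  have h1 : posLog (Real.exp (c * |s.im|)) = c * |s.im| := by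
    rw [Real.posLog_eq_log, Real.log_exp]
    rw [abs_of_pos (Real.exp_pos _)]
    exact Real.one_le_exp (by positivity)
  have h2 := (Real.posLog_le_posLog (norm_nonneg _) (h s hs)).trans Real.posLog_mul
  rw [h1] at h2
  have := Real.posLog_nonneg (x := C)
  nlinarith [abs_nonneg s.im]

/-- The part of a vertical strip away from the real axis. -/
def offAxisStrip (a b : ℝ) : Set ℂ := {s | a ≤ s.re ∧ s.re ≤ b ∧ 1 ≤ |s.im|}

lemma norm_cpow_le_of_re_mem {x : ℝ} (hx : 0 < x) {a b : ℝ} {s : ℂ} (h1 : a ≤ s.re)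
    (h2 : s.re ≤ b) : ‖(x : ℂ) ^ s‖ ≤ x ^ a + x ^ b := by
  rw [norm_cpow_eq_rpow_re_of_pos hx]
  rcases le_total 1 x with h | h
  · have := Real.rpow_le_rpow_of_exponent_le h h2
    have := Real.rpow_nonneg hx.le a
    linarith
  · have := Real.rpow_le_rpow_of_exponent_ge hx h h1
    have := Real.rpow_nonneg hx.le b
    linarith

lemma one_le_norm_of_one_le_abs_im {s : ℂ} (h : 1 ≤ |s.im|) : 1 ≤ ‖s‖ :=
  h.trans (abs_im_le_norm s)

lemma WeakFEPair.exists_norm_Λ_le (P : WeakFEPair ℂ) (a b : ℝ) :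
    ∃ C, ∀ s ∈ offAxisStrip a b, ‖P.Λ s‖ ≤ C := by
  obtain ⟨C, hC⟩ := P.exists_norm_Λ₀_le a b
  refine ⟨C + ‖P.f₀‖ + ‖P.ε‖ * ‖P.g₀‖, fun s hs => ?_⟩
  rw [WeakFEPair.Λ]
  have h1 : ‖(1 / s) • P.f₀‖ ≤ ‖P.f₀‖ := by
    rw [_root_.norm_smul, norm_div, norm_one, one_div]
    exact mul_le_of_le_one_left (norm_nonneg _)
      (inv_le_one_of_one_le₀ (one_le_norm_of_one_le_abs_im hs.2.2))
  have h2 : ‖(P.ε / (P.k - s)) • P.g₀‖ ≤ ‖P.ε‖ * ‖P.g₀‖ := by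
    rw [_root_.norm_smul, norm_div]
    gcongr
    refine div_le_self (norm_nonneg _) (one_le_norm_of_one_le_abs_im ?_)
    simpa using hs.2.2
  exact (norm_sub_le _ _).trans (add_le_add ((norm_sub_le _ _).trans
    (add_le_add (hC s hs.1 hs.2.1) h1)) h2)

lemma exists_norm_completedDedekind_le (K : Type*) [Field K] [NumberField K] (a b : ℝ) :
    ∃ C, ∀ s ∈ offAxisStrip a b, ‖completedDedekind K s‖ ≤ C := by
  choose C hC using fun c : ClassGroup (𝓞 K) =>
    (thetaPair (exists_mk_eq c).choose).exists_norm_Λ_le a b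
  set N : ClassGroup (𝓞 K) → ℝ := fun c => ((FractionalIdeal.absNorm
    ((exists_mk_eq c).choose : FractionalIdeal (nonZeroDivisors (𝓞 K)) K) : ℚ) : ℝ)
  have hN : ∀ c, 0 < N c := fun c => absNorm_pos _
  refine ⟨∑ c, (N c ^ a + N c ^ b) * C c, fun s hs => (norm_sum_le _ _).trans
    (Finset.sum_le_sum fun c _ => ?_)⟩
  rw [norm_mul]
  exact mul_le_mul (norm_cpow_le_of_re_mem (hN c) hs.1 hs.2.1) (hC c s hs)
    (norm_nonneg _) (add_nonneg (Real.rpow_nonneg (hN c).le _) (Real.rpow_nonneg (hN c).le _))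

lemma hasLogGrowth_archInv (r₁ r₂ : ℕ) (a b : ℝ) :
    HasLogGrowth (archInv r₁ r₂) (offAxisStrip a b) := by
  have hre : ∀ s : ℂ, (s / 2).re = s.re / 2 := fun s => by simp
  have him : ∀ s : ℂ, (s / 2).im = s.im / 2 := fun s => by simp
  obtain ⟨C, -, hC⟩ := exists_norm_Gamma_inv_le a b
  obtain ⟨D, -, hD⟩ := exists_norm_Gamma_inv_le (a / 2) (b / 2)
  refine ((HasLogGrowth.mul ?_ ?_).pow r₁).mul ((HasLogGrowth.mul ?_ ?_).pow r₂)
  · exact HasLogGrowth.of_bounded fun s hs => norm_cpow_le_of_re_mem Real.pi_pos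
      (a := a / 2) (b := b / 2) (by rw [hre]; linarith [hs.1]) (by rw [hre]; linarith [hs.2.1])
  · refine HasLogGrowth.of_le_exp (C := D) (c := Real.pi / 2) (by positivity) fun s hs => ?_
    have := hD (s / 2) (by rw [hre]; linarith [hs.1]) (by rw [hre]; linarith [hs.2.1])
      (by rw [him, abs_div, abs_two]; linarith [hs.2.2])
    rw [him, abs_div, abs_two] at this
    convert this using 3
    ring
  · refine HasLogGrowth.of_bounded (C := (2 * Real.pi) ^ a + (2 * Real.pi) ^ b) fun s hs => ?_
    have := norm_cpow_le_of_re_mem Real.two_pi_pos hs.1 hs.2.1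
    push_cast at this
    exact this
  · exact HasLogGrowth.of_le_exp Real.pi_pos.le fun s hs => hC s hs.1 hs.2.1 (by linarith [hs.2.2])

variable {K : Type*} [Field K] [NumberField K] {ζK : ℂ → ℂ}

lemma hasLogGrowth_zeta (hζ_an : ∀ s : ℂ, s ≠ 1 → DifferentiableAt ℂ ζK s)
    (hζ_ser : ∀ s : ℂ, 1 < s.re →
      HasSum (fun I : {I : Ideal (𝓞 K) // I ≠ ⊥} =>
        ((Ideal.absNorm I.1 : ℕ) : ℂ) ^ (-s)) (ζK s)) (a b : ℝ) :
    HasLogGrowth ζK (offAxisStrip a b) := by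
  obtain ⟨c, hc, h⟩ := exists_mul_zeta_eq K hζ_an hζ_ser
  obtain ⟨C, hC⟩ := exists_norm_completedDedekind_le K a b
  obtain ⟨D, hD0, hD⟩ := (HasLogGrowth.of_bounded (f := fun _ => c⁻¹) (C := ‖c⁻¹‖)
    (S := offAxisStrip a b) fun _ _ => le_rfl).mul
    ((HasLogGrowth.of_bounded hC).mul (hasLogGrowth_archInv (nrRealPlaces K) (nrComplexPlaces K) a b))
  refine ⟨D, hD0, fun s hs => ?_⟩
  have hs' := hs.2.2
  have h0 : s ≠ 0 := fun h => by rw [h, zero_im, abs_zero] at hs'; norm_num at hs'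
  have h1 : s ≠ 1 := fun h => by rw [h, one_im, abs_zero] at hs'; norm_num at hs'
  have := hD s hs
  simp only at this
  rwa [← h s h0 h1, inv_mul_cancel_left₀ hc] at this

lemma exists_norm_zeta_inv_le {b : ℕ → ℝ}
    (hb : ∀ s : ℂ, 1 < s.re →
      HasSum (fun m : ℕ => (b m : ℂ) * (m : ℂ) ^ (-s)) (ζK s)⁻¹) {σ : ℝ} (hσ : 1 < σ) :
    ∃ B : ℝ, ∀ s : ℂ, s.re = σ → ‖(ζK s)⁻¹‖ ≤ B := by
  have hn : ∀ s : ℂ, s.re = σ → ∀ m : ℕ,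
      ‖(b m : ℂ) * (m : ℂ) ^ (-s)‖ = ‖(b m : ℂ) * (m : ℂ) ^ (-(σ : ℂ))‖ := by
    intro s hs m
    rcases m.eq_zero_or_pos with rfl | hm
    · have h1 : -s ≠ 0 := fun h => by
        rw [neg_eq_zero] at h; rw [h, zero_re] at hs; linarith
      have h2 : -(σ : ℂ) ≠ 0 := neg_ne_zero.2 (ofReal_ne_zero.2 (by linarith))
      rw [Nat.cast_zero, zero_cpow h1, zero_cpow h2]
    · rw [norm_mul, norm_mul, norm_natCast_cpow_of_pos hm, norm_natCast_cpow_of_pos hm]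
      simp [hs]
  refine ⟨∑' m : ℕ, ‖(b m : ℂ) * (m : ℂ) ^ (-(σ : ℂ))‖, fun s hs => ?_⟩
  have hsum := hb s (by rw [hs]; exact hσ)
  rw [← hsum.tsum_eq]
  refine (norm_tsum_le_tsum_norm hsum.summable.norm).trans_eq (tsum_congr (hn s hs))

/-- The integrand whose residues make up the modular relation. -/
noncomputable def modularIntegrand (ζK : ℂ → ℂ) (r₁ r₂ : ℕ) (β : ℝ) (s : ℂ) : ℂ :=
  (β : ℂ) ^ s * Gamma ((1 - s) / 2) ^ r₁ * Gamma (1 - s) ^ r₂ / ζK s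

lemma modularIntegrand_eq (r₁ r₂ : ℕ) (β : ℝ) (s : ℂ) :
    modularIntegrand ζK r₁ r₂ β s = (β : ℂ) ^ s * archGamma r₁ r₂ (1 - s) * (ζK s)⁻¹ := by
  rw [modularIntegrand, archGamma, div_eq_mul_inv, mul_assoc ((β : ℂ) ^ s)]

lemma exists_lintegral_posLog_modularIntegrand_le
    (hζ_an : ∀ s : ℂ, s ≠ 1 → DifferentiableAt ℂ ζK s)
    (hζ_ser : ∀ s : ℂ, 1 < s.re →
      HasSum (fun I : {I : Ideal (𝓞 K) // I ≠ ⊥} =>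
        ((Ideal.absNorm I.1 : ℕ) : ℂ) ^ (-s)) (ζK s))
    (hζ_pole : ∃ A : ℂ, A ≠ 0 ∧
      Tendsto (fun s : ℂ => (s - 1) * ζK s) (𝓝[≠] (1 : ℂ)) (𝓝 A))
    {b : ℕ → ℝ}
    (hb : ∀ s : ℂ, 1 < s.re →
      HasSum (fun m : ℕ => (b m : ℂ) * (m : ℂ) ^ (-s)) (ζK s)⁻¹)
    {r₁ r₂ : ℕ} (hr : 1 ≤ r₁ + r₂) {β : ℝ} (hβ : 0 < β) :
    ∃ C : ℝ, 0 ≤ C ∧ ∀ z : ℂ, -(1 / 4) ≤ z.re → z.re ≤ 5 / 4 → 4 ≤ |z.im| →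
      ∫⁻ w in Metric.ball z (1 / 8), ENNReal.ofReal (posLog ‖modularIntegrand ζK r₁ r₂ β w‖) ≤
        ENNReal.ofReal (C * (1 + |z.im|)) := by
  obtain ⟨D, hD0, hD⟩ := hasLogGrowth_zeta hζ_an hζ_ser (-1) 5
  obtain ⟨B, hB⟩ := exists_norm_zeta_inv_le hb (σ := 2) (by norm_num)
  obtain ⟨G, hG1, hG⟩ := exists_norm_archGamma_le r₁ r₂ hr (-1) 2
  set E := posLog ((β ^ (-1 : ℝ) + β ^ (2 : ℝ)) * G) with hE
  have hE0 : 0 ≤ E := Real.posLog_nonneg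
  set V := (volume (Metric.ball (0 : ℂ) 3)).toReal
  have hV : ∀ c : ℂ, volume (Metric.ball c 3) = ENNReal.ofReal V := fun c => by
    rw [ENNReal.ofReal_toReal measure_ball_lt_top.ne, Measure.addHaar_ball_center]
  have hV0 : 0 ≤ V := ENNReal.toReal_nonneg
  have hB0 : 0 ≤ posLog B := Real.posLog_nonneg
  refine ⟨(E + 4 * D + posLog B) * V, by positivity, fun z h1 h2 h3 => ?_⟩
  set c : ℂ := ⟨2, z.im⟩ with hc
  have hsub : Metric.ball z (1 / 8) ⊆ Metric.ball c 3 := by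
    refine Metric.ball_subset_ball' ?_
    have : dist z c ≤ 9 / 4 := by
      have e : z - c = ((z.re - 2 : ℝ) : ℂ) := by
        apply Complex.ext <;> simp [hc]
      rw [dist_eq_norm, e, norm_real, Real.norm_eq_abs, abs_le]
      constructor <;> linarith
    linarith
  have hstrip : ∀ w ∈ Metric.ball c 3, w ∈ offAxisStrip (-1) 5 ∧ |w.im| ≤ |z.im| + 3 := by
    intro w hw
    rw [Metric.mem_ball, dist_eq_norm] at hw
    have hre := abs_lt.1 ((abs_re_le_norm _).trans_lt hw)
    have him := (abs_im_le_norm _).trans_lt hw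
    simp only [sub_re, sub_im, hc] at hre him
    have i1 := abs_sub_abs_le_abs_sub z.im w.im
    have i2 := abs_sub_abs_le_abs_sub w.im z.im
    rw [abs_sub_comm] at i1
    exact ⟨⟨by linarith [hre.1], by linarith [hre.2], by linarith⟩, by linarith⟩
  have hpt : ∀ w ∈ Metric.ball z (1 / 8),
      posLog ‖modularIntegrand ζK r₁ r₂ β w‖ ≤ E + posLog ‖ζK w‖⁻¹ := by
    intro w hw
    have hs := (hstrip w (hsub hw)).1.2.2
    rw [Metric.mem_ball, dist_eq_norm] at hw
    have hre := abs_lt.1 ((abs_re_le_norm _).trans_lt hw)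
    rw [sub_re] at hre
    have g1 := hG (1 - w) (by rw [sub_re, one_re]; linarith [hre.2])
      (by rw [sub_re, one_re]; linarith [hre.1]) (by simpa using hs)
    have hsq : (((1 - w).im) ^ 2)⁻¹ ≤ 1 := by
      refine inv_le_one_of_one_le₀ ?_
      rw [sub_im, one_im, zero_sub, neg_sq, ← sq_abs]
      nlinarith
    have g2 : ‖archGamma r₁ r₂ (1 - w)‖ ≤ G :=
      g1.trans (mul_le_of_le_one_right (by linarith) hsq)
    have g3 := norm_cpow_le_of_re_mem hβ (a := -1) (b := 2) (s := w) (by linarith [hre.1])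
      (by linarith [hre.2])
    rw [modularIntegrand_eq, norm_mul, norm_mul, norm_inv]
    refine Real.posLog_mul.trans ?_
    gcongr
    refine Real.posLog_le_posLog (by positivity) ?_
    gcongr
  have hζc : ζK c ≠ 0 := zeta_ne_zero_of_one_lt_re hζ_an hζ_pole hb (by rw [hc]; norm_num)
  have han : AnalyticOnNhd ℂ ζK (Metric.ball c 3) := fun w hw => analyticAt_zeta hζ_an (by
    rintro rfl
    have := (hstrip 1 hw).1.2.2
    rw [one_im, abs_zero] at this
    norm_num at this)
  have hJ := (le_self_add.trans (lintegral_ball_posLog_inv_add_le han hζc))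
  calc _ ≤ ∫⁻ w in Metric.ball z (1 / 8), (ENNReal.ofReal E + ENNReal.ofReal (posLog ‖ζK w‖⁻¹)) := by
        refine setLIntegral_mono' Metric.isOpen_ball.measurableSet fun w hw => ?_
        rw [← ENNReal.ofReal_add hE0 Real.posLog_nonneg]
        exact ENNReal.ofReal_le_ofReal (hpt w hw)
    _ ≤ ∫⁻ w in Metric.ball c 3, (ENNReal.ofReal E + ENNReal.ofReal (posLog ‖ζK w‖⁻¹)) :=
        lintegral_mono_set hsub
    _ = ENNReal.ofReal E * volume (Metric.ball c 3) +
        ∫⁻ w in Metric.ball c 3, ENNReal.ofReal (posLog ‖ζK w‖⁻¹) := by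
        rw [lintegral_add_left measurable_const, setLIntegral_const]
    _ ≤ ENNReal.ofReal E * volume (Metric.ball c 3) +
        ((∫⁻ w in Metric.ball c 3, ENNReal.ofReal (D * (4 + |z.im|))) +
          ENNReal.ofReal (posLog B) * volume (Metric.ball c 3)) := by
        refine add_le_add_right (hJ.trans ?_) _
        gcongr ?_ + ?_ * _
        · refine setLIntegral_mono' Metric.isOpen_ball.measurableSet fun w hw => ?_
          refine ENNReal.ofReal_le_ofReal ((hD w (hstrip w hw).1).trans ?_)
          exact mul_le_mul_of_nonneg_left (by linarith [(hstrip w hw).2]) hD0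
        · refine ENNReal.ofReal_le_ofReal (Real.posLog_le_posLog (by positivity) ?_)
          rw [← norm_inv]
          exact hB c rfl
    _ = ENNReal.ofReal (E * V + (D * (4 + |z.im|) * V + posLog B * V)) := by
        rw [setLIntegral_const, hV, ENNReal.ofReal_add, ENNReal.ofReal_add, ENNReal.ofReal_mul hE0,
          ENNReal.ofReal_mul hB0, ENNReal.ofReal_mul (p := D * (4 + |z.im|))]
        all_goals positivity
    _ ≤ _ := by
        refine ENNReal.ofReal_le_ofReal ?_
        have hz := abs_nonneg z.im
        have e1 : 0 ≤ E * V * |z.im| := by positivity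
        have e2 : 0 ≤ D * V * |z.im| := by positivity
        have e3 : 0 ≤ posLog B * V * |z.im| := by positivity
        nlinarith

end ZetaGrowth

section ContourShift

/-- The function whose value at each point is the limit of `f` there. -/
noncomputable def removeSingularities (f : ℂ → ℂ) (z : ℂ) : ℂ := limUnder (𝓝[≠] z) f

lemma removeSingularities_eventuallyEq {f k : ℂ → ℂ} {p : ℂ} (hk : AnalyticAt ℂ k p)
    (hf : f =ᶠ[𝓝[≠] p] k) : removeSingularities f =ᶠ[𝓝 p] k := by
  obtain ⟨u, hu, hpu, hsub⟩ := mem_nhdsWithin.1 hf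
  filter_upwards [hk.eventually_analyticAt, hu.mem_nhds hpu] with y hy hyu
  have hev : f =ᶠ[𝓝[≠] y] k := by
    by_cases hyp : y = p
    · rw [hyp]; exact hf
    · refine nhdsWithin_le_nhds ?_
      filter_upwards [(hu.inter isOpen_compl_singleton).mem_nhds ⟨hyu, hyp⟩] with w hw
      exact hsub hw
  exact ((hy.continuousAt.tendsto.mono_left nhdsWithin_le_nhds).congr' hev.symm).limUnder_eq

lemma removeSingularities_eq {f : ℂ → ℂ} {p : ℂ} (hf : AnalyticAt ℂ f p) :
    removeSingularities f p = f p :=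
  (removeSingularities_eventuallyEq hf EventuallyEq.rfl).eq_of_nhds

/-- A rational function with the polar part at `p` of `G s / (s - p) ^ (q + 1)`, the simple pole
being represented by a kernel that is absolutely integrable on vertical lines. -/
noncomputable def polarPart (G : ℂ → ℂ) (p : ℂ) (q : ℕ) (s : ℂ) : ℂ :=
  ∑ i ∈ Finset.range q, iteratedDeriv i G p / i.factorial * ((s - p) ^ (q + 1 - i))⁻¹ +
    iteratedDeriv q G p / q.factorial * cauchyKernel (s - p)

lemma exists_analyticAt_sub_polarPart {G F : ℂ → ℂ} {p : ℂ} (q : ℕ) (hG : AnalyticAt ℂ G p)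
    (h : ∀ᶠ s in 𝓝[≠] p, G s = (s - p) ^ (q + 1) * F s) :
    ∃ k, AnalyticAt ℂ k p ∧ ∀ᶠ s in 𝓝[≠] p, F s - polarPart G p q s = k s := by
  have hG' : AnalyticAt ℂ (fun z => G (p + z)) 0 := by
    refine AnalyticAt.fun_comp (g := G) (f := fun z => p + z) (by simpa using hG) (by fun_prop)
  obtain ⟨T, hT, hTe⟩ := hG'.exists_eq_sum_add_pow_mul (q + 1)
  have hD : ∀ i, iteratedDeriv i (fun z => G (p + z)) 0 = iteratedDeriv i G p := fun i => by
    simp [iteratedDeriv_comp_const_add]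
  refine ⟨fun s => T (s - p) + iteratedDeriv q G p / q.factorial * (s - p + 5)⁻¹, ?_, ?_⟩
  · refine AnalyticAt.add (AnalyticAt.fun_comp (g := T) (by simpa using hT) (by fun_prop)) ?_
    exact analyticAt_const.mul (AnalyticAt.inv (by fun_prop) (by simp))
  · filter_upwards [h, self_mem_nhdsWithin] with s hs hsp
    have hne : s - p ≠ 0 := sub_ne_zero.2 hsp
    have h1 := hTe (s - p)
    rw [add_sub_cancel, hs] at h1
    have h2 : F s = ((s - p) ^ (q + 1))⁻¹ * ((s - p) ^ (q + 1) * F s) := by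
      rw [inv_mul_cancel_left₀ (pow_ne_zero _ hne)]
    rw [h2, h1, Finset.sum_range_succ, mul_add, mul_add, Finset.mul_sum, smul_eq_mul,
      smul_eq_mul, inv_mul_cancel_left₀ (pow_ne_zero _ hne), polarPart, cauchyKernel]
    have h3 : ∑ i ∈ Finset.range q, ((s - p) ^ (q + 1))⁻¹ * (((s - p) ^ i / i.factorial) •
        iteratedDeriv i (fun z => G (p + z)) 0) = ∑ i ∈ Finset.range q,
        iteratedDeriv i G p / i.factorial * ((s - p) ^ (q + 1 - i))⁻¹ := by
      refine Finset.sum_congr rfl fun i hi => ?_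
      have hi' : i ≤ q + 1 := by have := Finset.mem_range.1 hi; omega
      rw [hD, smul_eq_mul, pow_sub₀ _ hne hi', mul_inv,
        inv_inv]
      ring
    have h4 : ((s - p) ^ (q + 1))⁻¹ * ((s - p) ^ q / q.factorial * iteratedDeriv q G p) =
        iteratedDeriv q G p / q.factorial * (1 / (s - p)) := by
      rw [pow_succ]
      field_simp
    rw [h3, hD, h4]
    ring

lemma norm_inv_pow_le_one {w : ℂ} (h : 1 ≤ ‖w‖) (j : ℕ) : ‖(w ^ j)⁻¹‖ ≤ 1 := by
  rw [norm_inv, norm_pow]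
  exact inv_le_one_of_one_le₀ (one_le_pow₀ h)

lemma exists_norm_polarPart_le (G : ℂ → ℂ) (p : ℝ) (q : ℕ) :
    ∃ C, ∀ s : ℂ, -4 ≤ s.re - p → 1 ≤ |s.im| → ‖polarPart G p q s‖ ≤ C := by
  refine ⟨∑ i ∈ Finset.range q, ‖iteratedDeriv i G p / i.factorial‖ * 1 +
    ‖iteratedDeriv q G p / q.factorial‖ * 2, fun s hs him => ?_⟩
  have h1 : 1 ≤ ‖s - p‖ := one_le_norm_of_one_le_abs_im (by simpa using him)
  refine (norm_add_le _ _).trans (add_le_add ((norm_sum_le _ _).trans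
    (Finset.sum_le_sum fun i _ => ?_)) ?_)
  · rw [norm_mul]
    gcongr
    exact norm_inv_pow_le_one h1 _
  · rw [norm_mul]
    gcongr
    refine (norm_cauchyKernel_le (by simpa using hs)).trans ?_
    linarith [inv_le_one_of_one_le₀ h1]

lemma integrable_polarPart_line (G : ℂ → ℂ) {a p : ℝ} (q : ℕ) (h1 : 1 / 4 ≤ |a - p|)
    (h2 : |a - p| ≤ 2) : Integrable (fun t : ℝ => polarPart G p q (a + t * I)) ∧
    ∫ t : ℝ, polarPart G p q (a + t * I) =
      iteratedDeriv q G p / q.factorial * ((|a - p| / (a - p) - 1) * Real.pi : ℝ) := by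
  have hne : a - p ≠ 0 := fun h => by rw [h, abs_zero] at h1; norm_num at h1
  have e : ∀ t : ℝ, (a : ℂ) + t * I - p = ((a - p : ℝ) : ℂ) + t * I := fun t => by
    push_cast; ring
  simp only [polarPart, e]
  have hi : ∀ i ∈ Finset.range q, Integrable (fun t : ℝ => iteratedDeriv i G p / i.factorial *
      ((((a - p : ℝ) : ℂ) + t * I) ^ (q + 1 - i))⁻¹) := fun i hi =>
    (integrable_inv_pow_line hne (by have := Finset.mem_range.1 hi; omega)).const_mul _
  have hk := (integrable_cauchyKernel_line h1 h2).const_mul (iteratedDeriv q G p / q.factorial)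
  refine ⟨(integrable_finsetSum _ hi).add hk, ?_⟩
  rw [integral_add (integrable_finsetSum _ hi) hk, integral_finsetSum _ hi,
    integral_const_mul, integral_cauchyKernel_line h1 h2, Finset.sum_eq_zero, zero_add]
  intro i hi
  rw [integral_const_mul, integral_inv_pow_line hne
    (by have := Finset.mem_range.1 hi; omega), mul_zero]

lemma norm_exp_mul_sq (δ : ℝ) (s : ℂ) :
    ‖Complex.exp (δ * s ^ 2)‖ = Real.exp (δ * (s.re ^ 2 - s.im ^ 2)) := by
  rw [Complex.norm_exp, sq s, sq s.re, sq s.im]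
  simp

lemma integral_line_eq_of_gaussian {H : ℂ → ℂ} {a b T₀ C δ : ℝ} (hab : a ≤ b) (hδ : 0 < δ)
    (hH : ∀ s : ℂ, a ≤ s.re → s.re ≤ b → DifferentiableAt ℂ H s)
    (hg : ∀ s : ℂ, a ≤ s.re → s.re ≤ b → T₀ ≤ |s.im| → ‖H s‖ ≤ Real.exp (C * (1 + |s.im|)))
    (hia : Integrable fun t : ℝ => H (a + t * I)  * Complex.exp (δ * (a + t * I) ^ 2))
    (hib : Integrable fun t : ℝ => H (b + t * I)  * Complex.exp (δ * (b + t * I) ^ 2)) :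
    ∫ t : ℝ, H (a + t * I)  * Complex.exp (δ * (a + t * I) ^ 2) =
      ∫ t : ℝ, H (b + t * I)  * Complex.exp (δ * (b + t * I) ^ 2) := by
  set f : ℂ → ℂ := fun s => H s * Complex.exp (δ * s ^ 2) with hf
  set M := max |a| |b|
  have hM : ∀ x ∈ Set.Icc a b, x ^ 2 ≤ M ^ 2 := fun x hx => by
    rw [← sq_abs x]
    have := abs_le_max_abs_abs hx.1 hx.2
    gcongr
  have hdec : Tendsto (fun T : ℝ => Real.exp (C * (1 + T) + δ * (M ^ 2 - T ^ 2)) * |b - a|)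
      atTop (𝓝 0) := by
    rw [← zero_mul |b - a|]
    refine Tendsto.mul_const _ (Real.tendsto_exp_atBot.comp ?_)
    have : (fun T : ℝ => C * (1 + T) + δ * (M ^ 2 - T ^ 2)) =
        fun T => (C + δ * M ^ 2) + -(T * (δ * T - C)) := by funext T; ring
    rw [this]
    refine tendsto_atBot_add_const_left _ _ (tendsto_neg_atTop_atBot.comp ?_)
    exact tendsto_id.atTop_mul_atTop₀ (tendsto_atTop_add_const_right _ _
      (tendsto_id.const_mul_atTop hδ))
  have hhor : ∀ ε : ℝ, (ε = 1 ∨ ε = -1) →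
      Tendsto (fun T : ℝ => ∫ x in a..b, f (x + ((ε * T : ℝ) : ℂ) * I)) atTop (𝓝 0) := by
    intro ε hε
    have hε1 : |ε| = 1 := by rcases hε with rfl | rfl <;> simp
    refine squeeze_zero_norm' ?_ hdec
    filter_upwards [eventually_ge_atTop T₀, eventually_ge_atTop 0] with T hT hT0
    refine intervalIntegral.norm_integral_le_of_norm_le_const fun x hx => ?_
    rw [Set.uIoc_of_le hab] at hx
    have hx' : x ∈ Set.Icc a b := ⟨hx.1.le, hx.2⟩
    have hre : ((x : ℂ) + ((ε * T : ℝ) : ℂ) * I).re = x := by simp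
    have him : ((x : ℂ) + ((ε * T : ℝ) : ℂ) * I).im = ε * T := by simp
    have himabs : |((x : ℂ) + ((ε * T : ℝ) : ℂ) * I).im| = T := by
      rw [him, abs_mul, hε1, one_mul, abs_of_nonneg hT0]
    have h1 := hg (x + ((ε * T : ℝ) : ℂ) * I) (by rw [hre]; exact hx'.1)
      (by rw [hre]; exact hx'.2) (by rw [himabs]; exact hT)
    rw [himabs] at h1
    rw [hf]
    simp only
    rw [norm_mul, norm_exp_mul_sq, hre, ← sq_abs (Complex.im _), himabs, Real.exp_add]
    have := hM x hx'
    gcongr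
  have hrect : ∀ T : ℝ, (∫ x in a..b, f (x + ((-1 * T : ℝ) : ℂ) * I)) -
      (∫ x in a..b, f (x + ((1 * T : ℝ) : ℂ) * I)) +
      I • (∫ y in (-T)..T, f (b + y * I)) - I • (∫ y in (-T)..T, f (a + y * I)) = 0 := by
    intro T
    have := integral_boundary_rect_eq_zero_of_differentiableOn f (a + ((-T : ℝ) : ℂ) * I)
      (b + (T : ℂ) * I) fun s hs => ?_
    · simpa using this
    · have hs' := (mem_reProdIm.1 hs).1
      simp only [add_re, ofReal_re, mul_re, I_re, mul_zero, ofReal_im, I_im, mul_one, sub_self,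
        add_zero, Set.uIcc_of_le hab] at hs'
      exact ((hH s hs'.1 hs'.2).mul (by fun_prop)).differentiableWithinAt
  have hva := intervalIntegral_tendsto_integral hia tendsto_neg_atTop_atBot tendsto_id
  have hvb := intervalIntegral_tendsto_integral hib tendsto_neg_atTop_atBot tendsto_id
  have hlim := (((hhor (-1) (Or.inr rfl)).sub (hhor 1 (Or.inl rfl))).add
    (hvb.const_smul I)).sub (hva.const_smul I)
  have hz := tendsto_nhds_unique hlim
    ((tendsto_const_nhds (x := (0 : ℂ))).congr fun T => (hrect T).symm)
  rw [sub_self, zero_add, sub_eq_zero] at hz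
  exact (smul_right_injective ℂ I_ne_zero hz).symm

/-- Shifting the contour for a function of exponential growth in the imaginary direction that is
integrable on both edges of a strip. -/
lemma integral_line_eq {H : ℂ → ℂ} {a b T₀ C : ℝ} (hab : a ≤ b)
    (hH : ∀ s : ℂ, a ≤ s.re → s.re ≤ b → DifferentiableAt ℂ H s)
    (hg : ∀ s : ℂ, a ≤ s.re → s.re ≤ b → T₀ ≤ |s.im| → ‖H s‖ ≤ Real.exp (C * (1 + |s.im|)))
    (hia : Integrable fun t : ℝ => H (a + t * I))
    (hib : Integrable fun t : ℝ => H (b + t * I)) :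
    ∫ t : ℝ, H (a + t * I) = ∫ t : ℝ, H (b + t * I) := by
  have hbd : ∀ (c δ t : ℝ), 0 ≤ δ → δ ≤ 1 →
      ‖Complex.exp (δ * ((c : ℂ) + t * I) ^ 2)‖ ≤ Real.exp (c ^ 2) := by
    intro c δ t h0 h1
    rw [norm_exp_mul_sq]
    simp only [add_re, ofReal_re, mul_re, I_re, mul_zero, ofReal_im, I_im, mul_one, sub_self,
      add_zero, add_im, mul_im, zero_add]
    gcongr
    nlinarith [sq_nonneg c, sq_nonneg t]
  have hms : ∀ c δ : ℝ, AEStronglyMeasurable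
      (fun t : ℝ => Complex.exp (δ * ((c : ℂ) + t * I) ^ 2)) volume := fun c δ =>
    Continuous.aestronglyMeasurable (by fun_prop)
  have h_int : ∀ c δ : ℝ, 0 ≤ δ → δ ≤ 1 → (Integrable fun t : ℝ => H (c + t * I)) →
      Integrable fun t : ℝ => H (c + t * I) * Complex.exp (δ * (c + t * I) ^ 2) :=
    fun c δ h0 h1 hc => hc.mul_bdd (c := Real.exp (c ^ 2)) (hms c δ)
      (Eventually.of_forall fun t => hbd c δ t h0 h1)
  have hδ : ∀ n : ℕ, 0 < 1 / ((n : ℝ) + 1) ∧ 1 / ((n : ℝ) + 1) ≤ 1 := fun n =>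
    ⟨by positivity, (div_le_one (by positivity)).2 (by linarith [n.cast_nonneg (α := ℝ)])⟩
  have hlim : ∀ c : ℝ, (Integrable fun t : ℝ => H (c + t * I)) →
      Tendsto (fun n : ℕ => ∫ t : ℝ, H (c + t * I) *
        Complex.exp (((1 / ((n : ℝ) + 1) : ℝ) : ℂ) * (c + t * I) ^ 2)) atTop
        (𝓝 (∫ t : ℝ, H (c + t * I))) := by
    intro c hc
    refine tendsto_integral_of_dominated_convergence
      (fun t => ‖H (c + t * I)‖ * Real.exp (c ^ 2)) (fun n => hc.aestronglyMeasurable.mul (hms c _))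
      (hc.norm.mul_const _) (fun n => Eventually.of_forall fun t => ?_)
      (Eventually.of_forall fun t => ?_)
    · rw [norm_mul]
      exact mul_le_mul_of_nonneg_left (hbd c _ t (hδ n).1.le (hδ n).2) (norm_nonneg _)
    · have h1 : Tendsto (fun n : ℕ => ((1 / ((n : ℝ) + 1) : ℝ) : ℂ) * ((c : ℂ) + t * I) ^ 2)
          atTop (𝓝 (((0 : ℝ) : ℂ) * ((c : ℂ) + t * I) ^ 2)) :=
        ((continuous_ofReal.tendsto 0).comp tendsto_one_div_add_atTop_nhds_zero_nat).mul_const _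
      have h2 := (Complex.continuous_exp.tendsto _).comp h1
      simpa [Function.comp_def] using h2.const_mul (H (c + t * I))
  refine tendsto_nhds_unique ((hlim a hia).congr fun n => ?_) (hlim b hib)
  exact integral_line_eq_of_gaussian hab (hδ n).1 hH hg (h_int a _ (hδ n).1.le (hδ n).2 hia)
    (h_int b _ (hδ n).1.le (hδ n).2 hib)

end ContourShift

section PolarSeries

open scoped ENNReal

variable {ι : Type*}

/-- The Mittag-Leffler series with simple poles at `ρ i` of residue `R i`. -/
noncomputable def polarSeries (R ρ : ι → ℂ) (s : ℂ) : ℂ := ∑' i, R i * cauchyKernel (s - ρ i)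

lemma measurable_cauchyKernel : Measurable cauchyKernel := by
  unfold cauchyKernel
  fun_prop

variable {R ρ : ι → ℂ}

lemma norm_mul_cauchyKernel_le {ε : ℝ} (hε : 0 < ε) {p s : ℂ} (hp : -1 < p.re)
    (hρ : ∀ i, (ρ i).re ≤ 1) (hsep : ∀ i, R i ≠ 0 → ε ≤ ‖p - ρ i‖)
    (hs : s ∈ Metric.ball p (min (ε / 2) 1)) (i : ι) :
    ‖R i * cauchyKernel (s - ρ i)‖ ≤ ‖R i‖ * (2 / ε + 1) := by
  rcases eq_or_ne (R i) 0 with h0 | h0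
  · simp [h0]
  rw [Metric.mem_ball, dist_eq_norm, lt_min_iff] at hs
  rw [norm_mul]
  gcongr
  have h1 := abs_le.1 ((abs_re_le_norm (s - p)).trans hs.2.le)
  rw [sub_re] at h1
  refine (norm_cauchyKernel_le ?_).trans (add_le_add_left ?_ _)
  · rw [sub_re]; linarith [h1.1, hρ i]
  · rw [← inv_div]
    refine inv_anti₀ (by positivity) ?_
    have h2 := norm_sub_norm_le (p - ρ i) (p - s)
    rw [sub_sub_sub_cancel_left, norm_sub_rev p s] at h2
    linarith [hsep i h0, hs.1]

lemma differentiableAt_mul_cauchyKernel {ε : ℝ} (hε : 0 < ε) {p s : ℂ} (hp : -1 < p.re)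
    (hρ : ∀ i, (ρ i).re ≤ 1) (hsep : ∀ i, R i ≠ 0 → ε ≤ ‖p - ρ i‖)
    (hs : s ∈ Metric.ball p (min (ε / 2) 1)) (i : ι) :
    DifferentiableAt ℂ (fun s => R i * cauchyKernel (s - ρ i)) s := by
  rcases eq_or_ne (R i) 0 with h0 | h0
  · simp [h0]
  rw [Metric.mem_ball, dist_eq_norm, lt_min_iff] at hs
  have h1 := abs_le.1 ((abs_re_le_norm (s - p)).trans hs.2.le)
  rw [sub_re] at h1
  have e1 : s - ρ i ≠ 0 := fun h => by
    have := hsep i h0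
    rw [← sub_eq_zero.1 h, norm_sub_rev] at this
    linarith [hs.1]
  have e2 : s - ρ i + 5 ≠ 0 := fun h => by
    have := congrArg re h
    simp only [add_re, sub_re, zero_re, re_ofNat] at this
    linarith [hρ i, h1.1]
  unfold cauchyKernel
  have d1 : DifferentiableAt ℂ (fun s => s - ρ i) s := by fun_prop
  have d2 : DifferentiableAt ℂ (fun s => s - ρ i + 5) s := by fun_prop
  exact (((differentiableAt_const 1).fun_div d1 e1).fun_sub
    ((differentiableAt_const 1).fun_div d2 e2)).const_mul _

lemma summable_mul_cauchyKernel (hR : Summable fun i => ‖R i‖) {ε : ℝ} (hε : 0 < ε) {p s : ℂ}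
    (hp : -1 < p.re) (hρ : ∀ i, (ρ i).re ≤ 1) (hsep : ∀ i, R i ≠ 0 → ε ≤ ‖p - ρ i‖)
    (hs : s ∈ Metric.ball p (min (ε / 2) 1)) :
    Summable fun i => R i * cauchyKernel (s - ρ i) :=
  Summable.of_norm_bounded (hR.mul_right _) (norm_mul_cauchyKernel_le hε hp hρ hsep hs)

lemma analyticAt_polarSeries (hR : Summable fun i => ‖R i‖) {ε : ℝ} (hε : 0 < ε) {p : ℂ}
    (hp : -1 < p.re) (hρ : ∀ i, (ρ i).re ≤ 1) (hsep : ∀ i, R i ≠ 0 → ε ≤ ‖p - ρ i‖) :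
    AnalyticAt ℂ (polarSeries R ρ) p := by
  have hpos : 0 < min (ε / 2) 1 := by positivity
  refine DifferentiableOn.analyticAt (s := Metric.ball p (min (ε / 2) 1)) ?_
    (Metric.ball_mem_nhds _ hpos)
  exact differentiableOn_tsum_of_summable_norm (hR.mul_right (2 / ε + 1))
    (fun i s hs => (differentiableAt_mul_cauchyKernel hε hp hρ hsep hs i).differentiableWithinAt)
    Metric.isOpen_ball fun i s hs => norm_mul_cauchyKernel_le hε hp hρ hsep hs i

lemma exists_analyticAt_polarSeries_sub [DecidableEq ι] (hR : Summable fun i => ‖R i‖) {ε : ℝ}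
    (hε : 0 < ε) (j : ι) (hp : -1 < (ρ j).re) (hρ : ∀ i, (ρ i).re ≤ 1)
    (hsep : ∀ i, i ≠ j → ε ≤ ‖ρ j - ρ i‖) :
    ∃ k, AnalyticAt ℂ k (ρ j) ∧
      ∀ᶠ s in 𝓝 (ρ j), polarSeries R ρ s - R j * cauchyKernel (s - ρ j) = k s := by
  have hR' : Summable fun i => ‖Function.update R j 0 i‖ := by
    refine hR.of_nonneg_of_le (fun i => norm_nonneg _) fun i => ?_
    rcases eq_or_ne i j with rfl | h
    · simp
    · rw [Function.update_of_ne h]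
  have hsep' : ∀ i, Function.update R j 0 i ≠ 0 → ε ≤ ‖ρ j - ρ i‖ := fun i h =>
    hsep i fun h' => by rw [h', Function.update_self] at h; exact h rfl
  refine ⟨_, analyticAt_polarSeries hR' hε hp hρ hsep', ?_⟩
  filter_upwards [Metric.ball_mem_nhds (ρ j) (show 0 < min (ε / 2) 1 by positivity)] with s hs
  have h1 := (summable_mul_cauchyKernel hR' hε hp hρ hsep' hs).hasSum.add
    (hasSum_ite_eq j (R j * cauchyKernel (s - ρ j)))
  have h2 : (fun i => Function.update R j 0 i * cauchyKernel (s - ρ i) +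
      if i = j then R j * cauchyKernel (s - ρ j) else 0) =
      fun i => R i * cauchyKernel (s - ρ i) := by
    funext i
    rcases eq_or_ne i j with rfl | h
    · simp
    · simp [h]
  rw [h2] at h1
  rw [polarSeries, h1.tsum_eq, add_sub_cancel_right, polarSeries]

lemma integral_mul_cauchyKernel_line (R : ι → ℂ) {a : ℝ}
    (h1 : ∀ i, 1 / 4 ≤ |a - (ρ i).re|) (h2 : ∀ i, |a - (ρ i).re| ≤ 2) :
    (∀ i, Integrable fun t : ℝ => R i * cauchyKernel (a + t * I - ρ i)) ∧
    ∀ i, ∫ t : ℝ, R i * cauchyKernel (a + t * I - ρ i) =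
      R i * ((|a - (ρ i).re| / (a - (ρ i).re) - 1) * Real.pi : ℝ) ∧
    ∫ t : ℝ, ‖R i * cauchyKernel (a + t * I - ρ i)‖ ≤ ‖R i‖ * (20 * Real.pi) := by
  have e : ∀ i (t : ℝ), (a : ℂ) + t * I - ρ i = ((a - (ρ i).re : ℝ) : ℂ) +
      ((t - (ρ i).im : ℝ) : ℂ) * I := fun i t => by
    conv_lhs => rw [← re_add_im (ρ i)]
    push_cast; ring
  have h_int : ∀ i, Integrable fun t : ℝ => R i * cauchyKernel (a + t * I - ρ i) := fun i => by
    simp only [e i]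
    exact ((integrable_cauchyKernel_line (h1 i) (h2 i)).comp_sub_right (ρ i).im).const_mul _
  refine ⟨h_int, fun i => ⟨?_, ?_⟩⟩
  · simp only [e i]
    rw [integral_const_mul, integral_sub_right_eq_self
      (fun t : ℝ => cauchyKernel (((a - (ρ i).re : ℝ) : ℂ) + (t : ℂ) * I)),
      integral_cauchyKernel_line (h1 i) (h2 i)]
  · have hb : ∀ t : ℝ, ‖R i * cauchyKernel (a + t * I - ρ i)‖ ≤
        ‖R i‖ * (20 * (1 + (t - (ρ i).im) ^ 2)⁻¹) := fun t => by
      rw [norm_mul, e]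
      exact mul_le_mul_of_nonneg_left (norm_cauchyKernel_line_le (h1 i) (h2 i) _) (norm_nonneg _)
    refine (integral_mono (h_int i).norm ?_ hb).trans_eq ?_
    · exact ((integrable_inv_one_add_sq.comp_sub_right (ρ i).im).const_mul 20).const_mul _
    · rw [integral_const_mul, integral_const_mul, integral_sub_right_eq_self
        (fun t : ℝ => (1 + t ^ 2)⁻¹), integral_univ_inv_one_add_sq]

lemma integrable_polarSeries_line [Countable ι] (hR : Summable fun i => ‖R i‖) {a : ℝ}
    (h1 : ∀ i, 1 / 4 ≤ |a - (ρ i).re|) (h2 : ∀ i, |a - (ρ i).re| ≤ 2) :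
    Integrable (fun t : ℝ => polarSeries R ρ (a + t * I)) ∧
    ∫ t : ℝ, polarSeries R ρ (a + t * I) =
      ∑' i, R i * ((|a - (ρ i).re| / (a - (ρ i).re) - 1) * Real.pi : ℝ) := by
  obtain ⟨hi, hv⟩ := integral_mul_cauchyKernel_line R h1 h2
  have hs : Summable fun i => ∫ t : ℝ, ‖R i * cauchyKernel (a + t * I - ρ i)‖ :=
    (hR.mul_right _).of_nonneg_of_le (fun i => integral_nonneg fun t => norm_nonneg _)
      fun i => (hv i).2
  refine ⟨?_, ?_⟩
  · refine ⟨AEMeasurable.aestronglyMeasurable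
      (AEMeasurable.tsum (L := .unconditional ι) fun i => (hi i).aemeasurable), ?_⟩
    · refine lt_of_le_of_lt (lintegral_mono fun t => enorm_tsum_le_tsum_enorm) ?_
      rw [lintegral_tsum fun i => (hi i).aestronglyMeasurable.enorm]
      have : ∀ i, ∫⁻ t : ℝ, ‖R i * cauchyKernel (a + t * I - ρ i)‖ₑ =
          ENNReal.ofReal (∫ t : ℝ, ‖R i * cauchyKernel (a + t * I - ρ i)‖) := fun i =>
        (ofReal_integral_norm_eq_lintegral_enorm (hi i)).symm
      rw [tsum_congr this, ← ENNReal.ofReal_tsum_of_nonneg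
        (fun i => integral_nonneg fun t => norm_nonneg _) hs]
      exact ENNReal.ofReal_lt_top
  · rw [← tsum_congr fun i => (hv i).1]
    exact (hasSum_integral_of_summable_integral_norm hi hs).tsum_eq.symm

lemma exists_lintegral_polarSeries_le [Countable ι] (hR : Summable fun i => ‖R i‖)
    (hρ : ∀ i, (ρ i).re ≤ 1) :
    ∃ C : ℝ≥0∞, C ≠ ⊤ ∧ ∀ (z : ℂ) (r : ℝ), r ≤ 1 → -1 ≤ z.re →
      ∫⁻ s in Metric.ball z r, ENNReal.ofReal ‖polarSeries R ρ s‖ ≤ C := by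
  obtain ⟨C, hC, h⟩ := exists_lintegral_cauchyKernel_le
  refine ⟨ENNReal.ofReal (∑' i, ‖R i‖) * C, ENNReal.mul_ne_top ENNReal.ofReal_ne_top hC,
    fun z r hr hz => ?_⟩
  have hm : ∀ i, Measurable fun s => R i * cauchyKernel (s - ρ i) := fun i =>
    (measurable_cauchyKernel.comp (measurable_id.sub_const _)).const_mul _
  calc ∫⁻ s in Metric.ball z r, ENNReal.ofReal ‖polarSeries R ρ s‖
      ≤ ∫⁻ s in Metric.ball z r, ∑' i, ‖R i * cauchyKernel (s - ρ i)‖ₑ := by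
        refine lintegral_mono fun s => ?_
        rw [ofReal_norm]
        exact enorm_tsum_le_tsum_enorm
    _ = ∑' i, ∫⁻ s in Metric.ball z r, ‖R i * cauchyKernel (s - ρ i)‖ₑ :=
        lintegral_tsum fun i => (hm i).enorm.aemeasurable
    _ ≤ ∑' i, ENNReal.ofReal ‖R i‖ * C := by
        refine ENNReal.tsum_le_tsum fun i => ?_
        simp only [enorm_mul]
        rw [lintegral_const_mul' _ _ enorm_ne_top, ofReal_norm]
        gcongr
        simp only [← ofReal_norm]
        refine h z (ρ i) r hr fun s hs => ?_
        rw [Metric.mem_ball, dist_eq_norm] at hs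
        have := abs_le.1 ((abs_re_le_norm (s - z)).trans hs.le)
        rw [sub_re] at this ⊢
        linarith [hρ i, this.1]
    _ = ENNReal.ofReal (∑' i, ‖R i‖) * C := by
        rw [ENNReal.tsum_mul_right, ENNReal.ofReal_tsum_of_nonneg (fun i => norm_nonneg _) hR]

end PolarSeries

section ModularPoles

open InfinitePlace

/-- The non-trivial zeros of `ζK`. -/
abbrev NontrivialZero (ζK : ℂ → ℂ) := {ρ : ℂ // ζK ρ = 0 ∧ 0 < ρ.re ∧ ρ.re < 1}

/-- The residue of `modularIntegrand` at a simple non-trivial zero. -/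
noncomputable def modularResidue (ζK : ℂ → ℂ) (r₁ r₂ : ℕ) (β : ℝ) (ρ : NontrivialZero ζK) : ℂ :=
  (β : ℂ) ^ ρ.1 * Gamma ((1 - ρ.1) / 2) ^ r₁ * Gamma (1 - ρ.1) ^ r₂ / deriv ζK ρ.1

variable {ζK : ℂ → ℂ} {r₁ r₂ : ℕ} {β : ℝ}

lemma modularResidue_ne_zero (hβ : 0 < β)
    (hsimple : ∀ ρ : ℂ, ζK ρ = 0 → 0 < ρ.re → ρ.re < 1 → deriv ζK ρ ≠ 0)
    (ρ : NontrivialZero ζK) : modularResidue ζK r₁ r₂ β ρ ≠ 0 := by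
  obtain ⟨ρ, h0, h1, h2⟩ := ρ
  have e1 : (0 : ℝ) < (1 - ρ).re := by rw [sub_re, one_re]; linarith
  have e2 : (0 : ℝ) < ((1 - ρ) / 2).re := by
    have : ((1 - ρ) / 2).re = (1 - ρ).re / 2 := by simp
    rw [this]; linarith
  refine div_ne_zero (mul_ne_zero (mul_ne_zero ?_ (pow_ne_zero _ (Gamma_ne_zero_of_re_pos e2)))
    (pow_ne_zero _ (Gamma_ne_zero_of_re_pos e1))) (hsimple ρ h0 h1 h2)
  exact (cpow_ne_zero_iff_of_exponent_ne_zero fun h => by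
    simp only at h; rw [h, zero_re] at h1; exact lt_irrefl _ h1).2 (ofReal_ne_zero.2 hβ.ne')

lemma countable_nontrivialZero (hβ : 0 < β)
    (hsimple : ∀ ρ : ℂ, ζK ρ = 0 → 0 < ρ.re → ρ.re < 1 → deriv ζK ρ ≠ 0)
    (hsum : Summable (modularResidue ζK r₁ r₂ β)) : Countable (NontrivialZero ζK) := by
  have h := hsum.countable_support
  have : Function.support (modularResidue ζK r₁ r₂ β) = Set.univ :=
    Set.eq_univ_of_forall (modularResidue_ne_zero hβ hsimple)
  rw [this] at h
  exact Set.countable_univ_iff.1 h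

lemma analyticAt_Gamma {s : ℂ} (hs : ∀ m : ℕ, s ≠ -m) : AnalyticAt ℂ Gamma s := by
  have h := differentiable_one_div_Gamma.analyticAt s
  have h2 := h.inv (inv_ne_zero (Gamma_ne_zero hs))
  refine h2.congr (Eventually.of_forall fun z => ?_)
  simp

lemma analyticAt_modularNumerator (hβ : 0 < β) {s : ℂ} (hs : s.re < 2) (hs1 : s ≠ 1) :
    AnalyticAt ℂ (fun s : ℂ => (β : ℂ) ^ s * Gamma ((1 - s) / 2) ^ r₁ * Gamma (1 - s) ^ r₂) s := by
  have h1 : ∀ m : ℕ, 1 - s ≠ -m := fun m h => by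
    have hsm : s = 1 + m := by linear_combination -h
    rcases m.eq_zero_or_pos with rfl | hm
    · exact hs1 (by simpa using hsm)
    · have := congrArg re hsm
      simp only [add_re, one_re, natCast_re] at this
      have : (1 : ℝ) ≤ m := by exact_mod_cast hm
      linarith
  have h2 : ∀ m : ℕ, (1 - s) / 2 ≠ -m := fun m h => h1 (2 * m) (by
    push_cast; linear_combination 2 * h)
  have e1 : AnalyticAt ℂ (fun s : ℂ => (β : ℂ) ^ s) s :=
    analyticAt_const.cpow analyticAt_id (ofReal_mem_slitPlane.2 hβ)
  have e2 : AnalyticAt ℂ (fun s : ℂ => Gamma ((1 - s) / 2)) s :=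
    AnalyticAt.fun_comp (g := Gamma) (analyticAt_Gamma h2) (by fun_prop)
  have e3 : AnalyticAt ℂ (fun s : ℂ => Gamma (1 - s)) s :=
    AnalyticAt.fun_comp (g := Gamma) (analyticAt_Gamma h1) (by fun_prop)
  exact (e1.mul (e2.pow _)).mul (e3.pow _)

lemma analyticAt_modularIntegrand (hζ_an : ∀ s : ℂ, s ≠ 1 → DifferentiableAt ℂ ζK s)
    (hβ : 0 < β) {s : ℂ} (hs : s.re < 2) (hs1 : s ≠ 1) (h0 : ζK s ≠ 0) :
    AnalyticAt ℂ (modularIntegrand ζK r₁ r₂ β) s :=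
  (analyticAt_modularNumerator hβ hs hs1).div (analyticAt_zeta hζ_an hs1) h0

lemma exists_analyticAt_modularIntegrand_sub
    (hζ_an : ∀ s : ℂ, s ≠ 1 → DifferentiableAt ℂ ζK s) (hβ : 0 < β)
    (hsimple : ∀ ρ : ℂ, ζK ρ = 0 → 0 < ρ.re → ρ.re < 1 → deriv ζK ρ ≠ 0)
    (ρ : NontrivialZero ζK) :
    ∃ k, AnalyticAt ℂ k ρ.1 ∧ ∀ᶠ s in 𝓝[≠] ρ.1, modularIntegrand ζK r₁ r₂ β s -
      modularResidue ζK r₁ r₂ β ρ * cauchyKernel (s - ρ.1) = k s := by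
  obtain ⟨ρ, h0, h1, h2⟩ := ρ
  have hρ1 : ρ ≠ 1 := fun h => by rw [h, one_re] at h2; exact lt_irrefl _ h2
  have hd : AnalyticAt ℂ (dslope ζK ρ) ρ := by
    have hn : ({1}ᶜ : Set ℂ) ∈ 𝓝 ρ := isOpen_compl_singleton.mem_nhds hρ1
    refine DifferentiableOn.analyticAt (s := {1}ᶜ) ?_ hn
    exact (differentiableOn_dslope hn).2 fun z hz => (hζ_an z hz).differentiableWithinAt
  have hG := (analyticAt_modularNumerator (r₁ := r₁) (r₂ := r₂) hβ (h2.trans one_lt_two) hρ1).div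
    hd (by rw [dslope_same]; exact hsimple ρ h0 h1 h2)
  obtain ⟨k, hk, hke⟩ := exists_analyticAt_sub_polarPart (F := modularIntegrand ζK r₁ r₂ β) 0 hG
    (by
      filter_upwards [self_mem_nhdsWithin] with s hs
      have hs' : s - ρ ≠ 0 := sub_ne_zero.2 hs
      rw [Pi.div_apply, dslope_of_ne _ hs, slope_def_field, h0, sub_zero, modularIntegrand,
        zero_add, pow_one, div_div_eq_mul_div]
      ring)
  refine ⟨k, hk, hke.mono fun s hs => ?_⟩
  rw [← hs]
  simp [polarPart, modularResidue, dslope_same]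

lemma exists_forall_le_norm_sub (hζ_an : ∀ s : ℂ, s ≠ 1 → DifferentiableAt ℂ ζK s)
    (hζ_pole : ∃ A : ℂ, A ≠ 0 ∧
      Tendsto (fun s : ℂ => (s - 1) * ζK s) (𝓝[≠] (1 : ℂ)) (𝓝 A)) (p : ℂ) :
    ∃ ε > 0, ∀ ρ : ℂ, ζK ρ = 0 → ρ ≠ p → ε ≤ ‖p - ρ‖ := by
  have h : ∀ᶠ s in 𝓝[≠] p, ζK s ≠ 0 := by
    rcases eq_or_ne p 1 with rfl | hp
    · obtain ⟨A, hA, hl⟩ := hζ_pole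
      filter_upwards [hl.eventually_ne hA] with s hs h
      rw [h, mul_zero] at hs
      exact hs rfl
    · exact (analyticAt_zeta hζ_an hp).eventually_eq_zero_or_eventually_ne_zero.resolve_left
        (not_eventually_zeta_eq_zero hζ_an hζ_pole hp)
  obtain ⟨ε, hε, hs⟩ := Metric.mem_nhdsWithin_iff.1 h
  refine ⟨ε, hε, fun ρ h0 hne => ?_⟩
  by_contra! hlt
  exact hs ⟨by rwa [Metric.mem_ball, dist_comm, dist_eq_norm], hne⟩ h0

lemma analyticAt_polarPart (G : ℂ → ℂ) {p s : ℂ} (q : ℕ) (hne : s ≠ p) (hre : p.re < s.re + 5) :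
    AnalyticAt ℂ (polarPart G p q) s := by
  have e1 : s - p ≠ 0 := sub_ne_zero.2 hne
  have e2 : s - p + 5 ≠ 0 := fun h => by
    have := congrArg re h
    simp only [add_re, sub_re, zero_re, re_ofNat] at this
    linarith
  have a1 : AnalyticAt ℂ (fun s => s - p) s := by fun_prop
  have a2 : AnalyticAt ℂ (fun s => s - p + 5) s := by fun_prop
  unfold polarPart cauchyKernel
  refine AnalyticAt.fun_add (Finset.analyticAt_fun_sum _ fun i _ => analyticAt_const.mul
    ((a1.pow _).inv (pow_ne_zero _ e1))) (analyticAt_const.mul ?_)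
  exact (analyticAt_const.div a1 e1).sub (analyticAt_const.div a2 e2)

/-- The sum of the polar parts of `modularIntegrand`. -/
noncomputable def modularPolarSum (ζK : ℂ → ℂ) (r₁ r₂ : ℕ) (β : ℝ) (g h : ℂ → ℂ) (q : ℕ)
    (s : ℂ) : ℂ :=
  polarSeries (modularResidue ζK r₁ r₂ β) Subtype.val s + polarPart g 1 q s + polarPart h 0 q s

lemma analyticAt_polarSeries_modularResidue
    (hζ_an : ∀ s : ℂ, s ≠ 1 → DifferentiableAt ℂ ζK s)
    (hζ_pole : ∃ A : ℂ, A ≠ 0 ∧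
      Tendsto (fun s : ℂ => (s - 1) * ζK s) (𝓝[≠] (1 : ℂ)) (𝓝 A))
    (hsum : Summable (modularResidue ζK r₁ r₂ β)) {s : ℂ} (hs : -1 < s.re)
    (h : ∀ ρ : NontrivialZero ζK, ρ.1 ≠ s) :
    AnalyticAt ℂ (polarSeries (modularResidue ζK r₁ r₂ β) Subtype.val) s := by
  obtain ⟨ε, hε, hsep⟩ := exists_forall_le_norm_sub hζ_an hζ_pole s
  exact analyticAt_polarSeries hsum.norm hε hs (fun ρ => ρ.2.2.2.le)
    fun ρ _ => hsep ρ.1 ρ.2.1 (h ρ)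

lemma analyticAt_modularIntegrand_sub_modularPolarSum
    (hζ_an : ∀ s : ℂ, s ≠ 1 → DifferentiableAt ℂ ζK s)
    (hζ_pole : ∃ A : ℂ, A ≠ 0 ∧
      Tendsto (fun s : ℂ => (s - 1) * ζK s) (𝓝[≠] (1 : ℂ)) (𝓝 A))
    (hβ : 0 < β) (hsum : Summable (modularResidue ζK r₁ r₂ β)) (g h : ℂ → ℂ) (q : ℕ) {s : ℂ}
    (hs : -1 < s.re) (hs' : s.re < 2) (h0 : s ≠ 0) (h1 : s ≠ 1) (hz : ζK s ≠ 0) :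
    AnalyticAt ℂ (fun s => modularIntegrand ζK r₁ r₂ β s - modularPolarSum ζK r₁ r₂ β g h q s)
      s := by
  refine (analyticAt_modularIntegrand hζ_an hβ hs' h1 hz).sub
    (((analyticAt_polarSeries_modularResidue hζ_an hζ_pole hsum hs ?_).add
      (analyticAt_polarPart g q h1 ?_)).add (analyticAt_polarPart h q h0 ?_))
  · rintro ρ rfl
    exact hz ρ.2.1
  · rw [one_re]; linarith
  · rw [zero_re]; linarith

lemma exists_analyticAt_modularIntegrand_sub_modularPolarSum
    (hζ_an : ∀ s : ℂ, s ≠ 1 → DifferentiableAt ℂ ζK s)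
    (hζ_pole : ∃ A : ℂ, A ≠ 0 ∧
      Tendsto (fun s : ℂ => (s - 1) * ζK s) (𝓝[≠] (1 : ℂ)) (𝓝 A))
    (hstrip : ∀ s : ℂ, ζK s = 0 → -1 < s.re → s.re < 2 → s ≠ 0 → s ≠ 1 → 0 < s.re ∧ s.re < 1)
    (hβ : 0 < β)
    (hsimple : ∀ ρ : ℂ, ζK ρ = 0 → 0 < ρ.re → ρ.re < 1 → deriv ζK ρ ≠ 0)
    (hsum : Summable (modularResidue ζK r₁ r₂ β)) {g h : ℂ → ℂ} {q : ℕ}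
    (hg : AnalyticAt ℂ g 1)
    (hg_eq : ∀ᶠ s in 𝓝[≠] (1 : ℂ), g s = (s - 1) ^ (q + 1) * modularIntegrand ζK r₁ r₂ β s)
    (hh : AnalyticAt ℂ h 0)
    (hh_eq : ∀ᶠ s in 𝓝[≠] (0 : ℂ), h s = (s - 0) ^ (q + 1) * modularIntegrand ζK r₁ r₂ β s)
    {p : ℂ} (hp : -1 < p.re) (hp' : p.re < 2) :
    ∃ k, AnalyticAt ℂ k p ∧ (fun s => modularIntegrand ζK r₁ r₂ β s -
      modularPolarSum ζK r₁ r₂ β g h q s) =ᶠ[𝓝[≠] p] k := by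
  classical
  rcases eq_or_ne p 1 with rfl | h1
  · obtain ⟨k, hk, hke⟩ := exists_analyticAt_sub_polarPart q hg hg_eq
    refine ⟨fun s => k s - (polarSeries (modularResidue ζK r₁ r₂ β) Subtype.val s +
      polarPart h 0 q s), hk.sub ((analyticAt_polarSeries_modularResidue hζ_an hζ_pole hsum hp
      ?_).add (analyticAt_polarPart h q one_ne_zero ?_)), ?_⟩
    · intro ρ hρ
      have := ρ.2.2.2
      rw [hρ, one_re] at this
      exact lt_irrefl _ this
    · rw [zero_re]; linarith
    · filter_upwards [hke] with s hs
      rw [← hs, modularPolarSum]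
      ring
  rcases eq_or_ne p 0 with rfl | h0
  · obtain ⟨k, hk, hke⟩ := exists_analyticAt_sub_polarPart q hh hh_eq
    refine ⟨fun s => k s - (polarSeries (modularResidue ζK r₁ r₂ β) Subtype.val s +
      polarPart g 1 q s), hk.sub ((analyticAt_polarSeries_modularResidue hζ_an hζ_pole hsum hp
      ?_).add (analyticAt_polarPart g q zero_ne_one ?_)), ?_⟩
    · intro ρ hρ
      have := ρ.2.2.1
      rw [hρ, zero_re] at this
      exact lt_irrefl _ this
    · rw [one_re, zero_re]; linarith
    · filter_upwards [hke] with s hs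
      rw [← hs, modularPolarSum]
      ring
  by_cases hz : ζK p = 0
  · obtain ⟨hp0, hp1⟩ := hstrip p hz hp hp' h0 h1
    set ρ : NontrivialZero ζK := ⟨p, hz, hp0, hp1⟩ with hρ
    obtain ⟨ε, hε, hsep⟩ := exists_forall_le_norm_sub hζ_an hζ_pole p
    obtain ⟨k, hk, hke⟩ := exists_analyticAt_modularIntegrand_sub (r₁ := r₁) (r₂ := r₂)
      hζ_an hβ hsimple ρ
    obtain ⟨l, hl, hle⟩ := exists_analyticAt_polarSeries_sub (R := modularResidue ζK r₁ r₂ β)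
      (ρ := Subtype.val) hsum.norm hε ρ hp (fun ρ => ρ.2.2.2.le)
      fun i hi => hsep i.1 i.2.1 fun h => hi (Subtype.ext h)
    refine ⟨fun s => k s - (l s + polarPart g 1 q s + polarPart h 0 q s),
      hk.sub ((hl.add (analyticAt_polarPart g q h1 ?_)).add (analyticAt_polarPart h q h0 ?_)), ?_⟩
    · rw [one_re]; linarith
    · rw [zero_re]; linarith
    · filter_upwards [hke, nhdsWithin_le_nhds hle] with s hs hs2
      rw [← hs, ← hs2, modularPolarSum]
      ring
  · exact ⟨_, analyticAt_modularIntegrand_sub_modularPolarSum hζ_an hζ_pole hβ hsum g h q hp hp'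
      h0 h1 hz, EventuallyEq.rfl⟩

end ModularPoles

section ModularGrowth

open InfinitePlace
open scoped ENNReal
open Real (posLog)

variable {K : Type*} [Field K] [NumberField K] {ζK : ℂ → ℂ}

lemma posLog_le_self {x : ℝ} (hx : 0 ≤ x) : posLog x ≤ x := by
  rw [Real.posLog_def]
  refine max_le hx ?_
  rcases hx.eq_or_lt with rfl | h
  · simp
  · linarith [Real.log_le_sub_one_of_pos h]

lemma le_exp_posLog (x : ℝ) : x ≤ Real.exp (posLog x) := by
  rcases le_or_gt x 0 with h | h
  · exact h.trans (Real.exp_pos _).le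
  · calc x = Real.exp (Real.log x) := (Real.exp_log h).symm
      _ ≤ _ := Real.exp_le_exp.2 (by rw [Real.posLog_def]; exact le_max_right _ _)

/-- `posLog ∘ norm` of a holomorphic function is bounded by its mean over a disc. -/
lemma posLog_norm_mul_volume_le {f : ℂ → ℂ} {c : ℂ} {R : ℝ}
    (hf : AnalyticOnNhd ℂ f (Metric.ball c R)) :
    ENNReal.ofReal (posLog ‖f c‖) * volume (Metric.ball c R) ≤
      ∫⁻ z in Metric.ball c R, ENNReal.ofReal (posLog ‖f z‖) := by
  rcases le_or_gt ‖f c‖ 1 with h | h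
  · have : posLog ‖f c‖ = 0 := by
      rw [Real.posLog_def]
      exact max_eq_left (Real.log_nonpos (norm_nonneg _) h)
    rw [this]
    simp
  · have h0 : f c ≠ 0 := fun h0 => by rw [h0, norm_zero] at h; linarith
    have h1 := lintegral_ball_posLog_inv_add_le hf h0
    have h2 : posLog ‖f c‖⁻¹ = 0 := by
      rw [Real.posLog_eq_zero_iff, abs_of_nonneg (by positivity)]
      exact inv_le_one_of_one_le₀ h.le
    rw [h2, ENNReal.ofReal_zero, zero_mul, add_zero] at h1
    exact le_add_self.trans h1

/-- `modularIntegrand` minus its polar parts, with the removable singularities removed. -/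
noncomputable def modularRegular (ζK : ℂ → ℂ) (r₁ r₂ : ℕ) (β : ℝ) (g h : ℂ → ℂ) (q : ℕ) :
    ℂ → ℂ :=
  removeSingularities fun s =>
    modularIntegrand ζK r₁ r₂ β s - modularPolarSum ζK r₁ r₂ β g h q s

lemma exists_norm_modularRegular_le {r₁ r₂ : ℕ} {β : ℝ}
    (hζ_an : ∀ s : ℂ, s ≠ 1 → DifferentiableAt ℂ ζK s)
    (hζ_ser : ∀ s : ℂ, 1 < s.re →
      HasSum (fun I : {I : Ideal (𝓞 K) // I ≠ ⊥} =>
        ((Ideal.absNorm I.1 : ℕ) : ℂ) ^ (-s)) (ζK s))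
    (hζ_pole : ∃ A : ℂ, A ≠ 0 ∧
      Tendsto (fun s : ℂ => (s - 1) * ζK s) (𝓝[≠] (1 : ℂ)) (𝓝 A))
    {b : ℕ → ℝ}
    (hb : ∀ s : ℂ, 1 < s.re →
      HasSum (fun m : ℕ => (b m : ℂ) * (m : ℂ) ^ (-s)) (ζK s)⁻¹)
    (hstrip : ∀ s : ℂ, ζK s = 0 → -1 < s.re → s.re < 2 → s ≠ 0 → s ≠ 1 → 0 < s.re ∧ s.re < 1)
    (hr : 1 ≤ r₁ + r₂) (hβ : 0 < β)
    (hsum : Summable (modularResidue ζK r₁ r₂ β)) (hcount : Countable (NontrivialZero ζK))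
    {g h : ℂ → ℂ} {q : ℕ}
    (hH : ∀ s : ℂ, -1 < s.re → s.re < 2 → AnalyticAt ℂ (modularRegular ζK r₁ r₂ β g h q) s) :
    ∃ C : ℝ, ∀ s : ℂ, -(1 / 4) ≤ s.re → s.re ≤ 5 / 4 → 4 ≤ |s.im| →
      ‖modularRegular ζK r₁ r₂ β g h q s‖ ≤ Real.exp (C * (1 + |s.im|)) := by
  obtain ⟨C, hC0, hC⟩ := exists_lintegral_posLog_modularIntegrand_le (r₁ := r₁) (r₂ := r₂)
    hζ_an hζ_ser hζ_pole hb hr hβ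
  obtain ⟨D, hDtop, hD⟩ := exists_lintegral_polarSeries_le hsum.norm
    (fun ρ : NontrivialZero ζK => ρ.2.2.2.le)
  obtain ⟨P, hP⟩ := exists_norm_polarPart_le g 1 q
  obtain ⟨Q, hQ⟩ := exists_norm_polarPart_le h 0 q
  rw [ofReal_one] at hP
  rw [ofReal_zero] at hQ
  set V : ℝ := (1 / 8) ^ 2 * Real.pi with hV
  have hVpos : 0 < V := by have := Real.pi_pos; positivity
  have hvol : ∀ z : ℂ, volume (Metric.ball z (1 / 8)) = ENNReal.ofReal V := fun z => by
    rw [Complex.volume_ball, hV, ENNReal.ofReal_mul (by positivity),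
      ENNReal.ofReal_pow (by norm_num)]
    congr 1
    rw [← NNReal.coe_real_pi, ENNReal.ofReal_coe_nnreal]
  set L : ℝ := Real.log 2 + |P| + |Q| with hL
  have hL0 : 0 ≤ L := by have := Real.log_nonneg one_le_two; positivity
  refine ⟨(C + D.toReal + L * V) / V, fun z hz1 hz2 hz3 => ?_⟩
  have hball : ∀ s ∈ Metric.ball z (1 / 8), -1 < s.re ∧ s.re < 2 ∧ 1 ≤ |s.im| := by
    intro s hs
    rw [Metric.mem_ball, dist_eq_norm] at hs
    have h1 := abs_le.1 ((abs_re_le_norm (s - z)).trans hs.le)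
    have h2 := (abs_im_le_norm (s - z)).trans hs.le
    rw [sub_re] at h1
    rw [sub_im] at h2
    have h3 := abs_sub_abs_le_abs_sub z.im s.im
    rw [abs_sub_comm] at h2
    exact ⟨by linarith [h1.1], by linarith [h1.2], by linarith⟩
  have key : ENNReal.ofReal (posLog ‖modularRegular ζK r₁ r₂ β g h q z‖) * ENNReal.ofReal V ≤
      ENNReal.ofReal (C * (1 + |z.im|)) + D + ENNReal.ofReal L * ENNReal.ofReal V := by
    rw [← hvol z]
    refine (posLog_norm_mul_volume_le fun s hs => hH s (hball s hs).1 (hball s hs).2.1).trans ?_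
    have hae : ∀ᵐ s ∂(volume.restrict (Metric.ball z (1 / 8))),
        modularRegular ζK r₁ r₂ β g h q s =
          modularIntegrand ζK r₁ r₂ β s - modularPolarSum ζK r₁ r₂ β g h q s := by
      have hc : (Set.range (Subtype.val : NontrivialZero ζK → ℂ)).Countable :=
        Set.countable_range _
      have h1 : ∀ᵐ s ∂(volume.restrict (Metric.ball z (1 / 8))),
          s ∉ Set.range (Subtype.val : NontrivialZero ζK → ℂ) :=
        ae_restrict_of_ae (hc.ae_notMem volume)
      filter_upwards [h1, ae_restrict_mem Metric.isOpen_ball.measurableSet] with s hs hsb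
      obtain ⟨b1, b2, b3⟩ := hball s hsb
      have s0 : s ≠ 0 := fun h => by rw [h, zero_im, abs_zero] at b3; linarith
      have s1 : s ≠ 1 := fun h => by rw [h, one_im, abs_zero] at b3; linarith
      refine removeSingularities_eq (analyticAt_modularIntegrand_sub_modularPolarSum hζ_an hζ_pole
        hβ hsum g h q b1 b2 s0 s1 fun hz => hs ?_)
      exact ⟨⟨s, hz, hstrip s hz b1 b2 s0 s1⟩, rfl⟩
    have hms : AEMeasurable (fun s => ENNReal.ofReal
        ‖polarSeries (modularResidue ζK r₁ r₂ β) Subtype.val s‖)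
        (volume.restrict (Metric.ball z (1 / 8))) := by
      refine (AEMeasurable.norm ?_).ennreal_ofReal
      exact AEMeasurable.tsum (L := .unconditional _) fun ρ =>
        ((measurable_cauchyKernel.comp (measurable_id.sub_const _)).const_mul _).aemeasurable
    calc ∫⁻ s in Metric.ball z (1 / 8),
          ENNReal.ofReal (posLog ‖modularRegular ζK r₁ r₂ β g h q s‖)
        ≤ ∫⁻ s in Metric.ball z (1 / 8), (ENNReal.ofReal
            (posLog ‖modularIntegrand ζK r₁ r₂ β s‖) + ENNReal.ofReal
            ‖polarSeries (modularResidue ζK r₁ r₂ β) Subtype.val s‖ + ENNReal.ofReal L) := by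
          refine lintegral_mono_ae ?_
          filter_upwards [hae, ae_restrict_mem Metric.isOpen_ball.measurableSet] with s hs hsb
          obtain ⟨b1, b2, b3⟩ := hball s hsb
          rw [hs, ← ENNReal.ofReal_add Real.posLog_nonneg (norm_nonneg _),
            ← ENNReal.ofReal_add (add_nonneg Real.posLog_nonneg (norm_nonneg _)) hL0]
          refine ENNReal.ofReal_le_ofReal ?_
          have e1 := Real.posLog_le_posLog (norm_nonneg _)
            (norm_sub_le (modularIntegrand ζK r₁ r₂ β s) (modularPolarSum ζK r₁ r₂ β g h q s))
          have e2 := Real.posLog_add (x := ‖modularIntegrand ζK r₁ r₂ β s‖)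
            (y := ‖modularPolarSum ζK r₁ r₂ β g h q s‖)
          have e3 := posLog_le_self (norm_nonneg (modularPolarSum ζK r₁ r₂ β g h q s))
          have e4 : ‖modularPolarSum ζK r₁ r₂ β g h q s‖ ≤
              ‖polarSeries (modularResidue ζK r₁ r₂ β) Subtype.val s‖ + |P| + |Q| :=
            norm_add₃_le.trans (add_le_add (add_le_add le_rfl
              ((hP s (by linarith) b3).trans (le_abs_self _)))
              ((hQ s (by linarith) b3).trans (le_abs_self _)))
          rw [hL]
          linarith
      _ = (∫⁻ s in Metric.ball z (1 / 8), ENNReal.ofReal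
            (posLog ‖modularIntegrand ζK r₁ r₂ β s‖)) + (∫⁻ s in Metric.ball z (1 / 8),
            ENNReal.ofReal ‖polarSeries (modularResidue ζK r₁ r₂ β) Subtype.val s‖) +
            ENNReal.ofReal L * volume (Metric.ball z (1 / 8)) := by
          rw [lintegral_add_right _ measurable_const, lintegral_add_right' _ hms, setLIntegral_const]
      _ ≤ _ := by
          gcongr
          · exact hC z hz1 hz2 hz3
          · exact hD z _ (by norm_num) (by linarith)
  have hbase : 0 ≤ C * (1 + |z.im|) := by positivity
  rw [← ENNReal.ofReal_toReal hDtop, ← ENNReal.ofReal_mul Real.posLog_nonneg,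
    ← ENNReal.ofReal_mul hL0, ← ENNReal.ofReal_add hbase ENNReal.toReal_nonneg,
    ← ENNReal.ofReal_add (by positivity) (by positivity),
    ENNReal.ofReal_le_ofReal_iff (by positivity)] at key
  refine (le_exp_posLog _).trans (Real.exp_le_exp.2 ?_)
  rw [div_mul_eq_mul_div, le_div_iff₀ hVpos]
  refine key.trans ?_
  have h1 : 0 ≤ D.toReal + L * V := by positivity
  nlinarith [abs_nonneg z.im, mul_nonneg h1 (abs_nonneg z.im)]

end ModularGrowth

section ModularContour

open InfinitePlace

lemma integrable_of_norm_le_inv_sq {f : ℝ → ℂ} {C : ℝ} (hf : Continuous f)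
    (h : ∀ t : ℝ, 1 ≤ |t| → ‖f t‖ ≤ C * (t ^ 2)⁻¹) : Integrable f := by
  obtain ⟨M, hM⟩ := (isCompact_Icc (a := (-1 : ℝ)) (b := 1)).exists_bound_of_continuousOn
    hf.continuousOn
  refine (integrable_inv_one_add_sq.const_mul (2 * max M |C|)).mono' hf.aestronglyMeasurable
    (Eventually.of_forall fun t => ?_)
  have h0 : 0 ≤ max M |C| := (abs_nonneg C).trans (le_max_right _ _)
  rcases le_total |t| 1 with ht | ht
  · have h1 : t ^ 2 ≤ 1 := by rw [← sq_abs]; exact pow_le_one₀ (abs_nonneg t) ht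
    refine ((hM t (abs_le.1 ht)).trans (le_max_left M |C|)).trans ?_
    rw [mul_assoc, mul_left_comm]
    refine le_mul_of_one_le_right h0 ?_
    rw [← div_eq_mul_inv, le_div_iff₀ (by positivity)]
    linarith
  · have h1 : 1 ≤ t ^ 2 := by rw [← sq_abs]; exact one_le_pow₀ ht
    refine (h t ht).trans ?_
    rw [mul_comm (2 : ℝ), mul_assoc]
    refine mul_le_mul ((le_abs_self C).trans (le_max_right _ _)) ?_ (by positivity) h0
    rw [← div_eq_mul_inv, le_div_iff₀ (by positivity), inv_mul_le_iff₀ (by positivity)]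
    linarith

variable {K : Type*} [Field K] [NumberField K] {ζK : ℂ → ℂ}

lemma modularIntegrand_eq_dual
    (hζ_an : ∀ s : ℂ, s ≠ 1 → DifferentiableAt ℂ ζK s)
    (hζ_ser : ∀ s : ℂ, 1 < s.re →
      HasSum (fun I : {I : Ideal (𝓞 K) // I ≠ ⊥} =>
        ((Ideal.absNorm I.1 : ℕ) : ℂ) ^ (-s)) (ζK s))
    {η β : ℝ} (hη : η = 4 ^ nrComplexPlaces K * Real.pi ^ Module.finrank ℚ K / |(discr K : ℝ)|)
    {s : ℂ} (hs : ∀ m : ℤ, s ≠ m) (h1 : ζK s ≠ 0) (h2 : ζK (1 - s) ≠ 0) :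
    modularIntegrand ζK (nrRealPlaces K) (nrComplexPlaces K) β s =
      (β : ℂ) ^ s * (η : ℂ) ^ (1 / 2 - s) *
        archGamma (nrRealPlaces K) (nrComplexPlaces K) s * (ζK (1 - s))⁻¹ := by
  have hη0 : (η : ℂ) ≠ 0 := by
    have := abs_discr_pos K
    have := Real.pi_pos
    rw [hη, ofReal_ne_zero]
    positivity
  have hFE := zeta_functional_equation K hζ_an hζ_ser hη hs
  have e : (η : ℂ) ^ (1 / 2 - s) * (η : ℂ) ^ (s - 1 / 2) = 1 := by
    rw [← cpow_add _ _ hη0, sub_add_sub_cancel, sub_self, cpow_zero]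
  rw [modularIntegrand_eq]
  generalize (η : ℂ) ^ (1 / 2 - s) = x at e ⊢
  generalize (η : ℂ) ^ (s - 1 / 2) = y at e hFE
  field_simp
  linear_combination (β : ℂ) ^ s * x * hFE -
    (β : ℂ) ^ s * ζK (1 - s) * archGamma (nrRealPlaces K) (nrComplexPlaces K) (1 - s) * e

lemma zeta_zero_re_mem
    (hζ_an : ∀ s : ℂ, s ≠ 1 → DifferentiableAt ℂ ζK s)
    (hζ_ser : ∀ s : ℂ, 1 < s.re →
      HasSum (fun I : {I : Ideal (𝓞 K) // I ≠ ⊥} =>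
        ((Ideal.absNorm I.1 : ℕ) : ℂ) ^ (-s)) (ζK s))
    (hζ_pole : ∃ A : ℂ, A ≠ 0 ∧
      Tendsto (fun s : ℂ => (s - 1) * ζK s) (𝓝[≠] (1 : ℂ)) (𝓝 A))
    {b : ℕ → ℝ}
    (hb : ∀ s : ℂ, 1 < s.re →
      HasSum (fun m : ℕ => (b m : ℂ) * (m : ℂ) ^ (-s)) (ζK s)⁻¹)
    (s : ℂ) (hs : ζK s = 0) (h : -1 < s.re) (h0 : s ≠ 0) (h1 : s ≠ 1) :
    0 < s.re ∧ s.re < 1 := by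
  refine ⟨?_, ?_⟩
  · by_contra! hle
    refine zeta_ne_zero_of_re_nonpos hζ_an hζ_ser hζ_pole hb hle (fun m hm => ?_) hs
    rw [hm, intCast_re] at h hle
    have h2 : (-1 : ℤ) < m := by exact_mod_cast h
    have h3 : m ≤ 0 := by exact_mod_cast hle
    have h4 : m = 0 := by omega
    exact h0 (by rw [hm, h4, Int.cast_zero])
  · by_contra! hle
    exact zeta_ne_zero_of_one_le_re hζ_an hζ_ser hζ_pole hb hle h1 hs

lemma exists_norm_archGamma_line_le {r₁ r₂ : ℕ} (hr : 1 ≤ r₁ + r₂) (a : ℝ) :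
    ∃ C : ℝ, ∀ t : ℝ, 1 ≤ |t| → ‖archGamma r₁ r₂ (a + t * I)‖ ≤ C * (t ^ 2)⁻¹ := by
  obtain ⟨C, -, hC⟩ := exists_norm_archGamma_le r₁ r₂ hr a a
  refine ⟨C, fun t ht => ?_⟩
  simpa using hC (a + t * I) (by simp) (by simp) (by simpa using ht)

lemma continuous_modularIntegrand_line {r₁ r₂ : ℕ} {β : ℝ}
    (hζ_an : ∀ s : ℂ, s ≠ 1 → DifferentiableAt ℂ ζK s) (hβ : 0 < β) {a : ℝ} (ha : a < 2)
    (ha1 : a ≠ 1) (h : ∀ s : ℂ, s.re = a → ζK s ≠ 0) :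
    Continuous fun t : ℝ => modularIntegrand ζK r₁ r₂ β (a + t * I) := by
  refine continuous_iff_continuousAt.2 fun t => ?_
  have hre : ((a : ℂ) + t * I).re = a := by simp
  have h1 := (analyticAt_modularIntegrand (r₁ := r₁) (r₂ := r₂) (s := a + t * I) hζ_an hβ
    (by rwa [hre]) (fun h => ha1 (by rw [← hre, h, one_re])) (h _ hre)).continuousAt
  exact ContinuousAt.comp (f := fun t : ℝ => (a : ℂ) + t * I) h1
    (Continuous.continuousAt (by fun_prop))

lemma integrable_modularIntegrand_line_right {r₁ r₂ : ℕ} {β : ℝ}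
    (hζ_an : ∀ s : ℂ, s ≠ 1 → DifferentiableAt ℂ ζK s)
    (hζ_pole : ∃ A : ℂ, A ≠ 0 ∧
      Tendsto (fun s : ℂ => (s - 1) * ζK s) (𝓝[≠] (1 : ℂ)) (𝓝 A))
    {b : ℕ → ℝ}
    (hb : ∀ s : ℂ, 1 < s.re →
      HasSum (fun m : ℕ => (b m : ℂ) * (m : ℂ) ^ (-s)) (ζK s)⁻¹)
    (hr : 1 ≤ r₁ + r₂) (hβ : 0 < β) {a : ℝ} (ha : 1 < a) (ha' : a < 2) :
    Integrable fun t : ℝ => modularIntegrand ζK r₁ r₂ β (a + t * I) := by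
  obtain ⟨C, hC⟩ := exists_norm_archGamma_line_le hr (1 - a)
  obtain ⟨B, hB⟩ := exists_norm_zeta_inv_le hb ha
  refine integrable_of_norm_le_inv_sq (C := β ^ a * C * B)
    (continuous_modularIntegrand_line hζ_an hβ ha' ha.ne' fun s hs =>
      zeta_ne_zero_of_one_lt_re hζ_an hζ_pole hb (by rwa [hs])) fun t ht => ?_
  have hre : ((a : ℂ) + t * I).re = a := by simp
  have h1 := hC (-t) (by rwa [abs_neg])
  have e : ((1 - a : ℝ) : ℂ) + ((-t : ℝ) : ℂ) * I = 1 - (a + t * I) := by push_cast; ring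
  rw [e, neg_sq] at h1
  have h2 := hB (a + t * I) hre
  rw [modularIntegrand_eq, norm_mul, norm_mul, norm_cpow_eq_rpow_re_of_pos hβ, hre]
  have hC0 : 0 ≤ C * (t ^ 2)⁻¹ := (norm_nonneg _).trans h1
  calc β ^ a * ‖archGamma r₁ r₂ (1 - (a + t * I))‖ * ‖(ζK (a + t * I))⁻¹‖
      ≤ β ^ a * (C * (t ^ 2)⁻¹) * B := by gcongr
    _ = _ := by ring

lemma integrable_modularIntegrand_line_left
    (hζ_an : ∀ s : ℂ, s ≠ 1 → DifferentiableAt ℂ ζK s)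
    (hζ_ser : ∀ s : ℂ, 1 < s.re →
      HasSum (fun I : {I : Ideal (𝓞 K) // I ≠ ⊥} =>
        ((Ideal.absNorm I.1 : ℕ) : ℂ) ^ (-s)) (ζK s))
    (hζ_pole : ∃ A : ℂ, A ≠ 0 ∧
      Tendsto (fun s : ℂ => (s - 1) * ζK s) (𝓝[≠] (1 : ℂ)) (𝓝 A))
    {b : ℕ → ℝ}
    (hb : ∀ s : ℂ, 1 < s.re →
      HasSum (fun m : ℕ => (b m : ℂ) * (m : ℂ) ^ (-s)) (ζK s)⁻¹)
    (hr : 1 ≤ nrRealPlaces K + nrComplexPlaces K) {β : ℝ} (hβ : 0 < β) {a : ℝ} (ha : -1 < a)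
    (ha' : a < 0) :
    Integrable fun t : ℝ =>
      modularIntegrand ζK (nrRealPlaces K) (nrComplexPlaces K) β (a + t * I) := by
  obtain ⟨C, hC⟩ := exists_norm_archGamma_line_le hr a
  obtain ⟨B, hB⟩ := exists_norm_zeta_inv_le hb (σ := 1 - a) (by linarith)
  obtain ⟨η, hη⟩ : ∃ η : ℝ, η = 4 ^ nrComplexPlaces K * Real.pi ^ Module.finrank ℚ K /
    |(discr K : ℝ)| := ⟨_, rfl⟩
  have hη0 : 0 < η := by
    have := abs_discr_pos K
    have := Real.pi_pos
    rw [hη]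
    positivity
  have hne : ∀ s : ℂ, s.re = a → ∀ m : ℤ, s ≠ m := fun s hs m h => by
    rw [h, intCast_re] at hs
    have h1 : (-1 : ℤ) < m := by exact_mod_cast hs ▸ ha
    have h2 : m < 0 := by exact_mod_cast hs ▸ ha'
    omega
  have hz : ∀ s : ℂ, s.re = a → ζK s ≠ 0 := fun s hs =>
    zeta_ne_zero_of_re_nonpos hζ_an hζ_ser hζ_pole hb (by linarith) (hne s hs)
  refine integrable_of_norm_le_inv_sq (C := β ^ a * η ^ (1 / 2 - a) * C * B)
    (continuous_modularIntegrand_line hζ_an hβ (by linarith) (by linarith) hz) fun t ht => ?_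
  have hre : ((a : ℂ) + t * I).re = a := by simp
  have hre1 : (1 - ((a : ℂ) + t * I)).re = 1 - a := by rw [sub_re, hre, one_re]
  have hre2 : (1 / 2 - ((a : ℂ) + t * I)).re = 1 / 2 - a := by
    rw [sub_re, hre]; norm_num
  have h1 := hC t ht
  have h2 := hB _ hre1
  rw [modularIntegrand_eq_dual hζ_an hζ_ser hη (hne _ hre) (hz _ hre)
    (zeta_ne_zero_of_one_lt_re hζ_an hζ_pole hb (by rw [hre1]; linarith)), norm_mul, norm_mul,
    norm_mul, norm_cpow_eq_rpow_re_of_pos hβ, norm_cpow_eq_rpow_re_of_pos hη0, hre, hre2]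
  have hC0 : 0 ≤ C * (t ^ 2)⁻¹ := (norm_nonneg _).trans h1
  calc _ ≤ β ^ a * η ^ (1 / 2 - a) * (C * (t ^ 2)⁻¹) * B := by gcongr
    _ = _ := by ring

lemma integral_modularPolarSum {r₁ r₂ : ℕ} {β : ℝ} [Countable (NontrivialZero ζK)]
    (hsum : Summable (modularResidue ζK r₁ r₂ β)) (g h : ℂ → ℂ) (q : ℕ) {a : ℝ}
    (ha : a = -(1 / 4) ∨ a = 5 / 4) :
    Integrable (fun t : ℝ => modularPolarSum ζK r₁ r₂ β g h q (a + t * I)) ∧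
    ∫ t : ℝ, modularPolarSum ζK r₁ r₂ β g h q (a + t * I) = ((|a| / a - 1) * Real.pi : ℝ) *
      (∑' ρ, modularResidue ζK r₁ r₂ β ρ + iteratedDeriv q g 1 / q.factorial +
        iteratedDeriv q h 0 / q.factorial) := by
  have hsgn : ∀ x : ℝ, x ∈ Set.Icc (0 : ℝ) 1 → 1 / 4 ≤ |a - x| ∧ |a - x| ≤ 2 ∧
      |a - x| / (a - x) = |a| / a := by
    intro x hx
    rcases ha with rfl | rfl
    · have e1 : -(1 / 4) - x < 0 := by linarith [hx.1]
      rw [abs_of_neg e1, neg_div, div_self e1.ne]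
      refine ⟨by linarith [hx.1], by linarith [hx.2], ?_⟩
      norm_num [abs_of_pos]
    · have e1 : 0 < 5 / 4 - x := by linarith [hx.2]
      rw [abs_of_pos e1, div_self e1.ne']
      refine ⟨by linarith [hx.2], by linarith [hx.1], ?_⟩
      norm_num [abs_of_pos]
  have hρ : ∀ ρ : NontrivialZero ζK, ρ.1.re ∈ Set.Icc (0 : ℝ) 1 := fun ρ =>
    ⟨ρ.2.2.1.le, ρ.2.2.2.le⟩
  obtain ⟨i1, v1⟩ := integrable_polarSeries_line (ρ := Subtype.val) hsum.norm (a := a)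
    (fun ρ => (hsgn _ (hρ ρ)).1) (fun ρ => (hsgn _ (hρ ρ)).2.1)
  have m1 := hsgn 1 ⟨zero_le_one, le_rfl⟩
  have m0 := hsgn 0 ⟨le_rfl, zero_le_one⟩
  obtain ⟨i2, v2⟩ := integrable_polarPart_line g q m1.1 m1.2.1
  obtain ⟨i3, v3⟩ := integrable_polarPart_line h q m0.1 m0.2.1
  rw [m1.2.2, ofReal_one] at v2
  rw [ofReal_one] at i2
  rw [m0.2.2, ofReal_zero] at v3
  rw [ofReal_zero] at i3
  simp only [(hsgn _ (hρ _)).2.2] at v1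
  rw [tsum_mul_right] at v1
  simp only [modularPolarSum]
  have i12 : Integrable fun t : ℝ =>
      polarSeries (modularResidue ζK r₁ r₂ β) Subtype.val (a + t * I) +
        polarPart g 1 q (a + t * I) := i1.add i2
  refine ⟨i12.add i3, ?_⟩
  rw [integral_add i12 i3, integral_add i1 i2, v1, v2, v3]
  ring

/-- The residue theorem for `modularIntegrand` on the strip `-1/4 ≤ Re s ≤ 5/4`. -/
lemma integral_modularIntegrand_sub
    (hζ_an : ∀ s : ℂ, s ≠ 1 → DifferentiableAt ℂ ζK s)
    (hζ_ser : ∀ s : ℂ, 1 < s.re →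
      HasSum (fun I : {I : Ideal (𝓞 K) // I ≠ ⊥} =>
        ((Ideal.absNorm I.1 : ℕ) : ℂ) ^ (-s)) (ζK s))
    (hζ_pole : ∃ A : ℂ, A ≠ 0 ∧
      Tendsto (fun s : ℂ => (s - 1) * ζK s) (𝓝[≠] (1 : ℂ)) (𝓝 A))
    {b : ℕ → ℝ}
    (hb : ∀ s : ℂ, 1 < s.re →
      HasSum (fun m : ℕ => (b m : ℂ) * (m : ℂ) ^ (-s)) (ζK s)⁻¹)
    (hr : 1 ≤ nrRealPlaces K + nrComplexPlaces K) {β : ℝ} (hβ : 0 < β)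
    (hsimple : ∀ ρ : ℂ, ζK ρ = 0 → 0 < ρ.re → ρ.re < 1 → deriv ζK ρ ≠ 0)
    (hsum : Summable (modularResidue ζK (nrRealPlaces K) (nrComplexPlaces K) β))
    {g h : ℂ → ℂ} {q : ℕ} (hg : AnalyticAt ℂ g 1)
    (hg_eq : ∀ᶠ s in 𝓝[≠] (1 : ℂ), g s =
      (s - 1) ^ (q + 1) * modularIntegrand ζK (nrRealPlaces K) (nrComplexPlaces K) β s)
    (hh : AnalyticAt ℂ h 0)
    (hh_eq : ∀ᶠ s in 𝓝[≠] (0 : ℂ), h s =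
      (s - 0) ^ (q + 1) * modularIntegrand ζK (nrRealPlaces K) (nrComplexPlaces K) β s) :
    (∫ t : ℝ, modularIntegrand ζK (nrRealPlaces K) (nrComplexPlaces K) β
        (((5 / 4 : ℝ) : ℂ) + t * I)) -
      ∫ t : ℝ, modularIntegrand ζK (nrRealPlaces K) (nrComplexPlaces K) β
        (((-(1 / 4) : ℝ) : ℂ) + t * I) =
    2 * Real.pi * (∑' ρ, modularResidue ζK (nrRealPlaces K) (nrComplexPlaces K) β ρ +
      iteratedDeriv q g 1 / q.factorial + iteratedDeriv q h 0 / q.factorial) := by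
  set r₁ := nrRealPlaces K
  set r₂ := nrComplexPlaces K
  have hcount := countable_nontrivialZero hβ hsimple hsum
  have hstrip : ∀ s : ℂ, ζK s = 0 → -1 < s.re → s.re < 2 → s ≠ 0 → s ≠ 1 →
      0 < s.re ∧ s.re < 1 := fun s hs h1 _ h2 h3 =>
    zeta_zero_re_mem hζ_an hζ_ser hζ_pole hb s hs h1 h2 h3
  have hH : ∀ s : ℂ, -1 < s.re → s.re < 2 →
      AnalyticAt ℂ (modularRegular ζK r₁ r₂ β g h q) s := by
    intro s h1 h2
    obtain ⟨k, hk, hke⟩ := exists_analyticAt_modularIntegrand_sub_modularPolarSum hζ_an hζ_pole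
      hstrip hβ hsimple hsum hg hg_eq hh hh_eq h1 h2
    exact hk.congr (removeSingularities_eventuallyEq hk hke).symm
  obtain ⟨C, hC⟩ := exists_norm_modularRegular_le hζ_an hζ_ser hζ_pole hb hstrip hr hβ hsum
    hcount hH
  have hline : ∀ a : ℝ, (a = -(1 / 4) ∨ a = 5 / 4) →
      (fun t : ℝ => modularRegular ζK r₁ r₂ β g h q (a + t * I)) = fun t : ℝ =>
        modularIntegrand ζK r₁ r₂ β (a + t * I) -
          modularPolarSum ζK r₁ r₂ β g h q (a + t * I) := by
    intro a ha
    funext t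
    have hre : ((a : ℂ) + t * I).re = a := by simp
    have ha' : -1 < a ∧ a < 2 ∧ a ≠ 0 ∧ a ≠ 1 ∧ ¬ (0 < a ∧ a < 1) := by
      rcases ha with rfl | rfl <;> norm_num
    have h0 : (a : ℂ) + t * I ≠ 0 := fun h => ha'.2.2.1 (by rw [← hre, h, zero_re])
    have h1 : (a : ℂ) + t * I ≠ 1 := fun h => ha'.2.2.2.1 (by rw [← hre, h, one_re])
    refine removeSingularities_eq (analyticAt_modularIntegrand_sub_modularPolarSum hζ_an hζ_pole
      hβ hsum g h q (by rw [hre]; exact ha'.1) (by rw [hre]; exact ha'.2.1) h0 h1 fun hz => ?_)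
    have := hstrip _ hz (by rw [hre]; exact ha'.1) (by rw [hre]; exact ha'.2.1) h0 h1
    rw [hre] at this
    exact ha'.2.2.2.2 this
  have iL := integrable_modularIntegrand_line_left hζ_an hζ_ser hζ_pole hb hr hβ
    (a := -(1 / 4)) (by norm_num) (by norm_num)
  have iR := integrable_modularIntegrand_line_right (r₁ := r₁) (r₂ := r₂) hζ_an hζ_pole hb hr hβ
    (a := 5 / 4) (by norm_num) (by norm_num)
  obtain ⟨jL, vL⟩ := integral_modularPolarSum hsum g h q (a := -(1 / 4)) (Or.inl rfl)
  obtain ⟨jR, vR⟩ := integral_modularPolarSum hsum g h q (a := 5 / 4) (Or.inr rfl)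
  have key := integral_line_eq (H := modularRegular ζK r₁ r₂ β g h q) (a := -(1 / 4))
    (b := 5 / 4) (by norm_num)
    (fun s h1 h2 => (hH s (by linarith) (by linarith)).differentiableAt) hC
    (by rw [hline _ (Or.inl rfl)]; exact iL.sub jL)
    (by rw [hline _ (Or.inr rfl)]; exact iR.sub jR)
  rw [hline _ (Or.inl rfl), hline _ (Or.inr rfl), integral_sub iL jL, integral_sub iR jR, vL, vR]
    at key
  have eL : |(-(1 / 4) : ℝ)| / (-(1 / 4)) - 1 = -2 := by rw [abs_neg, abs_of_pos] <;> norm_num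
  have eR : |(5 / 4 : ℝ)| / (5 / 4) - 1 = 0 := by rw [abs_of_pos] <;> norm_num
  rw [eL, eR] at key
  push_cast at key ⊢
  linear_combination -key

end ModularContour

section ModularSeries

open InfinitePlace

variable {ζK : ℂ → ℂ} {r₁ r₂ : ℕ}

lemma integrable_cpow_mul_archGamma_line (hr : 1 ≤ r₁ + r₂) {x : ℝ} (hx : 0 < x) {a : ℝ}
    (ha : ∀ m : ℕ, a ≠ -m) :
    Integrable fun t : ℝ => (x : ℂ) ^ (-((a : ℂ) + t * I)) * archGamma r₁ r₂ (a + t * I) := by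
  obtain ⟨C, hC⟩ := exists_norm_archGamma_line_le hr a
  have hre : ∀ t : ℝ, ((a : ℂ) + t * I).re = a := fun t => by simp
  have hG : ∀ t : ℝ, ∀ m : ℕ, (a : ℂ) + t * I ≠ -m := fun t m h => ha m (by
    rw [← hre t, h, neg_re, natCast_re])
  have hG2 : ∀ t : ℝ, ∀ m : ℕ, ((a : ℂ) + t * I) / 2 ≠ -m := fun t m h =>
    hG t (2 * m) (by push_cast; linear_combination 2 * h)
  have hx0 : (x : ℂ) ≠ 0 := ofReal_ne_zero.2 hx.ne'
  refine integrable_of_norm_le_inv_sq (C := x ^ (-a) * C) ?_ fun t ht => ?_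
  · refine continuous_iff_continuousAt.2 fun t => ?_
    have hl : ContinuousAt (fun t : ℝ => (a : ℂ) + t * I) t := by fun_prop
    refine ContinuousAt.mul ?_ (ContinuousAt.mul (ContinuousAt.pow ?_ _) (ContinuousAt.pow ?_ _))
    · exact hl.neg.const_cpow (Or.inl hx0)
    · exact ContinuousAt.comp (f := fun t : ℝ => ((a : ℂ) + t * I) / 2)
        (analyticAt_Gamma (hG2 t)).continuousAt (hl.div_const 2)
    · exact ContinuousAt.comp (f := fun t : ℝ => (a : ℂ) + t * I)
        (analyticAt_Gamma (hG t)).continuousAt hl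
  · rw [norm_mul, norm_cpow_eq_rpow_re_of_pos hx, neg_re, hre, mul_assoc]
    gcongr
    exact hC t ht

lemma tsum_div_mul_Z (hr : 1 ≤ r₁ + r₂) {b : ℕ → ℝ}
    (hb : ∀ s : ℂ, 1 < s.re →
      HasSum (fun m : ℕ => (b m : ℂ) * (m : ℂ) ^ (-s)) (ζK s)⁻¹) {x : ℝ} (hx : 0 < x) :
    ∑' m : ℕ, ((b m : ℂ) / (m : ℂ)) * Z r₁ r₂ (x / m) =
      1 / (2 * Real.pi) * ∫ t : ℝ, (x : ℂ) ^ (-(((-(1 / 4) : ℝ) : ℂ) + t * I)) *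
        archGamma r₁ r₂ (((-(1 / 4) : ℝ) : ℂ) + t * I) *
          (ζK (1 - (((-(1 / 4) : ℝ) : ℂ) + t * I)))⁻¹ := by
  set S : ℝ → ℂ := fun t => ((-(1 / 4) : ℝ) : ℂ) + t * I with hS
  set G : ℝ → ℂ := fun t => (x : ℂ) ^ (-S t) * archGamma r₁ r₂ (S t) with hGdef
  have hre : ∀ t, (1 - S t).re = 5 / 4 := fun t => by simp [hS]; norm_num
  have hGi : Integrable G := integrable_cpow_mul_archGamma_line hr hx fun m h => by
    have h4 : (1 : ℝ) = ((4 * m : ℕ) : ℝ) := by push_cast; linarith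
    have : 1 = 4 * m := by exact_mod_cast h4
    omega
  have hnorm : ∀ (m : ℕ) (t : ℝ), ‖(b m : ℂ) * (m : ℂ) ^ (-(1 - S t))‖ =
      ‖(b m : ℂ) * (m : ℂ) ^ (-((5 / 4 : ℝ) : ℂ))‖ := by
    intro m t
    rcases m.eq_zero_or_pos with rfl | hm
    · have h1 : -(1 - S t) ≠ 0 := fun h => by
        have h2 := hre t
        rw [neg_eq_zero.1 h, zero_re] at h2; norm_num at h2
      have h2 : -((5 / 4 : ℝ) : ℂ) ≠ 0 := neg_ne_zero.2 (ofReal_ne_zero.2 (by norm_num))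
      rw [Nat.cast_zero, zero_cpow h1, zero_cpow h2]
    · rw [norm_mul, norm_mul, norm_natCast_cpow_of_pos hm, norm_natCast_cpow_of_pos hm, neg_re,
        hre, neg_re, ofReal_re]
  have hterm : ∀ m : ℕ, (b m : ℂ) / m * Z r₁ r₂ (x / m) =
      1 / (2 * Real.pi) * ∫ t, G t * ((b m : ℂ) * (m : ℂ) ^ (-(1 - S t))) := by
    intro m
    rcases m.eq_zero_or_pos with rfl | hm
    · have h1 : ∀ t, -(1 - S t) ≠ 0 := fun t h => by
        have h2 := hre t
        rw [neg_eq_zero.1 h, zero_re] at h2; norm_num at h2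
      simp only [Nat.cast_zero, zero_cpow (h1 _), div_zero, zero_mul, mul_zero, integral_zero]
    · have hm0 : (m : ℂ) ≠ 0 := Nat.cast_ne_zero.2 hm.ne'
      rw [Z, mellinInv, real_smul, mul_left_comm, ← integral_const_mul]
      push_cast
      congr 1
      refine integral_congr_ae (Eventually.of_forall fun t => ?_)
      have e : ((x / m : ℝ) : ℂ) ^ (-S t) = (x : ℂ) ^ (-S t) * (m : ℂ) ^ (S t) := by
        rw [div_eq_mul_inv, ofReal_mul, mul_cpow_ofReal_nonneg hx.le (by positivity), ofReal_inv,
          ofReal_natCast, inv_cpow _ _ (by rw [natCast_arg]; exact Real.pi_pos.ne), cpow_neg,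
          cpow_neg, inv_inv]
      have e2 : (m : ℂ) ^ (-(1 - S t)) = (m : ℂ) ^ S t / m := by
        rw [neg_sub, cpow_sub _ _ hm0, cpow_one]
      have e3 : S t = -(1 / 4) + t * I := by simp [hS]
      simp only [smul_eq_mul, hGdef, e2, archGamma]
      rw [← e3, ← ofReal_natCast m, ← ofReal_div x, e, ofReal_natCast]
      ring
  have hF : ∀ m : ℕ, Integrable fun t => G t * ((b m : ℂ) * (m : ℂ) ^ (-(1 - S t))) := by
    intro m
    refine hGi.mul_bdd (c := ‖(b m : ℂ) * (m : ℂ) ^ (-((5 / 4 : ℝ) : ℂ))‖) ?_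
      (Eventually.of_forall fun t => (hnorm m t).le)
    have h1 : ∀ t, -(1 - S t) ≠ 0 := fun t h => by
      have h2 := hre t
      rw [neg_eq_zero.1 h, zero_re] at h2; norm_num at h2
    refine (continuous_const.mul (continuous_iff_continuousAt.2 fun t => ?_)).aestronglyMeasurable
    have : ContinuousAt (fun t => -(1 - S t)) t := by simp only [hS]; fun_prop
    exact this.const_cpow (Or.inr (h1 t))
  have key := hasSum_integral_of_summable_integral_norm hF (by
    simp only [norm_mul (G _), hnorm, integral_mul_const]
    exact ((hb ((5 / 4 : ℝ) : ℂ) (by rw [ofReal_re]; norm_num)).summable.norm).mul_left _)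
  rw [tsum_congr hterm, tsum_mul_left, key.tsum_eq]
  congr 1
  refine integral_congr_ae (Eventually.of_forall fun t => ?_)
  simp only [tsum_mul_left]
  rw [(hb (1 - S t) (by rw [hre]; norm_num)).tsum_eq]

lemma sqrt_mul_tsum_right (hr : 1 ≤ r₁ + r₂) {b : ℕ → ℝ}
    (hb : ∀ s : ℂ, 1 < s.re →
      HasSum (fun m : ℕ => (b m : ℂ) * (m : ℂ) ^ (-s)) (ζK s)⁻¹) {β : ℝ} (hβ : 0 < β) :
    (Real.sqrt β : ℂ) * ∑' m : ℕ, ((b m : ℂ) / (m : ℂ)) * Z r₁ r₂ (β / m) =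
      1 / (2 * Real.pi * Real.sqrt β) *
        ∫ t : ℝ, modularIntegrand ζK r₁ r₂ β (((5 / 4 : ℝ) : ℂ) + t * I) := by
  have hβ0 : (β : ℂ) ≠ 0 := ofReal_ne_zero.2 hβ.ne'
  have hq : (Real.sqrt β : ℂ) ≠ 0 := ofReal_ne_zero.2 (Real.sqrt_pos.2 hβ).ne'
  have hqq : (β : ℂ) = Real.sqrt β * Real.sqrt β := by
    rw [← ofReal_mul, Real.mul_self_sqrt hβ.le]
  rw [tsum_div_mul_Z hr hb hβ]
  have e : ∫ t : ℝ, modularIntegrand ζK r₁ r₂ β (((5 / 4 : ℝ) : ℂ) + t * I) =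
      β * ∫ t : ℝ, (β : ℂ) ^ (-(((-(1 / 4) : ℝ) : ℂ) + t * I)) *
        archGamma r₁ r₂ (((-(1 / 4) : ℝ) : ℂ) + t * I) *
          (ζK (1 - (((-(1 / 4) : ℝ) : ℂ) + t * I)))⁻¹ := by
    rw [← integral_neg_eq_self, ← integral_const_mul]
    refine integral_congr_ae (Eventually.of_forall fun t => ?_)
    have e1 : ((5 / 4 : ℝ) : ℂ) + ((-t : ℝ) : ℂ) * I =
        1 - (((-(1 / 4) : ℝ) : ℂ) + t * I) := by push_cast; ring
    simp only [e1, modularIntegrand_eq]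
    rw [sub_sub_cancel, sub_eq_add_neg, cpow_add _ _ hβ0, cpow_one]
    ring
  rw [e]
  generalize (∫ t : ℝ, _ : ℂ) = J
  have hp : (Real.pi : ℂ) ≠ 0 := ofReal_ne_zero.2 Real.pi_ne_zero
  field_simp
  rw [sq, ← hqq, mul_comm]

variable {K : Type*} [Field K] [NumberField K]

lemma sqrt_mul_tsum_left
    (hζ_an : ∀ s : ℂ, s ≠ 1 → DifferentiableAt ℂ ζK s)
    (hζ_ser : ∀ s : ℂ, 1 < s.re →
      HasSum (fun I : {I : Ideal (𝓞 K) // I ≠ ⊥} =>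
        ((Ideal.absNorm I.1 : ℕ) : ℂ) ^ (-s)) (ζK s))
    (hζ_pole : ∃ A : ℂ, A ≠ 0 ∧
      Tendsto (fun s : ℂ => (s - 1) * ζK s) (𝓝[≠] (1 : ℂ)) (𝓝 A))
    {b : ℕ → ℝ}
    (hb : ∀ s : ℂ, 1 < s.re →
      HasSum (fun m : ℕ => (b m : ℂ) * (m : ℂ) ^ (-s)) (ζK s)⁻¹)
    (hr : 1 ≤ nrRealPlaces K + nrComplexPlaces K) {α β : ℝ} (hα : 0 < α) (hβ : 0 < β)
    (hαβ : α * β = 4 ^ nrComplexPlaces K * Real.pi ^ Module.finrank ℚ K / |(discr K : ℝ)|) :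
    (Real.sqrt α : ℂ) *
        ∑' m : ℕ, ((b m : ℂ) / (m : ℂ)) * Z (nrRealPlaces K) (nrComplexPlaces K) (α / m) =
      1 / (2 * Real.pi * Real.sqrt β) *
        ∫ t : ℝ, modularIntegrand ζK (nrRealPlaces K) (nrComplexPlaces K) β
          (((-(1 / 4) : ℝ) : ℂ) + t * I) := by
  have hα0 : (α : ℂ) ≠ 0 := ofReal_ne_zero.2 hα.ne'
  have hβ0 : (β : ℂ) ≠ 0 := ofReal_ne_zero.2 hβ.ne'
  have hq : (Real.sqrt β : ℂ) ≠ 0 := ofReal_ne_zero.2 (Real.sqrt_pos.2 hβ).ne'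
  rw [tsum_div_mul_Z hr hb hα]
  have e : ∫ t : ℝ, modularIntegrand ζK (nrRealPlaces K) (nrComplexPlaces K) β
          (((-(1 / 4) : ℝ) : ℂ) + t * I) =
      Real.sqrt α * Real.sqrt β * ∫ t : ℝ, (α : ℂ) ^ (-(((-(1 / 4) : ℝ) : ℂ) + t * I)) *
        archGamma (nrRealPlaces K) (nrComplexPlaces K) (((-(1 / 4) : ℝ) : ℂ) + t * I) *
          (ζK (1 - (((-(1 / 4) : ℝ) : ℂ) + t * I)))⁻¹ := by
    rw [← integral_const_mul]
    refine integral_congr_ae (Eventually.of_forall fun t => ?_)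
    have hre : (((-(1 / 4) : ℝ) : ℂ) + t * I).re = -(1 / 4) := by simp
    have hre1 : 1 < (1 - (((-(1 / 4) : ℝ) : ℂ) + t * I)).re := by
      rw [sub_re, hre, one_re]; norm_num
    have hne : ∀ m : ℤ, ((-(1 / 4) : ℝ) : ℂ) + t * I ≠ m := fun m h => by
      rw [h, intCast_re] at hre
      have h4 : ((4 * m : ℤ) : ℝ) = ((-1 : ℤ) : ℝ) := by push_cast; linarith
      have : 4 * m = -1 := by exact_mod_cast h4
      omega
    have hz := zeta_ne_zero_of_re_nonpos hζ_an hζ_ser hζ_pole hb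
      (by rw [hre]; norm_num) hne
    have hz1 := zeta_ne_zero_of_one_lt_re hζ_an hζ_pole hb hre1
    simp only [modularIntegrand_eq_dual hζ_an hζ_ser hαβ hne hz hz1]
    generalize ((-(1 / 4) : ℝ) : ℂ) + t * I = s
    rw [ofReal_mul, mul_cpow_ofReal_nonneg hα.le hβ.le, sub_eq_add_neg, cpow_add _ _ hα0,
      cpow_add _ _ hβ0, cpow_neg (β : ℂ), Real.sqrt_eq_rpow, Real.sqrt_eq_rpow,
      ofReal_cpow hα.le, ofReal_cpow hβ.le]
    have hs : (β : ℂ) ^ s ≠ 0 := by simp [cpow_eq_zero_iff, hβ0]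
    push_cast
    field_simp
  rw [e]
  generalize (∫ t : ℝ, _ : ℂ) = J
  have hp : (Real.pi : ℂ) ≠ 0 := ofReal_ne_zero.2 Real.pi_ne_zero
  field_simp

end ModularSeries

/-- A modular relation involving the non-trivial zeros of the Dedekind zeta function
(Theorem 1.3 of Dixit–Gupta–Vatwani).  Here `ζK` is the meromorphic continuation of the
Dedekind zeta function of the number field `K` (characterised by `hζ_an`, `hζ_ser`,
`hζ_pole`), `b` are the Dirichlet coefficients of `1/ζK`, and `g`, `h` are the analytic
continuations of `s ↦ (s-1)^r β^s Γ^{r₁}((1-s)/2) Γ^{r₂}(1-s)/ζK(s)` at `s = 1` and of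
`s ↦ s^r β^s Γ^{r₁}((1-s)/2) Γ^{r₂}(1-s)/ζK(s)` at `s = 0`, whose `(r-1)`-st derivatives
appear on the right-hand side. -/
theorem modular_relation_dedekind
    (K : Type*) [Field K] [NumberField K] (ζK : ℂ → ℂ)
    (hζ_an : ∀ s : ℂ, s ≠ 1 → DifferentiableAt ℂ ζK s)
    (hζ_ser : ∀ s : ℂ, 1 < s.re →
      HasSum (fun I : {I : Ideal (𝓞 K) // I ≠ ⊥} =>
        ((Ideal.absNorm I.1 : ℕ) : ℂ) ^ (-s)) (ζK s))
    (hζ_pole : ∃ A : ℂ, A ≠ 0 ∧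
      Tendsto (fun s : ℂ => (s - 1) * ζK s) (𝓝[≠] (1 : ℂ)) (𝓝 A))
    (b : ℕ → ℝ)
    (hb : ∀ s : ℂ, 1 < s.re →
      HasSum (fun m : ℕ => (b m : ℂ) * (m : ℂ) ^ (-s)) (ζK s)⁻¹)
    (r₁ r₂ n r : ℕ)
    (hr₁ : r₁ = InfinitePlace.nrRealPlaces K)
    (hr₂ : r₂ = InfinitePlace.nrComplexPlaces K)
    (hn : n = Module.finrank ℚ K)
    (hr : r = r₁ + r₂ - 1) (hr1 : 1 ≤ r)
    (η : ℝ) (hη : η = 4 ^ r₂ * Real.pi ^ n / |(discr K : ℝ)|)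
    (hsimple : ∀ ρ : ℂ, ζK ρ = 0 → 0 < ρ.re → ρ.re < 1 → deriv ζK ρ ≠ 0)
    (hconv : ∀ x : ℝ, 0 < x →
      Summable (fun ρ : {ρ : ℂ // ζK ρ = 0 ∧ 0 < ρ.re ∧ ρ.re < 1} =>
        (x : ℂ) ^ (ρ.1) * (Complex.Gamma ((1 - ρ.1) / 2)) ^ r₁ *
          (Complex.Gamma (1 - ρ.1)) ^ r₂ / deriv ζK ρ.1))
    (α β : ℝ) (hα : 0 < α) (hβ : 0 < β) (hαβ : α * β = η)
    (g h : ℂ → ℂ)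
    (hg : AnalyticAt ℂ g 1)
    (hg_eq : ∀ᶠ s in 𝓝[≠] (1 : ℂ), g s =
      (s - 1) ^ r * (β : ℂ) ^ s * (Complex.Gamma ((1 - s) / 2)) ^ r₁ *
        (Complex.Gamma (1 - s)) ^ r₂ / ζK s)
    (hh : AnalyticAt ℂ h 0)
    (hh_eq : ∀ᶠ s in 𝓝[≠] (0 : ℂ), h s =
      s ^ r * (β : ℂ) ^ s * (Complex.Gamma ((1 - s) / 2)) ^ r₁ *
        (Complex.Gamma (1 - s)) ^ r₂ / ζK s) :
    (Real.sqrt α : ℂ) * ∑' m : ℕ, ((b m : ℂ) / (m : ℂ)) * Z r₁ r₂ (α / m)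
      - (Real.sqrt β : ℂ) * ∑' m : ℕ, ((b m : ℂ) / (m : ℂ)) * Z r₁ r₂ (β / m)
    = -(1 / ((Real.sqrt β : ℂ) * (Nat.factorial (r - 1) : ℂ))) * iteratedDeriv (r - 1) g 1
      - (1 / ((Real.sqrt β : ℂ) * (Nat.factorial (r - 1) : ℂ))) * iteratedDeriv (r - 1) h 0
      - (1 / (Real.sqrt β : ℂ)) *
          ∑' ρ : {ρ : ℂ // ζK ρ = 0 ∧ 0 < ρ.re ∧ ρ.re < 1},
            (β : ℂ) ^ (ρ.1) * (Complex.Gamma ((1 - ρ.1) / 2)) ^ r₁ *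
              (Complex.Gamma (1 - ρ.1)) ^ r₂ / deriv ζK ρ.1 := by
  subst hr₁ hr₂ hn hη
  obtain ⟨q, rfl⟩ : ∃ q, r = q + 1 := ⟨r - 1, by omega⟩
  have hr' : 1 ≤ InfinitePlace.nrRealPlaces K + InfinitePlace.nrComplexPlaces K := by omega
  have key := integral_modularIntegrand_sub hζ_an hζ_ser hζ_pole hb hr' hβ hsimple (hconv β hβ)
    (q := q) hg (hg_eq.mono fun s hs => by rw [hs, modularIntegrand]; ring) hh
    (hh_eq.mono fun s hs => by rw [hs, modularIntegrand]; ring)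
  rw [sqrt_mul_tsum_left hζ_an hζ_ser hζ_pole hb hr' hα hβ hαβ, sqrt_mul_tsum_right hr' hb hβ,
    Nat.add_sub_cancel]
  have hq : (Real.sqrt β : ℂ) ≠ 0 := ofReal_ne_zero.2 (Real.sqrt_pos.2 hβ).ne'
  have hp : (Real.pi : ℂ) ≠ 0 := ofReal_ne_zero.2 Real.pi_ne_zero
  have hf : (q.factorial : ℂ) ≠ 0 := Nat.cast_ne_zero.2 q.factorial_ne_zero
  change _ = _ - _ - 1 / (Real.sqrt β : ℂ) * ∑' ρ, modularResidue ζK _ _ β ρ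
  rw [← mul_sub, ← neg_sub (∫ t : ℝ, modularIntegrand ζK _ _ β (((5 / 4 : ℝ) : ℂ) + t * I)), key]
  field_simp
  ring
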